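/- The skew Coppersmith–Winograd tensor T_{skewcw,2} ∈ ℂ³⊗ℂ³⊗ℂ³ satisfies BR(T_{skewcw,2}) = 5, and its Kronecker square satisfies BR(T_{skewcw,2} ⊠ T_{skewcw,2}) = 17; in particular the border rank of the Kronecker square is strictly less than BR(T_{skewcw,2})² = 25. -/

import Mathlib

open scoped BigOperators

noncomputable section

/-- A tensor `T ∈ ℂ^{ι₁} ⊗ ℂ^{ι₂} ⊗ ℂ^{ι₃}`, written in coordinates, has rank at most `r`
if it is a sum of `r` simple tensors. -/
def rankLE {ι₁ ι₂ ι₃ : Type*} (T : ι₁ → ι₂ → ι₃ → ℂ) (r : ℕ) : Prop :=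
  ∃ u : Fin r → ι₁ → ℂ, ∃ v : Fin r → ι₂ → ℂ, ∃ w : Fin r → ι₃ → ℂ,
    T = fun i j k => ∑ l, u l i * v l j * w l k

/-- The rank of a tensor. -/
def trank {ι₁ ι₂ ι₃ : Type*} (T : ι₁ → ι₂ → ι₃ → ℂ) : ℕ :=
  sInf {r | rankLE T r}

/-- The border rank of a tensor: the least `r` such that `T` is a limit of tensors of rank
at most `r` (closure in the Euclidean = product topology). -/
def brank {ι₁ ι₂ ι₃ : Type*} [Fintype ι₁] [Fintype ι₂] [Fintype ι₃]
    (T : ι₁ → ι₂ → ι₃ → ℂ) : ℕ :=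
  sInf {r | T ∈ closure {S : ι₁ → ι₂ → ι₃ → ℂ | rankLE S r}}

/-- The matrix multiplication tensor `M⟨a,b,c⟩ = Σ e_{ij} ⊗ e_{jk} ⊗ e_{ki}`. -/
def matMulTensor (a b c : ℕ) :
    (Fin a × Fin b) → (Fin b × Fin c) → (Fin c × Fin a) → ℂ :=
  fun x y z => if x.2 = y.1 ∧ y.2 = z.1 ∧ z.2 = x.1 then 1 else 0

/-- Kronecker product of tensors. -/
def kron {ι₁ ι₂ ι₃ κ₁ κ₂ κ₃ : Type*} (T : ι₁ → ι₂ → ι₃ → ℂ) (T' : κ₁ → κ₂ → κ₃ → ℂ) :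
    (ι₁ × κ₁) → (ι₂ × κ₂) → (ι₃ × κ₃) → ℂ :=
  fun i j k => T i.1 j.1 k.1 * T' i.2 j.2 k.2

/-- The little Coppersmith–Winograd tensor
`cw_q = Σ_{i=1}^q (e₀⊗eᵢ⊗eᵢ + eᵢ⊗e₀⊗eᵢ + eᵢ⊗eᵢ⊗e₀)`. -/
def cw (q : ℕ) : Fin (q + 1) → Fin (q + 1) → Fin (q + 1) → ℂ :=
  fun i j k =>
    if (i.val = 0 ∧ j = k ∧ j.val ≠ 0) ∨ (j.val = 0 ∧ i = k ∧ i.val ≠ 0) ∨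
       (k.val = 0 ∧ i = j ∧ i.val ≠ 0)
    then 1 else 0

/-- The big Coppersmith–Winograd tensor `CW_{m-2} ∈ ℂ^m ⊗ ℂ^m ⊗ ℂ^m` (for `m ≥ 3`). -/
def bigCW (m : ℕ) : Fin m → Fin m → Fin m → ℂ :=
  fun i j k =>
    if (i.val = 0 ∧ j.val = 0 ∧ k.val = m - 1) ∨
       (i.val = 0 ∧ j.val = m - 1 ∧ k.val = 0) ∨
       (i.val = m - 1 ∧ j.val = 0 ∧ k.val = 0) ∨
       (i.val = 0 ∧ j = k ∧ 1 ≤ j.val ∧ j.val ≤ m - 2) ∨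
       (j.val = 0 ∧ i = k ∧ 1 ≤ i.val ∧ i.val ≤ m - 2) ∨
       (k.val = 0 ∧ i = j ∧ 1 ≤ i.val ∧ i.val ≤ m - 2)
    then 1 else 0

/-- The skew Coppersmith–Winograd tensor `T_{skewcw,2} ∈ ℂ³⊗ℂ³⊗ℂ³`. -/
def skewCW2 : Fin 3 → Fin 3 → Fin 3 → ℂ :=
  fun i j k =>
    if (i = 0 ∧ j = 1 ∧ k = 1) ∨ (i = 0 ∧ j = 2 ∧ k = 2) ∨ (i = 1 ∧ j = 0 ∧ k = 1) ∨
       (i = 2 ∧ j = 0 ∧ k = 2) ∨ (i = 1 ∧ j = 2 ∧ k = 0)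
    then 1
    else if i = 2 ∧ j = 1 ∧ k = 0 then -1 else 0

/-- Action of a triple of linear maps (matrices) on a tensor. -/
def triApply {a b c a' b' c' : ℕ}
    (g₁ : Matrix (Fin a') (Fin a) ℂ) (g₂ : Matrix (Fin b') (Fin b) ℂ)
    (g₃ : Matrix (Fin c') (Fin c) ℂ) (T : Fin a → Fin b → Fin c → ℂ) :
    Fin a' → Fin b' → Fin c' → ℂ :=
  fun i j k => ∑ i', ∑ j', ∑ k', g₁ i i' * g₂ j j' * g₃ k k' * T i' j' k'

/-- The unit (diagonal) tensor `I_r ∈ ℂ^r ⊗ ℂ^r ⊗ ℂ^r`. -/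
def unitTensor (r : ℕ) : Fin r → Fin r → Fin r → ℂ :=
  fun i j k => if i = j ∧ j = k then 1 else 0

/-- The unit tensor `I_r = Σ_{ℓ=1}^r a_ℓ⊗b_ℓ⊗c_ℓ` embedded in `ℂ^a ⊗ ℂ^b ⊗ ℂ^c`
(for `r ≤ min{a,b,c}`). -/
def unitIn (a b c r : ℕ) : Fin a → Fin b → Fin c → ℂ :=
  fun i j k => if i.val = j.val ∧ j.val = k.val ∧ i.val < r then 1 else 0

/-- The subrank `Q(T)`: largest `r` so that linear maps take `T` to the unit tensor `I_r`. -/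
def subrank {a b c : ℕ} (T : Fin a → Fin b → Fin c → ℂ) : ℕ :=
  sSup {r | ∃ f : Matrix (Fin r) (Fin a) ℂ, ∃ g : Matrix (Fin r) (Fin b) ℂ,
    ∃ h : Matrix (Fin r) (Fin c) ℂ, triApply f g h T = unitTensor r}

/-- The `GL(A) × GL(B) × GL(C)`-orbit of a tensor. -/
def glOrbit {a b c : ℕ} (T : Fin a → Fin b → Fin c → ℂ) :
    Set (Fin a → Fin b → Fin c → ℂ) :=
  {S | ∃ g₁ : Matrix (Fin a) (Fin a) ℂ, ∃ g₂ : Matrix (Fin b) (Fin b) ℂ,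
    ∃ g₃ : Matrix (Fin c) (Fin c) ℂ, IsUnit g₁ ∧ IsUnit g₂ ∧ IsUnit g₃ ∧
      S = triApply g₁ g₂ g₃ T}

/-- The border subrank `Q̲(T)`: largest `r` (with `r ≤ min{a,b,c}`) such that `I_r` lies in
the closure of the `GL×GL×GL`-orbit of `T`. -/
def bsubrank {a b c : ℕ} (T : Fin a → Fin b → Fin c → ℂ) : ℕ :=
  sSup {r | r ≤ min a (min b c) ∧ unitIn a b c r ∈ closure (glOrbit T)}

/-- Multilinear rank in the `A`-factor: rank of the contraction `T_A : A* → B⊗C`. -/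
def mlA {a b c : ℕ} (T : Fin a → Fin b → Fin c → ℂ) : ℕ :=
  (Matrix.of fun (i : Fin a) (p : Fin b × Fin c) => T i p.1 p.2).rank

/-- Multilinear rank in the `B`-factor. -/
def mlB {a b c : ℕ} (T : Fin a → Fin b → Fin c → ℂ) : ℕ :=
  (Matrix.of fun (j : Fin b) (p : Fin a × Fin c) => T p.1 j p.2).rank

/-- Multilinear rank in the `C`-factor. -/
def mlC {a b c : ℕ} (T : Fin a → Fin b → Fin c → ℂ) : ℕ :=
  (Matrix.of fun (k : Fin c) (p : Fin a × Fin b) => T p.1 p.2 k).rank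

/-- `T` is `1_A`-generic: some contraction `T(α) : B* → C` has full rank `m`. -/
def oneAGeneric {m : ℕ} (T : Fin m → Fin m → Fin m → ℂ) : Prop :=
  ∃ α : Fin m → ℂ, (Matrix.of fun j k => ∑ i, α i * T i j k).rank = m

def oneBGeneric {m : ℕ} (T : Fin m → Fin m → Fin m → ℂ) : Prop :=
  ∃ β : Fin m → ℂ, (Matrix.of fun i k => ∑ j, β j * T i j k).rank = m

def oneCGeneric {m : ℕ} (T : Fin m → Fin m → Fin m → ℂ) : Prop :=
  ∃ γ : Fin m → ℂ, (Matrix.of fun i j => ∑ k, γ k * T i j k).rank = m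

/-- `T` is `1`-generic. -/
def oneGeneric {m : ℕ} (T : Fin m → Fin m → Fin m → ℂ) : Prop :=
  oneAGeneric T ∧ oneBGeneric T ∧ oneCGeneric T

/-- The symmetry Lie algebra `g̃_T ⊂ gl(A) ⊕ gl(B) ⊕ gl(C)` of a tensor, as a set. -/
def symLieSet {m : ℕ} (T : Fin m → Fin m → Fin m → ℂ) :
    Set (Matrix (Fin m) (Fin m) ℂ × Matrix (Fin m) (Fin m) ℂ × Matrix (Fin m) (Fin m) ℂ) :=
  {XYZ | ∀ i j k, (∑ i', XYZ.1 i i' * T i' j k) + (∑ j', XYZ.2.1 j j' * T i j' k) +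
    (∑ k', XYZ.2.2 k k' * T i j k') = 0}


set_option linter.unusedSectionVars false
set_option linter.unusedSimpArgs false
namespace BR
open Module

section InLow
variable {ι : Type} [Fintype ι]

def prj (wt : ι → ℤ) (w : ℤ) : (ι → ℂ) →ₗ[ℂ] (ι → ℂ) where
  toFun x := fun i => if wt i = w then x i else 0
  map_add' x y := by ext i; by_cases h : wt i = w <;> simp [h]
  map_smul' c x := by ext i; by_cases h : wt i = w <;> simp [h]

theorem prj_apply (wt : ι → ℤ) (w : ℤ) (x : ι → ℂ) (i : ι) :
    prj wt w x i = if wt i = w then x i else 0 := rfl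

def vHi (wt : ι → ℤ) (w : ℤ) : Submodule ℂ (ι → ℂ) where
  carrier := {x | ∀ i, wt i < w → x i = 0}
  add_mem' ha hb i hi := by simp [ha i hi, hb i hi]
  zero_mem' i _ := rfl
  smul_mem' c x hx i hi := by simp [hx i hi]

def vLo (wt : ι → ℤ) (w : ℤ) : Submodule ℂ (ι → ℂ) where
  carrier := {x | ∀ i, w < wt i → x i = 0}
  add_mem' ha hb i hi := by simp [ha i hi, hb i hi]
  zero_mem' i _ := rfl
  smul_mem' c x hx i hi := by simp [hx i hi]

def inLow (wt : ι → ℤ) (X : Submodule ℂ (ι → ℂ)) : Submodule ℂ (ι → ℂ) :=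
  ⨅ w : ℤ, ((X ⊓ vHi wt w).map (prj wt w)).comap (prj wt w)

theorem mem_inLow {wt : ι → ℤ} {X : Submodule ℂ (ι → ℂ)} {y : ι → ℂ} :
    y ∈ inLow wt X ↔ ∀ w, ∃ x ∈ X, (∀ i, wt i < w → x i = 0) ∧ ∀ i, wt i = w → x i = y i := by
  simp only [inLow, Submodule.mem_iInf, Submodule.mem_comap, Submodule.mem_map]
  refine forall_congr' fun w => ?_
  constructor
  · rintro ⟨x, ⟨hx, hx2⟩, h⟩
    refine ⟨x, hx, hx2, fun i hi => ?_⟩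
    have := congrFun h i
    simpa [prj_apply, hi] using this
  · rintro ⟨x, hx, hx2, h⟩
    refine ⟨x, ⟨hx, hx2⟩, ?_⟩
    ext i
    by_cases hi : wt i = w
    · simp [prj_apply, hi, h i hi]
    · simp [prj_apply, hi]

def Graded (wt : ι → ℤ) (X : Submodule ℂ (ι → ℂ)) : Prop :=
  ∀ x ∈ X, ∀ w, prj wt w x ∈ X

theorem graded_inLow (wt : ι → ℤ) (X : Submodule ℂ (ι → ℂ)) : Graded wt (inLow wt X) := by
  intro x hx w
  rw [mem_inLow] at hx ⊢
  intro w'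
  by_cases h : w' = w
  · subst h
    obtain ⟨z, hz, h1, h2⟩ := hx w'
    exact ⟨z, hz, h1, fun i hi => by simp [prj_apply, hi, h2 i hi]⟩
  · exact ⟨0, X.zero_mem, fun _ _ => rfl, fun i hi => by simp [prj_apply, hi, h]⟩

theorem finrank_step (wt : ι → ℤ) (X : Submodule ℂ (ι → ℂ)) (w : ℤ) :
    finrank ℂ ((X ⊓ vHi wt w).map (prj wt w)) + finrank ℂ ↥(X ⊓ vHi wt (w+1))
      = finrank ℂ ↥(X ⊓ vHi wt w) := by
  have h := LinearMap.finrank_range_add_finrank_ker ((prj wt w).domRestrict (X ⊓ vHi wt w))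
  rw [← h, LinearMap.range_domRestrict]
  congr 1
  have : (X ⊓ vHi wt (w+1)) =
    (LinearMap.ker ((prj wt w).domRestrict (X ⊓ vHi wt w))).map (X ⊓ vHi wt w).subtype := by
    ext x
    simp only [Submodule.mem_map, LinearMap.mem_ker, LinearMap.domRestrict_apply]
    constructor
    · rintro ⟨hx, h2⟩
      refine ⟨⟨x, hx, fun i hi => h2 i (by omega)⟩, ?_, rfl⟩
      ext i
      by_cases hi : wt i = w
      · simp [prj_apply, hi, h2 i (by omega)]
      · simp [prj_apply, hi]
    · rintro ⟨⟨y, hy, hy2⟩, h, rfl⟩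
      refine ⟨hy, fun i hi => ?_⟩
      by_cases hi' : wt i = w
      · have := congrFun h i
        simpa [prj_apply, hi'] using this
      · exact hy2 i (by omega)
  rw [this]
  exact LinearEquiv.finrank_eq (Submodule.equivMapOfInjective _ (Submodule.injective_subtype _) _).symm

theorem map_inLow (wt : ι → ℤ) (X : Submodule ℂ (ι → ℂ)) (w : ℤ) :
    (inLow wt X ⊓ vHi wt w).map (prj wt w) = (X ⊓ vHi wt w).map (prj wt w) := by
  apply le_antisymm
  · rintro _ ⟨y, ⟨hy, -⟩, rfl⟩
    simp only [SetLike.mem_coe, inLow, Submodule.mem_iInf, Submodule.mem_comap] at hy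
    exact hy w
  · rintro _ ⟨x, ⟨hx, hx2⟩, rfl⟩
    refine ⟨prj wt w x, ⟨?_, ?_⟩, ?_⟩
    · rw [SetLike.mem_coe, mem_inLow]
      intro w'
      by_cases h : w' = w
      · subst h
        exact ⟨x, hx, hx2, fun i hi => by simp [prj_apply, hi]⟩
      · exact ⟨0, X.zero_mem, fun _ _ => rfl, fun i hi => by simp [prj_apply, hi, h]⟩
    · intro i hi
      simp [prj_apply, hi.ne]
    · ext i
      by_cases hi : wt i = w <;> simp [prj_apply, hi]

variable (wt : ι → ℤ) (M : ℤ)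

theorem finrank_inLow_hi (hM : ∀ i, wt i ≤ M) (X : Submodule ℂ (ι → ℂ)) (w : ℤ) :
    finrank ℂ ↥(inLow wt X ⊓ vHi wt w) = finrank ℂ ↥(X ⊓ vHi wt w) := by
  have key : ∀ n : ℕ, ∀ w, M + 1 - n ≤ w →
      finrank ℂ ↥(inLow wt X ⊓ vHi wt w) = finrank ℂ ↥(X ⊓ vHi wt w) := by
    intro n
    induction n with
    | zero =>
      intro w hw
      have : vHi wt w = ⊥ := by
        rw [eq_bot_iff]
        intro x hx
        rw [Submodule.mem_bot]
        ext i
        exact hx i (by have := hM i; push_cast at hw; omega)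
      rw [this, inf_bot_eq, inf_bot_eq]
    | succ n ih =>
      intro w hw
      rw [← finrank_step, ← finrank_step wt X w, map_inLow, ih (w+1) (by push_cast at hw; omega)]
  exact key (M + 1 - w).toNat w (by omega)

theorem vHi_top (h0 : ∀ i, 0 ≤ wt i) : vHi wt 0 = ⊤ := by
  rw [eq_top_iff]
  intro x _ i hi
  have := h0 i
  omega

theorem finrank_inLow (h0 : ∀ i, 0 ≤ wt i) (hM : ∀ i, wt i ≤ M) (X : Submodule ℂ (ι → ℂ)) :
    finrank ℂ (inLow wt X) = finrank ℂ X := by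
  have := finrank_inLow_hi wt M hM X 0
  rwa [vHi_top wt h0, inf_top_eq, inf_top_eq] at this

def phi (X : Submodule ℂ (ι → ℂ)) : ℕ :=
  ∑ w ∈ Finset.Icc (0:ℤ) M, finrank ℂ ↥(X ⊓ vLo wt w)

theorem lo_hi_bot (w : ℤ) : vLo wt w ⊓ vHi wt (w+1) = ⊥ := by
  rw [eq_bot_iff]
  rintro x ⟨h1, h2⟩
  rw [Submodule.mem_bot]
  ext i
  by_cases h : wt i < w + 1
  · exact h2 i h
  · exact h1 i (by omega)

theorem finrank_lo_hi (X : Submodule ℂ (ι → ℂ)) (w : ℤ) :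
    finrank ℂ ↥(X ⊓ vLo wt w ⊔ X ⊓ vHi wt (w+1)) =
    finrank ℂ ↥(X ⊓ vLo wt w) + finrank ℂ ↥(X ⊓ vHi wt (w+1)) := by
  have := Submodule.finrank_sup_add_finrank_inf_eq (X ⊓ vLo wt w) (X ⊓ vHi wt (w+1))
  rw [← this]
  have h : X ⊓ vLo wt w ⊓ (X ⊓ vHi wt (w + 1)) = ⊥ := by
    rw [eq_bot_iff, ← lo_hi_bot wt w]
    exact le_inf (inf_le_left.trans inf_le_right) (inf_le_right.trans inf_le_right)
  rw [h]; simp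

theorem trunc_eq (x : ι → ℂ) (M : ℤ) (h0 : ∀ i, 0 ≤ wt i) :
    (∑ w ∈ Finset.Icc (0:ℤ) M, prj wt w x) = fun i => if wt i ≤ M then x i else 0 := by
  ext i
  rw [Finset.sum_apply]
  simp only [prj_apply]
  rw [Finset.sum_ite_eq]
  simp [h0 i]

theorem sum_prj (x : ι → ℂ) (h0 : ∀ i, 0 ≤ wt i) (hM : ∀ i, wt i ≤ M) :
    (∑ w ∈ Finset.Icc (0:ℤ) M, prj wt w x) = x := by
  rw [trunc_eq wt x M h0]; ext i; simp [hM i]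

theorem graded_sup {X : Submodule ℂ (ι → ℂ)} (h0 : ∀ i, 0 ≤ wt i)
    (hX : Graded wt X) (w : ℤ) : X ⊓ vLo wt w ⊔ X ⊓ vHi wt (w+1) = X := by
  apply le_antisymm (sup_le inf_le_left inf_le_left)
  intro x hx
  have h1 : (∑ w ∈ Finset.Icc (0:ℤ) w, prj wt w x) ∈ X := X.sum_mem fun w' _ => hX x hx w'
  rw [trunc_eq wt x w h0] at h1
  rw [Submodule.mem_sup]
  refine ⟨_, ⟨h1, ?_⟩, _, ⟨X.sub_mem hx h1, ?_⟩, by abel⟩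
  · intro i hi
    simp [hi]
  · intro i hi
    simp [show wt i ≤ w by omega]

theorem finrank_lo_le (h0 : ∀ i, 0 ≤ wt i) (hM : ∀ i, wt i ≤ M) (X : Submodule ℂ (ι → ℂ)) (w : ℤ) :
    finrank ℂ ↥(X ⊓ vLo wt w) ≤ finrank ℂ ↥(inLow wt X ⊓ vLo wt w) ∧
    (finrank ℂ ↥(X ⊓ vLo wt w) = finrank ℂ ↥(inLow wt X ⊓ vLo wt w) →
      X ⊓ vLo wt w ⊔ X ⊓ vHi wt (w+1) = X) := by
  have a1 := finrank_lo_hi wt X w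
  have a2 := finrank_lo_hi wt (inLow wt X) w
  rw [graded_sup wt h0 (graded_inLow wt X), finrank_inLow wt M h0 hM, finrank_inLow_hi wt M hM] at a2
  have hle : X ⊓ vLo wt w ⊔ X ⊓ vHi wt (w+1) ≤ X := sup_le inf_le_left inf_le_left
  have a3 := Submodule.finrank_mono hle
  refine ⟨by omega, fun h => Submodule.eq_of_le_of_finrank_eq hle (by omega)⟩

theorem phi_le (h0 : ∀ i, 0 ≤ wt i) (hM : ∀ i, wt i ≤ M) (X : Submodule ℂ (ι → ℂ)) :
    phi wt M X ≤ phi wt M (inLow wt X) :=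
  Finset.sum_le_sum fun w _ => (finrank_lo_le wt M h0 hM X w).1

theorem graded_of_phi_eq (h0 : ∀ i, 0 ≤ wt i) (hM : ∀ i, wt i ≤ M) (X : Submodule ℂ (ι → ℂ))
    (h : phi wt M (inLow wt X) ≤ phi wt M X) : Graded wt X := by
  have h1 : ∀ w ∈ Finset.Icc (0:ℤ) M, finrank ℂ ↥(X ⊓ vLo wt w) = finrank ℂ ↥(inLow wt X ⊓ vLo wt w) :=
    (Finset.sum_eq_sum_iff_of_le fun w _ => (finrank_lo_le wt M h0 hM X w).1).1
      (le_antisymm (phi_le wt M h0 hM X) h)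
  have tr : ∀ x ∈ X, ∀ w, (fun i => if wt i ≤ w then x i else 0) ∈ X := by
    intro x hx w
    by_cases hw0 : w < 0
    · have e : (fun i => if wt i ≤ w then x i else 0) = 0 := by
        funext i
        have := h0 i
        simp [show ¬ wt i ≤ w by omega]
      rw [e]
      exact X.zero_mem
    by_cases hw1 : M < w
    · have e : (fun i => if wt i ≤ w then x i else 0) = x := by
        funext i
        have := hM i
        simp [show wt i ≤ w by omega]
      rw [e]
      exact hx
    have := (finrank_lo_le wt M h0 hM X w).2 (h1 w (by simp; omega))
    rw [← this, Submodule.mem_sup] at hx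
    obtain ⟨y, ⟨hy, hy2⟩, z, ⟨hz, hz2⟩, rfl⟩ := hx
    have e : (fun i => if wt i ≤ w then (y + z) i else 0) = y := by
      funext i
      by_cases hi : wt i ≤ w
      · simp [hi, hz2 i (by omega)]
      · simp [hi, hy2 i (by omega)]
    rw [e]
    exact hy
  intro x hx w
  have := X.sub_mem (tr x hx w) (tr x hx (w-1))
  convert this using 1
  ext i
  simp only [prj_apply, Pi.sub_apply]
  by_cases hi : wt i = w
  · simp [hi]
  · by_cases h2 : wt i ≤ w
    · simp [hi, h2, show wt i ≤ w - 1 by omega]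
    · simp [hi, h2, show ¬ wt i ≤ w - 1 by omega]

theorem phi_bound (X : Submodule ℂ (ι → ℂ)) :
    phi wt M X ≤ (Finset.Icc (0:ℤ) M).card * Fintype.card ι := by
  unfold phi
  rw [← smul_eq_mul]
  apply Finset.sum_le_card_nsmul
  intro w _
  have := Submodule.finrank_le (X ⊓ vLo wt w)
  simpa using this

/-- invariance of phi under a lowering automorphism -/
theorem phi_map (g : (ι → ℂ) ≃ₗ[ℂ] (ι → ℂ)) (hg : ∀ w, ∀ x ∈ vLo wt w, g x ∈ vLo wt w)
    (X : Submodule ℂ (ι → ℂ)) : phi wt M X ≤ phi wt M (X.map (g : (ι → ℂ) →ₗ[ℂ] (ι → ℂ))) := by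
  apply Finset.sum_le_sum
  intro w _
  rw [← LinearEquiv.finrank_map_eq g (X ⊓ vLo wt w)]
  apply Submodule.finrank_mono
  rintro _ ⟨x, ⟨hx, hx2⟩, rfl⟩
  exact ⟨⟨x, hx, rfl⟩, hg w x hx2⟩

variable {κ : Type} [Fintype κ]

/-- homogeneous maps are compatible with `inLow` -/
theorem inLow_map {wt : ι → ℤ} {wt' : κ → ℤ} (δ : ℤ) (ρ : (ι → ℂ) →ₗ[ℂ] (κ → ℂ))
    (hρ : ∀ x i', (∀ i, wt i = wt' i' + δ → x i = 0) → ρ x i' = 0)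
    {X : Submodule ℂ (ι → ℂ)} {X' : Submodule ℂ (κ → ℂ)} (h : ∀ x ∈ X, ρ x ∈ X') :
    ∀ x ∈ inLow wt X, ρ x ∈ inLow wt' X' := by
  intro y hy
  rw [mem_inLow] at hy ⊢
  intro w
  obtain ⟨x, hx, h1, h2⟩ := hy (w + δ)
  refine ⟨ρ x, h x hx, fun i' hi' => hρ x i' fun i hi => h1 i (by omega), fun i' hi' => ?_⟩
  have := hρ (x - y) i' fun i hi => by simp [h2 i (by omega)]
  rw [map_sub, Pi.sub_apply, sub_eq_zero] at this
  exact this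

theorem mem_inLow_of_hom {wt : ι → ℤ} {X : Submodule ℂ (ι → ℂ)} {x : ι → ℂ} (hx : x ∈ X) (w : ℤ)
    (h : ∀ i, wt i ≠ w → x i = 0) : x ∈ inLow wt X := by
  rw [mem_inLow]
  intro w'
  by_cases hw : w' = w
  · subst hw
    exact ⟨x, hx, fun i hi => h i hi.ne, fun _ _ => rfl⟩
  · exact ⟨0, X.zero_mem, fun _ _ => rfl, fun i hi => by rw [h i (by omega)]; rfl⟩

theorem inLow_mono {wt : ι → ℤ} {X Y : Submodule ℂ (ι → ℂ)} (h : X ≤ Y) : inLow wt X ≤ inLow wt Y := by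
  intro y hy
  rw [mem_inLow] at hy ⊢
  intro w
  obtain ⟨x, hx, h1⟩ := hy w
  exact ⟨x, h hx, h1⟩

end InLow
end BR

set_option linter.unusedSectionVars false
set_option linter.unusedSimpArgs false
namespace BR
open Module Filter Topology

section Lim
variable {ι : Type} [Fintype ι]

abbrev UU : Ultrafilter ℕ := Filter.hyperfilter ℕ

theorem exists_lim (d : ℕ) (X : ℕ → Submodule ℂ (ι → ℂ)) (hd : ∀ n, finrank ℂ (X n) = d) :
    ∃ Y : Submodule ℂ (ι → ℂ), finrank ℂ Y = d ∧
      (∀ y ∈ Y, ∃ x : ℕ → ι → ℂ, (∀ n, x n ∈ X n) ∧ Tendsto x UU (𝓝 y)) ∧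
      (∀ (x : ℕ → ι → ℂ) y, (∀ n, x n ∈ X n) → Tendsto x UU (𝓝 y) → y ∈ Y) := by
  classical
  let e := EuclideanSpace.equiv ι ℂ
  let E := EuclideanSpace ℂ ι
  let X' : ℕ → Submodule ℂ E := fun n => (X n).map (e.symm.toLinearEquiv : (ι → ℂ) →ₗ[ℂ] E)
  have hX' : ∀ n, finrank ℂ (X' n) = d := fun n => by
    rw [← hd n]; exact LinearEquiv.finrank_map_eq e.symm.toLinearEquiv (X n)
  have hb : ∀ n, ∃ u : Fin d → E, Orthonormal ℂ u ∧ Submodule.span ℂ (Set.range u) = X' n := by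
    intro n
    let b := (stdOrthonormalBasis ℂ (X' n)).reindex (finCongr (hX' n))
    refine ⟨fun i => (b i : E), ?_, ?_⟩
    · exact b.orthonormal.comp_linearIsometry (X' n).subtypeₗᵢ
    · have h2 := b.toBasis.span_eq
      have : (Set.range fun i => (b i : E)) = (X' n).subtype '' Set.range b.toBasis := by
        rw [← Set.range_comp]; congr 1
      rw [this, ← Submodule.map_span, h2]
      simp
  choose u hu hspan using hb
  have hlim : ∃ v : Fin d → E, Tendsto u UU (𝓝 v) := by
    have hK : IsCompact (Metric.closedBall (0 : Fin d → E) 1) := isCompact_closedBall _ _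
    have := hK.ultrafilter_le_nhds (UU.map u) (by
      simp only [le_principal_iff]
      rw [Ultrafilter.mem_coe, Ultrafilter.mem_map]
      apply Filter.mem_of_superset Filter.univ_mem
      intro n _
      simp only [Set.mem_preimage, Metric.mem_closedBall, dist_zero_right]
      rw [pi_norm_le_iff_of_nonneg zero_le_one]
      intro i
      rw [(hu n).1 i])
    obtain ⟨v, -, hv⟩ := this
    exact ⟨v, hv⟩
  obtain ⟨v, hv⟩ := hlim
  have hvi : ∀ i, Tendsto (fun n => u n i) UU (𝓝 (v i)) := fun i => (tendsto_pi_nhds.1 hv) i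
  have hvo : Orthonormal ℂ v := by
    rw [orthonormal_iff_ite]
    intro i j
    have h1 : Tendsto (fun n => inner ℂ (u n i) (u n j)) UU (𝓝 (inner ℂ (v i) (v j))) :=
      (hvi i).inner (hvi j)
    have h2 : (fun n => inner ℂ (u n i) (u n j)) = fun _ => if i = j then (1:ℂ) else 0 := by
      funext n
      exact orthonormal_iff_ite.1 (hu n) i j
    rw [h2] at h1
    exact (tendsto_nhds_unique h1 tendsto_const_nhds)
  let Y' : Submodule ℂ E := Submodule.span ℂ (Set.range v)
  have hexp : ∀ n, ∀ x ∈ X' n, x = ∑ i, inner ℂ (u n i) x • u n i := by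
    intro n x hx
    rw [← hspan n] at hx
    obtain ⟨c, rfl⟩ := (Submodule.mem_span_range_iff_exists_fun ℂ).1 hx
    apply Finset.sum_congr rfl
    intro i _
    rw [(hu n).inner_right_fintype]
  have emem : ∀ n x, x ∈ X n ↔ e.symm x ∈ X' n := by
    intro n x
    constructor
    · intro h; exact ⟨x, h, rfl⟩
    · rintro ⟨y, hy, h⟩
      have : y = x := e.symm.injective h
      rwa [← this]
  refine ⟨Y'.map (e.toLinearEquiv : E →ₗ[ℂ] (ι → ℂ)), ?_, ?_, ?_⟩
  · rw [LinearEquiv.finrank_map_eq e.toLinearEquiv Y']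
    simpa using finrank_span_eq_card hvo.linearIndependent
  · rintro _ ⟨y, hy, rfl⟩
    obtain ⟨c, rfl⟩ := (Submodule.mem_span_range_iff_exists_fun ℂ).1 hy
    refine ⟨fun n => e (∑ i, c i • u n i), fun n => ?_, ?_⟩
    · rw [emem, e.symm_apply_apply, ← hspan n]
      exact Submodule.sum_mem _ fun i _ => Submodule.smul_mem _ _ (Submodule.subset_span ⟨i, rfl⟩)
    · apply (e.continuous.tendsto _).comp
      exact tendsto_finsetSum _ fun i _ => (hvi i).const_smul (c i)
  · intro x y hx hxy
    have h1 : Tendsto (fun n => e.symm (x n)) UU (𝓝 (e.symm y)) :=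
      (e.symm.continuous.tendsto _).comp hxy
    have h2 : Tendsto (fun n => ∑ i, inner ℂ (u n i) (e.symm (x n)) • u n i) UU
        (𝓝 (∑ i, inner ℂ (v i) (e.symm y) • v i)) :=
      tendsto_finsetSum _ fun i _ => ((hvi i).inner h1).smul (hvi i)
    have h3 : (fun n => ∑ i, inner ℂ (u n i) (e.symm (x n)) • u n i) = fun n => e.symm (x n) := by
      funext n
      exact (hexp n _ ((emem n _).1 (hx n))).symm
    rw [h3] at h2
    have h4 := tendsto_nhds_unique h1 h2
    refine ⟨e.symm y, ?_, e.apply_symm_apply y⟩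
    rw [h4]
    exact Submodule.sum_mem _ fun i _ => Submodule.smul_mem _ _ (Submodule.subset_span ⟨i, rfl⟩)

/-- generic independence along a curve -/
theorem eventually_li {κ : Type} [Fintype κ] [DecidableEq κ] (v : κ → ℂ → ι → ℂ)
    (hv : ∀ k i, Differentiable ℂ fun s => v k s i)
    (h1 : LinearIndependent ℂ fun k => v k 1) :
    ∀ᶠ s in 𝓝[≠] (0:ℂ), LinearIndependent ℂ fun k => v k s := by
  classical
  obtain ⟨L, hL⟩ := (Fintype.linearCombination ℂ (fun k => v k 1)).exists_leftInverse_of_injective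
    (linearIndependent_iff_injective_fintypeLinearCombination.1 h1 |> LinearMap.ker_eq_bot.2)
  let f : ℂ → ℂ := fun s => (Matrix.of fun k j => L (v k s) j).det
  have hf : Differentiable ℂ f := by
    have : ∀ k j, Differentiable ℂ fun s => L (v k s) j := by
      intro k j
      have h : Differentiable ℂ (fun s => v k s) := differentiable_pi.2 (hv k)
      have h2 : Differentiable ℂ (fun s => LinearMap.toContinuousLinearMap L (v k s)) :=
        (LinearMap.toContinuousLinearMap L).differentiable.comp h
      exact differentiable_pi.1 h2 j
    have e : f = fun s => ∑ σ : Equiv.Perm κ, ((Equiv.Perm.sign σ : ℤ) : ℂ) * ∏ i, L (v (σ i) s) i := by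
      funext s
      simp only [f, Matrix.det_apply', Matrix.of_apply]
    rw [e]
    refine Differentiable.fun_sum fun σ _ => Differentiable.const_mul ?_ _
    exact fun z => DifferentiableAt.fun_finsetProd fun i _ => this _ _ z
  have hf1 : f 1 ≠ 0 := by
    have : (Matrix.of fun k j => L (v k 1) j) = (1 : Matrix κ κ ℂ) := by
      ext k j
      have := congrFun (congrArg DFunLike.coe hL) (Pi.single k 1)
      simp [Fintype.linearCombination_apply_single] at this
      simp [this, Matrix.one_apply, Pi.single_apply, eq_comm]
    simp only [f, this, Matrix.det_one]
    exact one_ne_zero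
  have han : AnalyticOnNhd ℂ f Set.univ := fun z _ => hf.analyticAt z
  have hne : ∀ᶠ s in 𝓝[≠] (0:ℂ), f s ≠ 0 := by
    rcases (han 0 trivial).eventually_eq_zero_or_eventually_ne_zero with h | h
    · exfalso
      have := han.eqOn_zero_of_preconnected_of_eventuallyEq_zero isPreconnected_univ trivial h
      exact hf1 (this (Set.mem_univ 1))
    · exact h
  filter_upwards [hne] with s hs
  have h2 : LinearIndependent ℂ (fun k => L (v k s)) := by
    have := Matrix.linearIndependent_rows_of_det_ne_zero hs
    exact this
  exact LinearIndependent.of_comp L h2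

end Lim
end BR

set_option linter.unusedSectionVars false
set_option linter.unusedSimpArgs false
namespace BR
open Module Filter Topology

abbrev I := Fin 9
abbrev V1 := I → ℂ
abbrev V2 := I × I → ℂ
abbrev V3 := I × I × I → ℂ

def w1 : I → ℤ := ![0,7,21,1,8,22,3,10,24]
def w2 (p : I × I) : ℤ := w1 p.1 + w1 p.2
def w3 (p : I × I × I) : ℤ := w1 p.1 + w2 p.2

theorem w1_b (a : I) : 0 ≤ w1 a ∧ w1 a ≤ 24 := by revert a; decide
theorem w1_0 (a : I) : 0 ≤ w1 a := (w1_b a).1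
theorem w2_0 (a : I × I) : 0 ≤ w2 a := add_nonneg (w1_0 _) (w1_0 _)
theorem w3_0 (a : I × I × I) : 0 ≤ w3 a := add_nonneg (w1_0 _) (w2_0 _)
theorem w1_M (a : I) : w1 a ≤ 72 := by have := (w1_b a).2; omega
theorem w2_M (a : I × I) : w2 a ≤ 72 := by
  have := (w1_b a.1).2; have := (w1_b a.2).2; unfold w2; omega
theorem w3_M (a : I × I × I) : w3 a ≤ 72 := by
  have := (w1_b a.1).2; have := (w1_b a.2.1).2; have := (w1_b a.2.2).2; unfold w3 w2; omega

/-- the Levi-Civita symbol -/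
def epsZ (a b c : ℕ) : ℤ := ((b : ℤ) - a) * ((c : ℤ) - a) * ((c : ℤ) - b) / 2

def TZ (a b c : I) : ℤ := epsZ (a.val/3) (b.val/3) (c.val/3) * epsZ (a.val%3) (b.val%3) (c.val%3)

def T0 : V3 := fun p => (TZ p.1 p.2.1 p.2.2 : ℂ)

theorem TZ_hom : ∀ a b c : I, TZ a b c ≠ 0 → w1 a + (w1 b + w1 c) = 32 := by decide +kernel

def ten2 (x y : V1) : V2 := fun p => x p.1 * y p.2
def sw12 (p : I × I × I) : I × I × I := (p.2.1, p.1, p.2.2)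
def sw23 (p : I × I × I) : I × I × I := (p.1, p.2.2, p.2.1)
def ten3 : V1 →ₗ[ℂ] V2 →ₗ[ℂ] V3 :=
  LinearMap.mk₂ ℂ (fun x r p => x p.1 * r p.2)
    (fun x y r => by ext p; simp [add_mul]) (fun c x r => by ext p; simp [mul_assoc])
    (fun x y r => by ext p; simp [mul_add]) (fun c x r => by ext p; simp; ring)
theorem ten3_apply (x : V1) (r : V2) (p) : ten3 x r p = x p.1 * r p.2 := rfl
def s12 : V3 →ₗ[ℂ] V3 := LinearMap.funLeft ℂ ℂ sw12
def s23 : V3 →ₗ[ℂ] V3 := LinearMap.funLeft ℂ ℂ sw23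
theorem s12_apply (h : V3) (p) : s12 h p = h (sw12 p) := rfl
theorem s23_apply (h : V3) (p) : s23 h p = h (sw23 p) := rfl
def sl (a : I) : V3 →ₗ[ℂ] V2 := LinearMap.funLeft ℂ ℂ (fun p => (a, p))
theorem sl_apply (a : I) (h : V3) (p) : sl a h p = h (a, p) := rfl

structure Half (K : Submodule ℂ V1) (F : Submodule ℂ V2) : Prop where
  dimF : finrank ℂ F = 32
  hP : ∃ P M : Submodule ℂ V3, finrank ℂ P = 167 ∧ finrank ℂ M = 386 ∧
    (∀ h ∈ P, s12 h = h) ∧ (∀ h ∈ P, h ∈ M) ∧ (∀ x ∈ K, ∀ r, ten3 x r ∈ M) ∧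
    (∀ r ∈ F, ∀ y, ten3 y r ∈ M)
  hQ : ∃ Q : Submodule ℂ V3, finrank ℂ Q = 104 ∧ (∀ h ∈ Q, s23 h = h) ∧
    (∀ h ∈ Q, ∀ b, sl b (s12 h) ∈ F)

structure Full (K : Submodule ℂ V1) (F F' : Submodule ℂ V2) : Prop where
  dimK : finrank ℂ K = 2
  h1 : Half K F
  h2 : Half K F'
  hH : ∃ (R : Submodule ℂ V2) (H G : Submodule ℂ V3), finrank ℂ R = 14 ∧ finrank ℂ H = 176 ∧
    finrank ℂ G = 260 ∧ T0 ∈ H ∧ (∀ x ∈ K, ∀ r, ten3 x r ∈ H) ∧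
    (∀ h ∈ H, ∀ b, sl b (s12 h) ∈ F') ∧ (∀ h ∈ H, ∀ c, sl c (s12 (s23 h)) ∈ F) ∧
    (∀ h ∈ H, h ∈ G) ∧ (∀ r ∈ R, ∀ y, ten3 y r ∈ G)

/-! ### inLow -/

theorem inLow_sl (a : I) {P : Submodule ℂ V3} {F : Submodule ℂ V2} (h : ∀ x ∈ P, sl a x ∈ F) :
    ∀ x ∈ inLow w3 P, sl a x ∈ inLow w2 F :=
  inLow_map (w1 a) (sl a) (fun x p hx => hx (a, p) (by simp [w3, add_comm])) h

theorem w3_sw12 (p) : w3 (sw12 p) = w3 p := by simp only [w3, w2, sw12]; ring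
theorem w3_sw23 (p) : w3 (sw23 p) = w3 p := by simp only [w3, w2, sw23]; ring

theorem inLow_sl' (f : V3 →ₗ[ℂ] V3) (hf : ∀ x i', (∀ i, w3 i = w3 i' → x i = 0) → f x i' = 0)
    (a : I) {P : Submodule ℂ V3} {F : Submodule ℂ V2} (h : ∀ x ∈ P, sl a (f x) ∈ F) :
    ∀ x ∈ inLow w3 P, sl a (f x) ∈ inLow w2 F :=
  inLow_map (w1 a) ((sl a).comp f)
    (fun x p hx => hf x (a, p) (fun i hi => hx i (by rw [hi]; simp [w3, add_comm]))) h

theorem s12_hom (x i') (h : ∀ i, w3 i = w3 i' → x i = 0) : s12 x i' = 0 := h _ (w3_sw12 _)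
theorem s23_hom (x i') (h : ∀ i, w3 i = w3 i' → x i = 0) : s23 x i' = 0 := h _ (w3_sw23 _)

theorem ten3_sum (x : V1) (r : V2) : ten3 x r = ∑ q, r q • ten3 x (Pi.single q 1) := by
  have : r = ∑ q, r q • Pi.single (M := fun _ => ℂ) q 1 := by
    ext p
    simp [Finset.sum_apply, Pi.single_apply]
  conv_lhs => rw [this]
  simp

theorem ten3_sum' (x : V1) (r : V2) : ten3 x r = ∑ q, x q • ten3 (Pi.single q 1) r := by
  have : x = ∑ q, x q • Pi.single (M := fun _ => ℂ) q 1 := by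
    ext p
    simp [Finset.sum_apply, Pi.single_apply]
  conv_lhs => rw [this]
  simp

theorem inLow_ten (f : V3 →ₗ[ℂ] V3) (hf : ∀ x i', (∀ i, w3 i = w3 i' → x i = 0) → f x i' = 0)
    {K : Submodule ℂ V1} {P : Submodule ℂ V3} (h : ∀ x ∈ K, ∀ r, f (ten3 x r) ∈ P) :
    ∀ x ∈ inLow w1 K, ∀ r, f (ten3 x r) ∈ inLow w3 P := by
  intro x hx r
  rw [ten3_sum, map_sum]
  refine Submodule.sum_mem _ fun q _ => ?_
  rw [map_smul]
  refine Submodule.smul_mem _ _ ?_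
  refine inLow_map (-w2 q) (f.comp (ten3.flip (Pi.single q 1))) (fun x p hx => hf _ _ ?_)
    (fun x hx => h x hx _) x hx
  intro i hi
  simp only [LinearMap.flip_apply, ten3_apply]
  by_cases hq : i.2 = q
  · rw [hx i.1 (by rw [← hi, ← hq]; simp [w3]), zero_mul]
  · simp [hq]

theorem inLow_ten' {R : Submodule ℂ V2} {P : Submodule ℂ V3} (h : ∀ x ∈ R, ∀ r, ten3 r x ∈ P) :
    ∀ x ∈ inLow w2 R, ∀ r, ten3 r x ∈ inLow w3 P := by
  intro x hx r
  rw [ten3_sum']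
  refine Submodule.sum_mem _ fun q _ => ?_
  refine Submodule.smul_mem _ _ ?_
  refine inLow_map (-w1 q) (ten3 (Pi.single q 1)) (fun x i hx => ?_)
    (fun x hx => h x hx _) x hx
  simp only [ten3_apply]
  by_cases hq : i.1 = q
  · rw [hx i.2 (by rw [← hq]; simp [w3]), mul_zero]
  · simp [hq]

theorem inLow_sym (s : I × I × I → I × I × I) (hs : ∀ p, w3 (s p) = w3 p) {P : Submodule ℂ V3}
    (h : ∀ x ∈ P, ∀ p, x (s p) = x p) : ∀ x ∈ inLow w3 P, ∀ p, x (s p) = x p := by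
  intro x hx p
  rw [mem_inLow] at hx
  obtain ⟨y, hy, -, h2⟩ := hx (w3 p)
  rw [← h2 p rfl, ← h2 (s p) (hs p), h y hy]

theorem Half.inLow {K F} (h : Half K F) : Half (inLow w1 K) (inLow w2 F) := by
  obtain ⟨hd, ⟨P, M, p1, p2, p3, p4, p5, p6⟩, ⟨Q, q1, q3, q4⟩⟩ := h
  refine ⟨by rw [finrank_inLow w2 72 w2_0 w2_M, hd],
    ⟨BR.inLow w3 P, BR.inLow w3 M, by rw [finrank_inLow w3 72 w3_0 w3_M, p1],
      by rw [finrank_inLow w3 72 w3_0 w3_M, p2], ?_, ?_, ?_, ?_⟩,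
    ⟨BR.inLow w3 Q, by rw [finrank_inLow w3 72 w3_0 w3_M, q1], ?_, ?_⟩⟩
  · intro x hx
    funext p
    exact inLow_sym sw12 w3_sw12 (fun x hx p => congrFun (p3 x hx) p) x hx p
  · exact inLow_mono p4
  · exact inLow_ten LinearMap.id (fun x i hx => hx i rfl) p5
  · exact inLow_ten' p6
  · intro x hx
    funext p
    exact inLow_sym sw23 w3_sw23 (fun x hx p => congrFun (q3 x hx) p) x hx p
  · intro x hx a
    exact inLow_sl' s12 s12_hom a (fun x hx => q4 x hx a) x hx

theorem Full.inLow {K F F'} (h : Full K F F') : Full (inLow w1 K) (inLow w2 F) (inLow w2 F') := by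
  obtain ⟨hd, h1, h2, R, H, G, r1, r2, r3, r4, r5, r6, r7, r8, r9⟩ := h
  refine ⟨by rw [finrank_inLow w1 72 w1_0 w1_M, hd], h1.inLow, h2.inLow,
    BR.inLow w2 R, BR.inLow w3 H, BR.inLow w3 G, by rw [finrank_inLow w2 72 w2_0 w2_M, r1],
    by rw [finrank_inLow w3 72 w3_0 w3_M, r2], by rw [finrank_inLow w3 72 w3_0 w3_M, r3],
    ?_, ?_, ?_, ?_, ?_, ?_⟩
  · refine mem_inLow_of_hom r4 32 fun i hi => ?_
    by_contra hc
    exact hi (TZ_hom i.1 i.2.1 i.2.2 (fun h => hc (by simp [T0, h])))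
  · exact inLow_ten LinearMap.id (fun x i hx => hx i rfl) r5
  · intro x hx a
    exact inLow_sl' s12 s12_hom a (fun x hx => r6 x hx a) x hx
  · intro x hx a
    exact inLow_sl' (s12.comp s23) (fun x i hx => s12_hom _ _ fun j hj => s23_hom _ _ fun k hk =>
      hx k (hk.trans hj)) a (fun x hx => r7 x hx a) x hx
  · exact inLow_mono r8
  · exact inLow_ten' r9

/-! ### limits -/

def IsLim {ι : Type} (X : ℕ → Submodule ℂ (ι → ℂ)) (Y : Submodule ℂ (ι → ℂ)) : Prop :=
  (∀ y ∈ Y, ∃ x : ℕ → ι → ℂ, (∀ n, x n ∈ X n) ∧ Tendsto x UU (𝓝 y)) ∧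
      (∀ (x : ℕ → ι → ℂ) y, (∀ n, x n ∈ X n) → Tendsto x UU (𝓝 y) → y ∈ Y)

theorem IsLim.map {ι κ : Type} [Fintype ι] [Fintype κ] {X : ℕ → Submodule ℂ (ι → ℂ)} {Y}
    {X' : ℕ → Submodule ℂ (κ → ℂ)} {Y'} (h : IsLim X Y) (h' : IsLim X' Y')
    (ρ : (ι → ℂ) →ₗ[ℂ] (κ → ℂ)) (hρ : ∀ n, ∀ x ∈ X n, ρ x ∈ X' n) : ∀ x ∈ Y, ρ x ∈ Y' := by
  intro y hy
  obtain ⟨x, hx, hxy⟩ := h.1 y hy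
  refine h'.2 (fun n => ρ (x n)) _ (fun n => hρ n _ (hx n)) ?_
  exact ((LinearMap.continuous_of_finiteDimensional ρ).tendsto _).comp hxy

theorem IsLim.eq {ι κ : Type} [Fintype ι] [Fintype κ] {X : ℕ → Submodule ℂ (ι → ℂ)} {Y}
    (h : IsLim X Y) 
    (ρ : (ι → ℂ) →ₗ[ℂ] (ι → ℂ)) (hρ : ∀ n, ∀ x ∈ X n, ρ x = x) : ∀ x ∈ Y, ρ x = x := by
  intro y hy
  obtain ⟨x, hx, hxy⟩ := h.1 y hy
  have h1 := ((LinearMap.continuous_of_finiteDimensional ρ).tendsto _).comp hxy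
  have : (ρ ∘ x) = x := by funext n; exact hρ n _ (hx n)
  rw [this] at h1
  exact tendsto_nhds_unique h1 hxy

theorem exists_lim' {ι : Type} [Fintype ι] (d : ℕ) (X : ℕ → Submodule ℂ (ι → ℂ)) (hd : ∀ n, finrank ℂ (X n) = d) :
    ∃ Y : Submodule ℂ (ι → ℂ), finrank ℂ Y = d ∧ IsLim X Y := exists_lim d X hd

theorem Half.lim {K : ℕ → Submodule ℂ V1} {F : ℕ → Submodule ℂ V2} (h : ∀ n, Half (K n) (F n))
    {K' F'} (hK : IsLim K K') (hF : IsLim F F') (hd : finrank ℂ F' = 32) : Half K' F' := by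
  refine ⟨hd, ?_, ?_⟩
  · choose P M p1 p2 p3 p4 p5 p6 using fun n => (h n).hP
    obtain ⟨P', d, hP⟩ := exists_lim' _ P p1
    obtain ⟨M', d', hM⟩ := exists_lim' _ M p2
    exact ⟨P', M', d, d', hP.eq (κ := I) _ p3, hP.map hM LinearMap.id p4,
      fun x hx r => hK.map hM (ten3.flip r) (fun n x hx => p5 n x hx r) x hx,
      fun x hx y => hF.map hM (ten3 y) (fun n x hx => p6 n x hx y) x hx⟩
  · choose P p1 p3 p4 using fun n => (h n).hQ
    obtain ⟨P', d, hP⟩ := exists_lim' _ P p1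
    exact ⟨P', d, hP.eq (κ := I) _ p3,
      fun x hx a => hP.map hF ((sl a).comp s12) (fun n x hx => p4 n x hx a) x hx⟩

/-- the tuple without `T0 ∈ H`, with a general tensor -/
structure Pre (t : V3) (K : Submodule ℂ V1) (F F' : Submodule ℂ V2) : Prop where
  dimK : finrank ℂ K = 2
  h1 : Half K F
  h2 : Half K F'
  hH : ∃ (R : Submodule ℂ V2) (H G : Submodule ℂ V3), finrank ℂ R = 14 ∧ finrank ℂ H = 176 ∧
    finrank ℂ G = 260 ∧ t ∈ H ∧ (∀ x ∈ K, ∀ r, ten3 x r ∈ H) ∧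
    (∀ h ∈ H, ∀ b, sl b (s12 h) ∈ F') ∧ (∀ h ∈ H, ∀ c, sl c (s12 (s23 h)) ∈ F) ∧
    (∀ h ∈ H, h ∈ G) ∧ (∀ r ∈ R, ∀ y, ten3 y r ∈ G)

theorem Full.lim {t : ℕ → V3} (ht : Tendsto t UU (𝓝 T0)) (h : ∀ n, ∃ K F F', Pre (t n) K F F') :
    ∃ K F F', Full K F F' := by
  choose K F F' h using h
  obtain ⟨K0, kd, hK⟩ := exists_lim' _ K (fun n => (h n).dimK)
  obtain ⟨F0, fd, hF⟩ := exists_lim' _ F (fun n => (h n).h1.dimF)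
  obtain ⟨F0', fd', hF'⟩ := exists_lim' _ F' (fun n => (h n).h2.dimF)
  choose R H G r1 r2 r3 r4 r5 r6 r7 r8 r9 using fun n => (h n).hH
  obtain ⟨R0, rd, hR⟩ := exists_lim' _ R r1
  obtain ⟨H0, hd, hH⟩ := exists_lim' _ H r2
  obtain ⟨G0, gd, hG⟩ := exists_lim' _ G r3
  refine ⟨K0, F0, F0', kd, Half.lim (fun n => (h n).h1) hK hF fd,
    Half.lim (fun n => (h n).h2) hK hF' fd', R0, H0, G0, rd, hd, gd, hH.2 t T0 r4 ht, ?_, ?_, ?_, ?_, ?_⟩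
  · exact fun x hx r => hK.map hH (ten3.flip r) (fun n x hx => r5 n x hx r) x hx
  · exact fun x hx a => hH.map hF' ((sl a).comp s12) (fun n x hx => r6 n x hx a) x hx
  · exact fun x hx a => hH.map hF ((sl a).comp (s12.comp s23)) (fun n x hx => r7 n x hx a) x hx
  · exact hH.map hG LinearMap.id r8
  · exact fun x hx y => hR.map hG (ten3 y) (fun n x hx => r9 n x hx y) x hx

/-! ### symmetry -/

structure Compat (g : V1 ≃ₗ[ℂ] V1) (g2 : V2 ≃ₗ[ℂ] V2) (g3 : V3 ≃ₗ[ℂ] V3) : Prop where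
  t3 : ∀ x r, g3 (ten3 x r) = ten3 (g x) (g2 r)
  c12 : ∀ h, g3 (s12 h) = s12 (g3 h)
  c23 : ∀ h, g3 (s23 h) = s23 (g3 h)
  csl : ∀ a, ∃ m : I → ℂ, ∀ h, sl a (g3 h) = g2 (∑ a', m a' • sl a' h)
  gT : g3 T0 = T0

section
variable {g : V1 ≃ₗ[ℂ] V1} {g2 : V2 ≃ₗ[ℂ] V2} {g3 : V3 ≃ₗ[ℂ] V3}

abbrev mp {ι : Type} (X : Submodule ℂ (ι → ℂ)) (g : (ι → ℂ) ≃ₗ[ℂ] (ι → ℂ)) : Submodule ℂ (ι → ℂ) :=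
  X.map (g : (ι → ℂ) →ₗ[ℂ] (ι → ℂ))

theorem Compat.slm (hc : Compat g g2 g3) (f : V3 →ₗ[ℂ] V3) (hf : ∀ h, g3 (f h) = f (g3 h))
    {P : Submodule ℂ V3} {F : Submodule ℂ V2} (h : ∀ x ∈ P, ∀ a, sl a (f x) ∈ F) :
    ∀ x ∈ mp P g3, ∀ a, sl a (f x) ∈ mp F g2 := by
  rintro _ ⟨x, hx, rfl⟩ a
  obtain ⟨m, hm⟩ := hc.csl a
  change sl a (f (g3 x)) ∈ _
  rw [← hf, hm]
  exact ⟨_, Submodule.sum_mem _ fun a' _ => Submodule.smul_mem _ _ (h x hx a'), rfl⟩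

theorem Compat.ten (hc : Compat g g2 g3) (f : V3 →ₗ[ℂ] V3) (hf : ∀ h, g3 (f h) = f (g3 h))
    {K : Submodule ℂ V1} {P : Submodule ℂ V3} (h : ∀ x ∈ K, ∀ r, f (ten3 x r) ∈ P) :
    ∀ x ∈ mp K g, ∀ r, f (ten3 x r) ∈ mp P g3 := by
  rintro _ ⟨x, hx, rfl⟩ r
  refine ⟨f (ten3 x (g2.symm r)), h x hx _, ?_⟩
  change g3 _ = f (ten3 (g x) r)
  rw [hf, hc.t3, g2.apply_symm_apply]

theorem fr_mp {ι : Type} (X : Submodule ℂ (ι → ℂ)) (g : (ι → ℂ) ≃ₗ[ℂ] (ι → ℂ)) :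
    finrank ℂ (mp X g) = finrank ℂ X := LinearEquiv.finrank_map_eq g X

theorem Half.mp (hc : Compat g g2 g3) {K F} (h : Half K F) : Half (mp K g) (mp F g2) := by
  obtain ⟨hd, ⟨P, M, p1, p2, p3, p4, p5, p6⟩, ⟨Q, q1, q3, q4⟩⟩ := h
  refine ⟨by rw [fr_mp, hd], ⟨BR.mp P g3, BR.mp M g3, by rw [fr_mp, p1], by rw [fr_mp, p2], ?_, ?_, ?_, ?_⟩,
    ⟨BR.mp Q g3, by rw [fr_mp, q1], ?_, ?_⟩⟩
  · rintro _ ⟨x, hx, rfl⟩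
    change s12 (g3 x) = g3 x
    rw [← hc.c12, p3 x hx]
  · rintro _ ⟨x, hx, rfl⟩
    exact ⟨x, p4 x hx, rfl⟩
  · exact hc.ten LinearMap.id (fun h => rfl) p5
  · rintro _ ⟨x, hx, rfl⟩ y
    refine ⟨ten3 (g.symm y) x, p6 x hx _, ?_⟩
    change g3 _ = ten3 y (g2 x)
    rw [hc.t3, g.apply_symm_apply]
  · rintro _ ⟨x, hx, rfl⟩
    change s23 (g3 x) = g3 x
    rw [← hc.c23, q3 x hx]
  · exact hc.slm s12 hc.c12 q4

theorem Full.mp (hc : Compat g g2 g3) {K F F'} (h : Full K F F') :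
    Full (mp K g) (mp F g2) (mp F' g2) := by
  obtain ⟨hd, h1, h2, R, H, G, r1, r2, r3, r4, r5, r6, r7, r8, r9⟩ := h
  refine ⟨by rw [fr_mp, hd], h1.mp hc, h2.mp hc, BR.mp R g2, BR.mp H g3, BR.mp G g3, by rw [fr_mp, r1],
    by rw [fr_mp, r2], by rw [fr_mp, r3], ?_, ?_, ?_, ?_, ?_, ?_⟩
  · exact ⟨T0, r4, hc.gT⟩
  · exact hc.ten LinearMap.id (fun h => rfl) r5
  · exact hc.slm s12 hc.c12 r6
  · exact hc.slm (s12.comp s23) (fun h => by simp [hc.c12, hc.c23]) r7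
  · rintro _ ⟨x, hx, rfl⟩
    exact ⟨x, r8 x hx, rfl⟩
  · rintro _ ⟨x, hx, rfl⟩ y
    refine ⟨ten3 (g.symm y) x, r9 x hx _, ?_⟩
    change g3 _ = ten3 y (g2 x)
    rw [hc.t3, g.apply_symm_apply]
end

end BR

set_option linter.unusedSectionVars false
set_option linter.unusedSimpArgs false
namespace BR
open Module Filter Topology

section sh
variable {ι : Type}

def shL (c : ι → ℂ) (τ : ι → ι) : (ι → ℂ) →ₗ[ℂ] (ι → ℂ) where
  toFun x := fun i => x i + c i * x (τ i)
  map_add' x y := by ext i; simp; ring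
  map_smul' k x := by ext i; simp; ring

theorem shL_apply (c : ι → ℂ) (τ : ι → ι) (x i) : shL c τ x i = x i + c i * x (τ i) := rfl

def shE (c : ι → ℂ) (τ : ι → ι) (h : ∀ i, c i * c (τ i) = 0) : (ι → ℂ) ≃ₗ[ℂ] (ι → ℂ) :=
  LinearEquiv.ofLinearMap (shL c τ) (shL (fun i => - c i) τ)
    (by ext x i; simp only [LinearMap.comp_apply, shL_apply, LinearMap.id_apply]; linear_combination (-(x (τ (τ i)))) * h i)
    (by ext x i; simp only [LinearMap.comp_apply, shL_apply, LinearMap.id_apply]; linear_combination (-(x (τ (τ i)))) * h i)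

theorem shE_apply (c : ι → ℂ) (τ : ι → ι) (h) (x i) : shE c τ h x i = x i + c i * x (τ i) := rfl
end sh

def cz (s : Fin 4) (a : I) : ℤ :=
  if (s.val = 0 ∧ a.val / 3 = 0) ∨ (s.val = 1 ∧ a.val / 3 = 1) ∨ (s.val = 2 ∧ a.val % 3 = 0) ∨
    (s.val = 3 ∧ a.val % 3 = 1) then 1 else 0
def tau (s : Fin 4) (a : I) : I := if s.val < 2 then a + 3 else a + 1
def cc (s : Fin 4) (a : I) : ℂ := (cz s a : ℂ)
def dd : Fin 4 → ℤ := ![1, 2, 7, 14]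

theorem cz_sq : ∀ s a, cz s a * cz s (tau s a) = 0 := by decide
theorem cz_w : ∀ s a, cz s a ≠ 0 → w1 (tau s a) = w1 a + dd s := by decide
theorem dd_pos : ∀ s, 0 < dd s := by decide
theorem cc_sq (s a) : cc s a * cc s (tau s a) = 0 := by
  have := cz_sq s a
  unfold cc; exact_mod_cast this
theorem cc_w (s a) (h : cc s a ≠ 0) : w1 (tau s a) = w1 a + dd s :=
  cz_w s a (by intro h0; exact h (by simp [cc, h0]))

theorem TZ_inv : ∀ s a b c,
    (TZ a b c + cz s a * TZ (tau s a) b c) + cz s b * (TZ a (tau s b) c + cz s a * TZ (tau s a) (tau s b) c)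
    + cz s c * ((TZ a b (tau s c) + cz s a * TZ (tau s a) b (tau s c))
      + cz s b * (TZ a (tau s b) (tau s c) + cz s a * TZ (tau s a) (tau s b) (tau s c))) = TZ a b c := by
  decide +kernel

def g1 (s : Fin 4) : V1 ≃ₗ[ℂ] V1 := shE (cc s) (tau s) (cc_sq s)
def g2 (s : Fin 4) : V2 ≃ₗ[ℂ] V2 :=
  (shE (fun p : I × I => cc s p.1) (fun p => (tau s p.1, p.2)) (fun p => cc_sq s p.1)).trans
  (shE (fun p : I × I => cc s p.2) (fun p => (p.1, tau s p.2)) (fun p => cc_sq s p.2))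
def g3 (s : Fin 4) : V3 ≃ₗ[ℂ] V3 :=
  ((shE (fun p : I × I × I => cc s p.1) (fun p => (tau s p.1, p.2)) (fun p => cc_sq s p.1)).trans
  (shE (fun p : I × I × I => cc s p.2.1) (fun p => (p.1, tau s p.2.1, p.2.2)) (fun p => cc_sq s p.2.1))).trans
  (shE (fun p : I × I × I => cc s p.2.2) (fun p => (p.1, p.2.1, tau s p.2.2)) (fun p => cc_sq s p.2.2))

theorem g1_apply (s x a) : g1 s x a = x a + cc s a * x (tau s a) := rfl
theorem g2_apply (s x a b) : g2 s x (a, b) = (x (a, b) + cc s a * x (tau s a, b))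
    + cc s b * (x (a, tau s b) + cc s a * x (tau s a, tau s b)) := rfl
theorem g3_apply (s x a b c) : g3 s x (a, b, c) =
  ((x (a, b, c) + cc s a * x (tau s a, b, c))
    + cc s b * (x (a, tau s b, c) + cc s a * x (tau s a, tau s b, c))) + cc s c *
  ((x (a, b, tau s c) + cc s a * x (tau s a, b, tau s c))
    + cc s b * (x (a, tau s b, tau s c) + cc s a * x (tau s a, tau s b, tau s c))) := rfl

theorem compat_g (s : Fin 4) : Compat (g1 s) (g2 s) (g3 s) where
  t3 x r := by
    ext ⟨a, b, c⟩
    rw [ten3_apply, g3_apply, g1_apply, g2_apply]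
    simp only [ten3_apply]
    ring
  c12 h := by
    ext ⟨a, b, c⟩
    rw [s12_apply, sw12, g3_apply, g3_apply]
    simp only [s12_apply, sw12]
    ring
  c23 h := by
    ext ⟨a, b, c⟩
    rw [s23_apply, sw23, g3_apply, g3_apply]
    simp only [s23_apply, sw23]
    ring
  csl a := by
    refine ⟨Pi.single a 1 + cc s a • Pi.single (tau s a) 1, fun h => ?_⟩
    have : ∑ a', ((Pi.single a 1 + cc s a • Pi.single (tau s a) 1 : I → ℂ) a') • sl a' h =
        sl a h + cc s a • sl (tau s a) h := by
      simp [add_smul, Finset.sum_add_distrib, Pi.single_apply, mul_smul, ite_smul]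
    rw [this]
    ext ⟨b, c⟩
    rw [sl_apply, g3_apply, g2_apply]
    simp only [sl_apply, Pi.add_apply, Pi.smul_apply, smul_eq_mul]
  gT := by
    ext ⟨a, b, c⟩
    rw [g3_apply]
    have := TZ_inv s a b c
    simp only [T0, cc]
    exact_mod_cast this

/-! transposition -/
def sg (a : I) : I := ⟨3 * (a.val % 3) + a.val / 3, by omega⟩
theorem sg_sg : ∀ a, sg (sg a) = a := by decide
def sgE : I ≃ I := ⟨sg, sg, sg_sg, sg_sg⟩
theorem TZ_sg : ∀ a b c, TZ (sg a) (sg b) (sg c) = TZ a b c := by decide +kernel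
def q1 : V1 ≃ₗ[ℂ] V1 := LinearEquiv.funCongrLeft ℂ ℂ sgE
def q2 : V2 ≃ₗ[ℂ] V2 := LinearEquiv.funCongrLeft ℂ ℂ (sgE.prodCongr sgE)
def q3 : V3 ≃ₗ[ℂ] V3 := LinearEquiv.funCongrLeft ℂ ℂ (sgE.prodCongr (sgE.prodCongr sgE))
theorem q1_apply (x a) : q1 x a = x (sg a) := rfl
theorem q2_apply (x a b) : q2 x (a, b) = x (sg a, sg b) := rfl
theorem q3_apply (x a b c) : q3 x (a, b, c) = x (sg a, sg b, sg c) := rfl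

theorem compat_q : Compat q1 q2 q3 where
  t3 x r := rfl
  c12 h := rfl
  c23 h := rfl
  csl a := by
    refine ⟨Pi.single (sg a) 1, fun h => ?_⟩
    have : ∑ a', ((Pi.single (sg a) 1 : I → ℂ) a') • sl a' h = sl (sg a) h := by
      simp [Pi.single_apply]
    rw [this]
    rfl
  gT := by
    ext ⟨a, b, c⟩
    rw [q3_apply]
    simp only [T0, TZ_sg]

/-! extremal -/
def N1 (s : Fin 4) : V1 →ₗ[ℂ] V1 where
  toFun x := fun a => cc s a * x (tau s a)
  map_add' x y := by ext i; simp; ring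
  map_smul' k x := by ext i; simp; ring
def N2 (s : Fin 4) : V2 →ₗ[ℂ] V2 where
  toFun x := fun p => cc s p.1 * x (tau s p.1, p.2) + cc s p.2 * x (p.1, tau s p.2)
  map_add' x y := by ext i; simp; ring
  map_smul' k x := by ext i; simp; ring
theorem N1_apply (s x a) : N1 s x a = cc s a * x (tau s a) := rfl
theorem N2_apply (s x a b) : N2 s x (a, b) = cc s a * x (tau s a, b) + cc s b * x (a, tau s b) := rfl

theorem g1_lo (s w x) (h : x ∈ vLo w1 w) : g1 s x ∈ vLo w1 w := by
  intro a ha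
  rw [g1_apply, h a ha]
  by_cases hc : cc s a = 0
  · simp [hc]
  · have := cc_w s a hc
    have := dd_pos s
    rw [h _ (by omega)]; simp

theorem g2_lo (s w x) (h : x ∈ vLo w2 w) : g2 s x ∈ vLo w2 w := by
  rintro ⟨a, b⟩ hab
  have hd := dd_pos s
  have e1 := cc_w s a
  have e2 := cc_w s b
  rw [g2_apply, h _ hab]
  simp only [w2] at hab
  by_cases ha : cc s a = 0 <;> by_cases hb : cc s b = 0
  · simp [ha, hb]
  · have := e2 hb
    simp [ha, h (a, tau s b) (by simp only [w2]; omega)]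
  · have := e1 ha
    simp [hb, h (tau s a, b) (by simp only [w2]; omega)]
  · have := e1 ha
    have := e2 hb
    simp [h (a, tau s b) (by simp only [w2]; omega), h (tau s a, b) (by simp only [w2]; omega),
      h (tau s a, tau s b) (by simp only [w2]; omega)]

theorem stable_aux {ι : Type} [Fintype ι] (wt : ι → ℤ) (h0 : ∀ i, 0 ≤ wt i) (hM : ∀ i, wt i ≤ 72)
    (X : Submodule ℂ (ι → ℂ)) (g : (ι → ℂ) ≃ₗ[ℂ] (ι → ℂ)) (N : (ι → ℂ) →ₗ[ℂ] (ι → ℂ)) (d : ℤ)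
    (hg : ∀ w x, (∀ i, wt i ≠ w → x i = 0) → prj wt w (g x) = x ∧ prj wt (w - d) (g x) = N x)
    (hX : Graded wt X) (hgX : Graded wt (mp X g)) : ∀ x ∈ X, N x ∈ X := by
  have hle : X ≤ mp X g := by
    intro x hx
    rw [← sum_prj wt 72 x h0 hM]
    refine Submodule.sum_mem _ fun w _ => ?_
    have h1 := hX x hx w
    have h2 := (hg w (prj wt w x) (fun i hi => by simp [prj_apply, hi])).1
    rw [← h2]
    exact hgX _ ⟨_, h1, rfl⟩ w
  have heq := Submodule.eq_of_le_of_finrank_eq hle (fr_mp X g).symm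
  intro x hx
  rw [← sum_prj wt 72 x h0 hM, map_sum]
  refine Submodule.sum_mem _ fun w _ => ?_
  have h1 := hX x hx w
  have h2 := (hg w (prj wt w x) (fun i hi => by simp [prj_apply, hi])).2
  rw [← h2, heq]
  exact hgX _ ⟨_, h1, rfl⟩ _

theorem g1_hom (s w) (x : V1) (h : ∀ i, w1 i ≠ w → x i = 0) :
    prj w1 w (g1 s x) = x ∧ prj w1 (w - dd s) (g1 s x) = N1 s x := by
  have hd := dd_pos s
  constructor <;> ext a <;> rw [prj_apply, g1_apply]
  · by_cases ha : cc s a = 0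
    · split_ifs with h1
      · simp [ha]
      · exact (h a h1).symm
    · have := cc_w s a ha
      split_ifs with h1
      · rw [h (tau s a) (by omega)]; simp
      · exact (h a h1).symm
  · rw [N1_apply]
    by_cases ha : cc s a = 0
    · split_ifs with h1
      · rw [ha, h a (by omega)]; simp
      · simp [ha]
    · have := cc_w s a ha
      split_ifs with h1
      · rw [h a (by omega)]; simp
      · rw [h (tau s a) (by omega)]; simp

theorem g2_hom (s w) (x : V2) (h : ∀ i, w2 i ≠ w → x i = 0) :
    prj w2 w (g2 s x) = x ∧ prj w2 (w - dd s) (g2 s x) = N2 s x := by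
  have hd := dd_pos s
  constructor <;> ext ⟨a, b⟩ <;> rw [prj_apply, g2_apply] <;> have e1 := cc_w s a <;>
    have e2 := cc_w s b <;> have k0 := h (a, b) <;> have k1 := h (tau s a, b) <;>
    have k2 := h (a, tau s b) <;> have k3 := h (tau s a, tau s b) <;>
    have hw : w2 (a, b) = w1 a + w1 b := rfl <;>
    simp only [w2] at k1 k2 k3
  · by_cases h1 : w2 (a, b) = w
    · rw [if_pos h1]
      by_cases ha : cc s a = 0 <;> by_cases hb : cc s b = 0
      · simp [ha, hb]
      · have := e2 hb
        rw [ha, k2 (by omega)]; simp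
      · have := e1 ha
        rw [hb, k1 (by omega)]; simp
      · have := e1 ha
        have := e2 hb
        rw [k1 (by omega), k2 (by omega), k3 (by omega)]; simp
    · rw [if_neg h1]; exact (k0 h1).symm
  · rw [N2_apply]
    by_cases h1 : w2 (a, b) = w - dd s
    · rw [if_pos h1, k0 (by omega)]
      by_cases ha : cc s a = 0 <;> by_cases hb : cc s b = 0
      · simp [ha, hb]
      · simp [ha]
      · simp [hb]
      · have := e1 ha
        have := e2 hb
        rw [k3 (by omega)]; simp
    · rw [if_neg h1]
      by_cases ha : cc s a = 0 <;> by_cases hb : cc s b = 0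
      · simp [ha, hb]
      · have := e2 hb
        rw [ha, k2 (by omega)]; simp
      · have := e1 ha
        rw [hb, k1 (by omega)]; simp
      · have := e1 ha
        have := e2 hb
        rw [k1 (by omega), k2 (by omega)]; simp

theorem borel (h : ∃ K F F', Full K F F') : ∃ K F F', Full K F F' ∧ Graded w1 K ∧ Graded w2 F ∧
    Graded w2 F' ∧ (∀ s, ∀ x ∈ K, N1 s x ∈ K) ∧ (∀ s, ∀ x ∈ F, N2 s x ∈ F) ∧
    (∀ s, ∀ x ∈ F', N2 s x ∈ F') := by
  let tot : Submodule ℂ V1 → Submodule ℂ V2 → Submodule ℂ V2 → ℕ := fun K F F' =>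
    phi w1 72 K + phi w2 72 F + phi w2 72 F'
  let S : Set ℕ := {n | ∃ K F F', Full K F F' ∧ tot K F F' = n}
  have hne : S.Nonempty := by
    obtain ⟨K, F, F', h⟩ := h
    exact ⟨_, K, F, F', h, rfl⟩
  have hbd : BddAbove S := by
    refine ⟨(Finset.Icc (0:ℤ) 72).card * Fintype.card I + (Finset.Icc (0:ℤ) 72).card * Fintype.card (I × I)
      + (Finset.Icc (0:ℤ) 72).card * Fintype.card (I × I), ?_⟩
    rintro _ ⟨K, F, F', -, rfl⟩
    exact add_le_add (add_le_add (phi_bound w1 72 K) (phi_bound w2 72 F)) (phi_bound w2 72 F')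
  obtain ⟨K, F, F', hF, hm⟩ := Nat.sSup_mem hne hbd
  have hmax : ∀ L E E', Full L E E' → tot L E E' ≤ tot K F F' := fun L E E' h' => by
    rw [hm]; exact le_csSup hbd ⟨L, E, E', h', rfl⟩
  have hgr : ∀ L E E', Full L E E' → tot K F F' ≤ tot L E E' →
      Graded w1 L ∧ Graded w2 E ∧ Graded w2 E' := by
    intro L E E' h' hle
    have h1 := hmax _ _ _ h'.inLow
    have a1 := phi_le w1 72 w1_0 w1_M L
    have a2 := phi_le w2 72 w2_0 w2_M E
    have a3 := phi_le w2 72 w2_0 w2_M E'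
    simp only [tot] at h1 hle
    exact ⟨graded_of_phi_eq w1 72 w1_0 w1_M L (by omega), graded_of_phi_eq w2 72 w2_0 w2_M E (by omega),
      graded_of_phi_eq w2 72 w2_0 w2_M E' (by omega)⟩
  have hg := hgr K F F' hF le_rfl
  have hgs : ∀ s, Graded w1 (mp K (g1 s)) ∧ Graded w2 (mp F (g2 s)) ∧ Graded w2 (mp F' (g2 s)) := by
    intro s
    refine hgr _ _ _ (hF.mp (compat_g s)) ?_
    exact add_le_add (add_le_add (phi_map w1 72 (g1 s) (g1_lo s) K) (phi_map w2 72 (g2 s) (g2_lo s) F))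
      (phi_map w2 72 (g2 s) (g2_lo s) F')
  refine ⟨K, F, F', hF, hg.1, hg.2.1, hg.2.2, fun s => ?_, fun s => ?_, fun s => ?_⟩
  · exact stable_aux w1 w1_0 w1_M K (g1 s) (N1 s) (dd s) (g1_hom s) hg.1 (hgs s).1
  · exact stable_aux w2 w2_0 w2_M F (g2 s) (N2 s) (dd s) (g2_hom s) hg.2.1 (hgs s).2.1
  · exact stable_aux w2 w2_0 w2_M F' (g2 s) (N2 s) (dd s) (g2_hom s) hg.2.2 (hgs s).2.2

/-- the Borel-fixed structure -/
structure Bor (K : Submodule ℂ V1) (F F' : Submodule ℂ V2) : Prop where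
  full : Full K F F'
  gK : Graded w1 K
  gF : Graded w2 F
  gF' : Graded w2 F'
  nK : ∀ s, ∀ x ∈ K, N1 s x ∈ K
  nF : ∀ s, ∀ x ∈ F, N2 s x ∈ F
  nF' : ∀ s, ∀ x ∈ F', N2 s x ∈ F'

end BR

namespace BR

/-! ### polynomial arithmetic -/
abbrev Poly := List ℤ
def isz : ℤ → Bool
  | .ofNat n => Nat.beq n 0
  | .negSucc _ => false
def pcons (c : ℤ) (p : Poly) : Poly :=
  match p with
  | [] => if isz c then [] else [c]
  | q => c :: q
def padd : Poly → Poly → Poly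
  | [], q => q
  | p, [] => p
  | a :: p, b :: q => pcons (a + b) (padd p q)
def pscale (c : ℤ) : Poly → Poly
  | [] => []
  | a :: p => pcons (c * a) (pscale c p)
def pmul : Poly → Poly → Poly
  | [], _ => []
  | [a], q => pscale a q
  | a :: p, q => padd (pscale a q) (pcons 0 (pmul p q))
def divA (s : ℤ) : ℤ → Poly → Poly
  | _, [] => []
  | _, [_] => []
  | acc, a :: p => (s * acc + a) :: divA s (s * acc + a) p
def okp : ℕ → Poly → Bool
  | 0, _ => false
  | _, [] => false
  | _, [c] => !isz c
  | n+1, a :: p =>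
    if isz a then okp n p else
    let q := divA 1 0 (a :: p)
    if pmul [1, -1] q == a :: p then okp n q else
    let q := divA (-1) 0 (a :: p)
    if pmul [1, 1] q == a :: p then okp n q else false

/-! ### rows -/
abbrev Row := List (ℕ × Poly)
def coef (c : ℕ) : Row → Poly
  | [] => []
  | (d, p) :: r => if Nat.beq d c then padd p (coef c r) else coef c r
def rscale (p : Poly) : Row → Row
  | [] => []
  | (d, q) :: r => match pmul p q with
    | [] => rscale p r
    | s => (d, s) :: rscale p r
def rmerge : ℕ → Row → Row → Row
  | 0, _, _ => []
  | _, [], r => r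
  | _, r, [] => r
  | n+1, (c, p) :: r, (d, q) :: s =>
    if Nat.beq c d then
      match padd p q with
      | [] => rmerge n r s
      | t => (c, t) :: rmerge n r s
    else if Nat.blt c d then (c, p) :: rmerge n r ((d, q) :: s)
    else (d, q) :: rmerge n ((c, p) :: r) s
def radd (r s : Row) : Row := rmerge (r.length + s.length) r s
def pivot (r0 : Row) : Row → Option (ℕ × Poly)
  | [] => none
  | (c, _) :: r => if okp 8 (coef c r0) then some (c, coef c r0) else pivot r0 r
def elim (c : ℕ) (p : Poly) (r x : Row) : Row :=
  match coef c x with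
  | [] => x
  | q => radd (rscale p x) (rscale (pscale (-1) q) r)

def rk : ℕ → List Row → ℕ
  | 0, _ => 0
  | _, [] => 0
  | n+1, r :: rs => match pivot r r with
    | none => rk n rs
    | some (c, p) => rk n (rs.map (elim c p r)) + 1

def ech : ℕ → List Row → Option (List Row)
  | 0, _ => none
  | _, [] => some []
  | n+1, [] :: rs => ech n rs
  | n+1, r :: rs => match pivot r r with
    | none => none
    | some (c, p) => match ech n (rs.map (elim c p r)) with
      | none => none
      | some o => some (r :: o)

def redBy : ℕ → List Row → List Row → Option (List Row)
  | 0, _, _ => none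
  | _, [], ks => some ks
  | n+1, [] :: rs, ks => redBy n rs ks
  | n+1, r :: rs, ks => match pivot r r with
    | none => none
    | some (c, p) => redBy n (rs.map (elim c p r)) (ks.map (elim c p r))

/-- kernel: rows have columns `< 1000` (left part) and `≥ 1000` (right part) -/
def leftPart : Row → Row
  | [] => []
  | (c, p) :: r => if Nat.blt c 1000 then (c, p) :: leftPart r else leftPart r
def kerv : ℕ → List Row → Option (List Row)
  | 0, _ => none
  | _, [] => some []
  | n+1, r :: rs => match leftPart r with
    | [] => match kerv n rs with
      | none => none
      | some o => some (r :: o)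
    | l => match pivot r l with
      | none => none
      | some (c, p) => kerv n (rs.map (elim c p r))

/-! ### the tensors -/
def w1l : List ℕ := [0,7,21,1,8,22,3,10,24]
def wn (a : ℕ) : ℕ := w1l.getD a 0
def wcode (n : ℕ) : ℕ := wn (n / 9) + wn (n % 9)
def codes : List ℕ := (List.range 63).map (· + 18)
def weights : List ℕ := (List.range 49).filter fun w => codes.any fun c => Nat.beq (wcode c) w
def coords (w : ℕ) : List ℕ := codes.filter fun c => Nat.beq (wcode c) w
/-- image of a basis vector under the sum of the (truncated) raising operators -/
def lowA (a : ℕ) : List ℕ := (if 3 ≤ a then [a - 3] else []) ++ (if 1 ≤ a % 3 then [a - 1] else [])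
def nL (n : ℕ) : List ℕ :=
  ((lowA (n/9)).filter (Nat.ble 2 ·)).map (fun a => 9 * a + n % 9) ++ (lowA (n%9)).map (fun b => 9 * (n/9) + b)
def nE (n : ℕ) : Row :=
  radd ((nL n).foldr (fun c r => radd [(c, [1])] r) []) [(n + 1000, [1])]

def epsN (a b c : ℕ) : ℤ := ((b : ℤ) - a) * ((c : ℤ) - a) * ((c : ℤ) - b) / 2
def TN (a b c : ℕ) : ℤ := epsN (a/3) (b/3) (c/3) * epsN (a%3) (b%3) (c%3)
abbrev St := List (ℕ × Row)
def L0 : St := (List.range 9).map fun c => (32 - wn c,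
  codes.filterMap fun n => if isz (TN (n/9) (n%9) c) then none else some (n, [TN (n/9) (n%9) c]))

def unoff : Row → Row
  | [] => []
  | (c, p) :: r => if Nat.blt c 1000 then unoff r else (c - 1000, p) :: unoff r

def newH (S : St) (w : ℕ) : Option (List Row) :=
  let B := (S.filter fun e => Nat.beq (e.1+1) w || Nat.beq (e.1+2) w || Nat.beq (e.1+7) w || Nat.beq (e.1+14) w).map (·.2)
  match kerv 100 (B ++ (coords w).map nE) with
  | none => none
  | some ks => match redBy 20 ((S.filter fun e => Nat.beq e.1 w).map (·.2)) (ks.map unoff) with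
    | none => none
    | some ks => ech 20 ks

/-- rows of the (210) test; the column code encodes a triple whose first two entries increase -/
def row210 (a : ℕ) : Row → Row
  | [] => []
  | (c, p) :: r =>
    if Nat.blt (c / 9) a then (9 * (9 * (c / 9) + a) + c % 9, pscale (-1) p) :: row210 a r
    else if Nat.blt a (c / 9) then (9 * (9 * a + c / 9) + c % 9, p) :: row210 a r
    else row210 a r
def row120 (b : ℕ) : Row → Row
  | [] => []
  | (c, p) :: r =>
    if Nat.blt (c % 9) b then (9 * (9 * (c / 9) + c % 9) + b, pscale (-1) p) :: row120 b r
    else if Nat.blt b (c % 9) then (9 * (9 * (c / 9) + b) + c % 9, p) :: row120 b r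
    else row120 b r

def rkb : ℕ → ℕ → List (ℕ × Row) → ℕ
  | _, _, [] => 0
  | 0, _, rows => rk 200 (rows.map (·.2))
  | d+1, m, rows => rkb d m (rows.filter fun e => Nat.blt e.1 (m + 2 ^ d)) +
      rkb d (m + 2 ^ d) (rows.filter fun e => Nat.ble (m + 2 ^ d) e.1)
def blockRk (rows : List (ℕ × Row)) : ℕ := rkb 7 0 rows
def rows210 (S : St) : List (ℕ × Row) :=
  S.flatMap fun e => ((List.range 7).map (· + 2)).map fun a => (e.1 + wn a, row210 a e.2)
def rows120 (S : St) : List (ℕ × Row) :=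
  S.flatMap fun e => (List.range 9).map fun a => (e.1 + wn a, row120 a e.2)
def isCand (Cd : St) (S : St) : Bool :=
  Nat.beq (rk 20 (S.map (·.2))) 14 && match redBy 20 (Cd.map (·.2)) (S.map (·.2)) with
    | none => false
    | some l => l.all (·.isEmpty)
def candS : St := L0 ++ [18, 19, 20, 21, 27].map fun n => (wcode n, [(n, [1])])
def homS (S : St) : Bool :=
  S.all fun e => e.2.all fun f => Nat.ble 18 f.1 && Nat.blt f.1 81 && Nat.beq (wcode f.1) e.1
def leaf (S : St) : Bool := homS S && (
  Nat.ble 85 (blockRk (rows210 S)) || Nat.ble 113 (blockRk (rows120 S)) || isCand candS S)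

def isConst (S : St) : Bool := S.all fun e => e.2.all fun f => Nat.ble f.2.length 1

def explore : ℕ → ℕ → St → Bool
  | 0, _, S => leaf S
  | n+1, m, S => weights.all fun w => Nat.blt w m || match newH S w with
    | some [] => true
    | some [h] => explore n w (S ++ [(w, h)])
    | some [h1, h2] => isConst S && isConst [(0, h1), (0, h2)] &&
       (explore n w (S ++ [(w, h2)]) && explore n w (S ++ [(w, h1)]) &&
        explore n w (S ++ [(w, radd h1 h2)]) && explore n w (S ++ [(w, radd h1 (rscale [-1] h2))]) &&
        explore n w (S ++ [(w, radd h1 (rscale [0, 1] h2))]))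
    | _ => false
end BR

set_option linter.unusedSimpArgs false
namespace BR
open Module

def pev (t : ℂ) : Poly → ℂ
  | [] => 0
  | a :: p => (a : ℂ) + t * pev t p

theorem isz_iff (c : ℤ) : isz c = true ↔ c = 0 := by
  cases c with
  | ofNat n => simp [isz]
  | negSucc n => simp [isz]

theorem pev_pcons (t : ℂ) (c : ℤ) (p) : pev t (pcons c p) = (c : ℂ) + t * pev t p := by
  cases p with
  | nil =>
    by_cases h : isz c = true
    · have := (isz_iff c).1 h
      subst this
      simp [pcons, h, pev]
    · simp [pcons, h, pev]
  | cons a p => simp [pcons, pev]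

theorem pev_padd (t : ℂ) (p q) : pev t (padd p q) = pev t p + pev t q := by
  induction p generalizing q with
  | nil => simp [padd, pev]
  | cons a p ih =>
    cases q with
    | nil => simp [padd, pev]
    | cons b q => simp only [padd, pev_pcons, pev, ih]; push_cast; ring

theorem pev_pscale (t : ℂ) (c : ℤ) (p) : pev t (pscale c p) = c * pev t p := by
  induction p with
  | nil => simp [pscale, pev]
  | cons a p ih => simp only [pscale, pev_pcons, pev, ih]; push_cast; ring

theorem pev_pmul (t : ℂ) (p q) : pev t (pmul p q) = pev t p * pev t q := by
  induction p with
  | nil => simp [pmul, pev]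
  | cons a p ih =>
    cases p with
    | nil => simp [pmul, pev, pev_pscale]
    | cons b p =>
      rw [pmul, pev_padd, pev_pscale, pev_pcons, ih]
      · simp only [pev]; push_cast; ring
      · simp

def gd (t : ℂ) : Prop := t ≠ 0 ∧ t ≠ 1 ∧ t ≠ -1

theorem okp_sound {t : ℂ} (ht : gd t) : ∀ n p, okp n p = true → pev t p ≠ 0 := by
  intro n
  induction n with
  | zero => intro p h; cases p <;> simp [okp] at h
  | succ n ih =>
    intro p h
    match p, h with
    | [], h => simp [okp] at h
    | [c], h =>
      have : ¬ (isz c = true) := by simpa [okp] using h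
      rw [isz_iff] at this
      simpa [pev] using this
    | a :: b :: p, h =>
      rw [okp] at h
      swap
      · simp
      dsimp only at h
      split_ifs at h with h1 h2 h3
      · rw [isz_iff] at h1
        have := ih _ h
        rw [pev, h1]
        simpa using ⟨ht.1, this⟩
      · have := ih _ h
        rw [← (beq_iff_eq.1 h2), pev_pmul]
        refine mul_ne_zero ?_ this
        simp only [pev]
        have := ht.2.1
        intro h0
        apply this
        push_cast at h0
        linear_combination -h0
      · have := ih _ h
        rw [← (beq_iff_eq.1 h3), pev_pmul]
        refine mul_ne_zero ?_ this
        simp only [pev]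
        have := ht.2.2
        intro h0
        apply this
        push_cast at h0
        linear_combination h0

abbrev W := ℕ → ℂ

def rowv (t : ℂ) : Row → W
  | [] => 0
  | (d, q) :: r => Pi.single d (pev t q) + rowv t r

theorem coef_sound (t : ℂ) (c r) : pev t (coef c r) = rowv t r c := by
  induction r with
  | nil => simp [coef, rowv, pev]
  | cons e r ih =>
    obtain ⟨d, q⟩ := e
    by_cases h : d = c
    · subst h
      simp [coef, rowv, pev_padd, ih]
    · have h' : c ≠ d := fun h' => h h'.symm
      simp [coef, rowv, h, ih, Pi.single_apply, h']

theorem rscale_sound (t : ℂ) (p r) : rowv t (rscale p r) = pev t p • rowv t r := by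
  induction r with
  | nil => simp [rscale, rowv]
  | cons e r ih =>
    obtain ⟨d, q⟩ := e
    have hm := pev_pmul t p q
    rw [rscale]
    split
    · next h =>
      rw [h, pev] at hm
      rw [ih, rowv, smul_add, ← Pi.single_smul, smul_eq_mul, ← hm]
      simp
    · rw [rowv, ih, rowv, smul_add, ← Pi.single_smul, smul_eq_mul, ← hm]

theorem rmerge_sound (t : ℂ) : ∀ n r s, r.length + s.length ≤ n →
    rowv t (rmerge n r s) = rowv t r + rowv t s := by
  intro n
  induction n with
  | zero =>
    intro r s h
    have h1 : r = [] := by rw [← List.length_eq_zero_iff]; omega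
    have h2 : s = [] := by rw [← List.length_eq_zero_iff]; omega
    subst h1 h2
    simp [rmerge, rowv]
  | succ n ih =>
    intro r s h
    match r, s, h with
    | [], s, h => simp [rmerge, rowv]
    | (c, p) :: r, [], h => simp [rmerge, rowv]
    | (c, p) :: r, (d, q) :: s, h =>
      simp only [List.length_cons] at h
      rw [rmerge]
      split_ifs with h1 h2
      · have h1 := Nat.eq_of_beq_eq_true h1
        subst h1
        have hp := pev_padd t p q
        split
        · next h' =>
          rw [h', pev] at hp
          rw [ih _ _ (by omega), rowv, rowv]
          have : Pi.single (M := fun _ => ℂ) c (pev t p) + Pi.single c (pev t q) = 0 := by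
            rw [← Pi.single_add, ← hp, Pi.single_zero]
          linear_combination -this
        · rw [rowv, ih _ _ (by omega), rowv, rowv, hp, Pi.single_add]
          abel
      · rw [rowv, ih _ _ (by simp; omega), rowv, rowv]
        abel
      · rw [rowv, ih _ _ (by simp; omega), rowv, rowv]
        abel

theorem radd_sound (t : ℂ) (r s) : rowv t (radd r s) = rowv t r + rowv t s :=
  rmerge_sound t _ _ _ le_rfl

theorem elim_sound (t : ℂ) (c p r x) :
    ∃ _ : ℂ, rowv t x = rowv t x ∧
      (rowv t (elim c p r x) = rowv t x ∧ rowv t x c = 0 ∨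
        rowv t (elim c p r x) = pev t p • rowv t x - rowv t x c • rowv t r) := by
  refine ⟨0, rfl, ?_⟩
  have := coef_sound t c x
  rw [elim]
  split
  · next h =>
    rw [h, pev] at this
    exact Or.inl ⟨rfl, this.symm⟩
  · right
    rw [radd_sound, rscale_sound, rscale_sound, pev_pscale, this, sub_eq_add_neg, ← neg_smul]
    simp

theorem pivot_sound {t : ℂ} (ht : gd t) {r0 r c p} (h : pivot r0 r = some (c, p)) :
    pev t p = rowv t r0 c ∧ pev t p ≠ 0 ∧ ∃ q, (c, q) ∈ r := by
  induction r with
  | nil => simp [pivot] at h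
  | cons e r ih =>
    obtain ⟨d, q⟩ := e
    rw [pivot] at h
    split_ifs at h with h1
    · simp only [Option.some.injEq, Prod.mk.injEq] at h
      obtain ⟨rfl, rfl⟩ := h
      exact ⟨coef_sound _ _ _, okp_sound ht _ _ h1, q, by simp⟩
    · obtain ⟨h1, h2, q, h3⟩ := ih h
      exact ⟨h1, h2, q, by simp [h3]⟩

/-- span of a list of rows -/
def sp (t : ℂ) (rs : List Row) : Submodule ℂ W := Submodule.span ℂ (rowv t '' {r | r ∈ rs})

instance (t : ℂ) (rs) : FiniteDimensional ℂ (sp t rs) :=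
  FiniteDimensional.span_of_finite ℂ (Set.Finite.image _ (List.finite_toSet rs))

theorem mem_sp {t : ℂ} {rs r} (h : r ∈ rs) : rowv t r ∈ sp t rs := Submodule.subset_span ⟨r, h, rfl⟩
theorem sp_le {t : ℂ} {rs} {X : Submodule ℂ W} : sp t rs ≤ X ↔ ∀ r ∈ rs, rowv t r ∈ X := by
  rw [sp, Submodule.span_le, Set.image_subset_iff]
  rfl
theorem sp_mono {t : ℂ} {rs rs' : List Row} (h : ∀ r ∈ rs, r ∈ rs') : sp t rs ≤ sp t rs' :=
  sp_le.2 fun r hr => mem_sp (h r hr)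
theorem sp_cons (t : ℂ) (r rs) : sp t (r :: rs) = Submodule.span ℂ {rowv t r} ⊔ sp t rs := by
  apply le_antisymm
  · rw [sp_le]
    intro x hx
    rcases List.mem_cons.1 hx with rfl | hx
    · exact Submodule.mem_sup_left (Submodule.mem_span_singleton_self _)
    · exact Submodule.mem_sup_right (mem_sp hx)
  · refine sup_le ?_ (sp_mono fun x hx => List.mem_cons_of_mem _ hx)
    rw [Submodule.span_singleton_le_iff_mem]
    exact mem_sp (by simp)
theorem sp_nil (t : ℂ) : sp t [] = ⊥ := by simp [sp]

variable {t : ℂ}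

theorem sp_elim_le (t : ℂ) (c p r rs) : sp t (rs.map (elim c p r)) ≤ sp t (r :: rs) := by
  rw [sp_le]
  intro x hx
  obtain ⟨y, hy, rfl⟩ := List.mem_map.1 hx
  obtain ⟨-, -, ⟨h, -⟩ | h⟩ := elim_sound t c p r y
  · rw [h]; exact mem_sp (by simp [hy])
  · rw [h]; exact sub_mem (Submodule.smul_mem _ _ (mem_sp (by simp [hy]))) (Submodule.smul_mem _ _ (mem_sp (by simp)))

theorem le_sp_elim {c p r} (rs) (hp : pev t p ≠ 0) :
    sp t rs ≤ Submodule.span ℂ {rowv t r} ⊔ sp t (rs.map (elim c p r)) := by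
  rw [sp_le]
  intro y hy
  have hm : rowv t (elim c p r y) ∈ sp t (rs.map (elim c p r)) := mem_sp (List.mem_map_of_mem hy)
  obtain ⟨-, -, ⟨h, -⟩ | h⟩ := elim_sound t c p r y
  · rw [← h]; exact Submodule.mem_sup_right hm
  · have : rowv t y = (pev t p)⁻¹ • (rowv t (elim c p r y) + rowv t y c • rowv t r) := by
      rw [h, sub_add_cancel, smul_smul, inv_mul_cancel₀ hp, one_smul]
    rw [this]
    refine Submodule.smul_mem _ _ (add_mem (Submodule.mem_sup_right hm) (Submodule.mem_sup_left ?_))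
    exact Submodule.smul_mem _ _ (Submodule.mem_span_singleton_self _)

theorem elim_zero {c p r} (rs : List Row) (hp : pev t p = rowv t r c) :
    ∀ x ∈ sp t (rs.map (elim c p r)), x c = 0 := by
  intro x hx
  have : sp t (rs.map (elim c p r)) ≤ LinearMap.ker (LinearMap.proj (R := ℂ) (φ := fun _ : ℕ => ℂ) c) := by
    rw [sp_le]
    intro z hz
    obtain ⟨y, hy, rfl⟩ := List.mem_map.1 hz
    rw [LinearMap.mem_ker, LinearMap.proj_apply]
    obtain ⟨-, -, ⟨h, h0⟩ | h⟩ := elim_sound t c p r y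
    · rw [h, h0]
    · rw [h]; simp [hp, mul_comm]
  exact this hx

theorem finrank_mono' {X Y : Submodule ℂ W} [FiniteDimensional ℂ Y] (h : X ≤ Y) : finrank ℂ X ≤ finrank ℂ Y :=
  Submodule.finrank_mono h

theorem rk_sound (ht : gd t) : ∀ n rs, rk n rs ≤ finrank ℂ (sp t rs) := by
  intro n
  induction n with
  | zero => intro rs; simp [rk]
  | succ n ih =>
    intro rs
    match rs with
    | [] => simp [rk]
    | r :: rs =>
      rw [rk]
      split
      · exact (ih rs).trans (finrank_mono' (sp_mono fun x hx => List.mem_cons_of_mem _ hx))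
      · next c p hpv =>
        obtain ⟨h1, h2, -⟩ := pivot_sound ht hpv
        have hz := elim_zero (t := t) rs h1
        have h3 := ih (rs.map (elim c p r))
        have h4 : sp t (rs.map (elim c p r)) < sp t (r :: rs) := by
          refine lt_of_le_of_ne (sp_elim_le _ _ _ _ _) fun he => ?_
          have := hz (rowv t r) (he ▸ mem_sp (by simp))
          exact h2 (h1.trans this)
        have := Submodule.finrank_lt_finrank_of_lt h4
        omega

theorem ech_sound (ht : gd t) : ∀ n rs o, ech n rs = some o → sp t rs ≤ sp t o := by
  intro n
  induction n with
  | zero => intro rs o h; simp [ech] at h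
  | succ n ih =>
    intro rs o h
    match rs, h with
    | [], h => simp [sp_nil]
    | [] :: rs, h =>
      rw [ech] at h
      rw [sp_cons]
      refine sup_le ?_ (ih _ _ h)
      simp [rowv]
    | (e :: r') :: rs, h =>
      rw [ech] at h
      · set r := e :: r' with hr
        split at h
        · simp at h
        · next c p hpv =>
          obtain ⟨h1, h2, -⟩ := pivot_sound ht hpv
          split at h
          · simp at h
          · next o' ho =>
            simp only [Option.some.injEq] at h
            subst h
            rw [sp_cons, sp_cons]
            exact sup_le le_sup_left ((le_sp_elim rs h2).trans (sup_le le_sup_left ((ih _ _ ho).trans le_sup_right)))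
      · simp

theorem redBy_sound (ht : gd t) : ∀ n rs ks o, redBy n rs ks = some o → sp t ks ≤ sp t rs ⊔ sp t o := by
  intro n
  induction n with
  | zero => intro rs ks o h; simp [redBy] at h
  | succ n ih =>
    intro rs ks o h
    match rs, h with
    | [], h =>
      simp only [redBy, Option.some.injEq] at h
      subst h
      exact le_sup_right
    | [] :: rs, h =>
      rw [redBy] at h
      exact (ih _ _ _ h).trans (sup_le_sup_right (sp_mono fun x hx => List.mem_cons_of_mem _ hx) _)
    | (e :: r') :: rs, h =>
      rw [redBy] at h
      · set r := e :: r' with hr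
        split at h
        · simp at h
        · next c p hpv =>
          obtain ⟨h1, h2, -⟩ := pivot_sound ht hpv
          refine (le_sp_elim ks h2).trans (sup_le ?_ ((ih _ _ _ h).trans (sup_le_sup_right (sp_elim_le _ _ _ _ _) _)))
          rw [sp_cons]
          exact le_sup_left.trans le_sup_left
      · simp

theorem leftPart_nil {r : Row} (h : leftPart r = []) : ∀ c < 1000, rowv t r c = 0 := by
  induction r with
  | nil => simp [rowv]
  | cons e r ih =>
    obtain ⟨d, q⟩ := e
    rw [leftPart] at h
    split_ifs at h with h1
    intro c hc
    have : c ≠ d := by rintro rfl; simp [Nat.blt_eq] at h1; omega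
    rw [rowv, Pi.add_apply, ih h c hc, Pi.single_eq_of_ne this, add_zero]

theorem mem_leftPart {r : Row} {c q} (h : (c, q) ∈ leftPart r) : c < 1000 := by
  induction r with
  | nil => simp [leftPart] at h
  | cons e r ih =>
    obtain ⟨d, p⟩ := e
    rw [leftPart] at h
    split_ifs at h with h1
    · rcases List.mem_cons.1 h with h | h
      · simp only [Prod.mk.injEq] at h
        rw [h.1]
        simpa [Nat.blt_eq] using h1
      · exact ih h
    · exact ih h

theorem kerv_sound (ht : gd t) : ∀ n rs o, kerv n rs = some o → ∀ y ∈ sp t rs, (∀ c < 1000, y c = 0) → y ∈ sp t o := by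
  intro n
  induction n with
  | zero => intro rs o h; simp [kerv] at h
  | succ n ih =>
    intro rs o h y hy h0
    match rs, h with
    | [], h => simp [sp_nil] at hy; subst hy; exact zero_mem _
    | r :: rs, h =>
      rw [kerv] at h
      rw [sp_cons] at hy
      split at h
      · next hl =>
        split at h
        · simp at h
        · next o' ho =>
          simp only [Option.some.injEq] at h
          subst h
          obtain ⟨u, hu, z, hz, rfl⟩ := Submodule.mem_sup.1 hy
          obtain ⟨α, rfl⟩ := Submodule.mem_span_singleton.1 hu
          rw [sp_cons]
          refine add_mem (Submodule.mem_sup_left hu) (Submodule.mem_sup_right (ih _ _ ho _ hz fun c hc => ?_))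
          have := h0 c hc
          simpa [leftPart_nil (t := t) hl c hc] using this
      · split at h
        · simp at h
        · next c p hpv =>
          obtain ⟨h1, h2, q, h3⟩ := pivot_sound ht hpv
          have hc := mem_leftPart h3
          have hy' := (sup_le le_sup_left (le_sp_elim (c := c) (p := p) (r := r) rs h2)) hy
          obtain ⟨u, hu, z, hz, rfl⟩ := Submodule.mem_sup.1 hy'
          obtain ⟨α, rfl⟩ := Submodule.mem_span_singleton.1 hu
          have hzc := elim_zero (t := t) rs h1 z hz
          have := h0 c hc
          rw [Pi.add_apply, hzc, Pi.smul_apply, smul_eq_mul, ← h1, add_zero] at this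
          have : α = 0 := by simpa [h2] using this
          subst this
          rw [zero_smul, zero_add] at h0 ⊢
          exact ih _ _ h z hz h0

def shift : W →ₗ[ℂ] W := LinearMap.funLeft ℂ ℂ (fun n => n + 1000)
theorem shift_apply (x : W) (n) : shift x n = x (n + 1000) := rfl
theorem unoff_sound (t : ℂ) (r) : rowv t (unoff r) = shift (rowv t r) := by
  induction r with
  | nil => simp [unoff, rowv]
  | cons e r ih =>
    obtain ⟨c, p⟩ := e
    rw [unoff]
    split_ifs with h
    · simp only [Nat.blt_eq] at h
      rw [rowv, map_add, ← ih]
      ext n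
      have : n + 1000 ≠ c := by omega
      rw [Pi.add_apply, shift_apply, Pi.single_eq_of_ne this, zero_add]
    · simp only [Nat.blt_eq, not_lt] at h
      rw [rowv, rowv, map_add, ← ih]
      ext n
      rw [Pi.add_apply, Pi.add_apply]
      refine congrArg (· + _) ?_
      rw [shift_apply]
      by_cases hn : n + 1000 = c
      · have h' : n = c - 1000 := by omega
        rw [hn, h', Pi.single_eq_same, Pi.single_eq_same]
      · have h' : n ≠ c - 1000 := by omega
        rw [Pi.single_eq_of_ne h', Pi.single_eq_of_ne hn]

/-- support weight condition -/
def SW (wt : ℕ → ℕ) (w : ℕ) (x : W) : Prop := ∀ n, x n ≠ 0 → wt n = w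

theorem rkb_sound (ht : gd t) (wt : ℕ → ℕ) : ∀ d m rows, (∀ e ∈ rows, SW wt e.1 (rowv t e.2)) →
    rkb d m rows ≤ finrank ℂ (sp t (rows.map (·.2))) := by
  intro d
  induction d with
  | zero =>
    intro m rows h
    match rows with
    | [] => simp [rkb]
    | e :: rows => rw [rkb]; exact rk_sound ht _ _; simp
  | succ d ih =>
    intro m rows h
    match rows, h with
    | [], h => simp [rkb]
    | e :: rs, h =>
      rw [rkb]
      swap
      · simp
      generalize e :: rs = rows at h
      set M := m + 2 ^ d
      set lo := rows.filter fun e => Nat.blt e.1 M with hlo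
      set hi := rows.filter fun e => Nat.ble M e.1 with hhi
      have a1 := ih m lo fun e he => h e (List.mem_of_mem_filter he)
      have a2 := ih M hi fun e he => h e (List.mem_of_mem_filter he)
      refine (add_le_add a1 a2).trans ?_
      have hlo' : ∀ x ∈ sp t (lo.map (·.2)), ∀ n, M ≤ wt n → x n = 0 := by
        intro x hx n hn
        have : sp t (lo.map (·.2)) ≤ LinearMap.ker (LinearMap.proj (R := ℂ) (φ := fun _ : ℕ => ℂ) n) := by
          rw [sp_le]
          intro r hr
          obtain ⟨e, he, rfl⟩ := List.mem_map.1 hr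
          rw [LinearMap.mem_ker, LinearMap.proj_apply]
          by_contra h0
          have h1 := h e (List.mem_of_mem_filter he) n h0
          have h2 := (List.mem_filter.1 he).2
          rw [Nat.blt_eq] at h2
          omega
        exact this hx
      have hhi' : ∀ x ∈ sp t (hi.map (·.2)), ∀ n, wt n < M → x n = 0 := by
        intro x hx n hn
        have : sp t (hi.map (·.2)) ≤ LinearMap.ker (LinearMap.proj (R := ℂ) (φ := fun _ : ℕ => ℂ) n) := by
          rw [sp_le]
          intro r hr
          obtain ⟨e, he, rfl⟩ := List.mem_map.1 hr
          rw [LinearMap.mem_ker, LinearMap.proj_apply]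
          by_contra h0
          have h1 := h e (List.mem_of_mem_filter he) n h0
          have h2 := (List.mem_filter.1 he).2
          have h2 := Nat.le_of_ble_eq_true h2
          omega
        exact this hx
      have hd : sp t (lo.map (·.2)) ⊓ sp t (hi.map (·.2)) = ⊥ := by
        rw [eq_bot_iff]
        rintro x ⟨h1, h2⟩
        rw [Submodule.mem_bot]
        ext n
        rcases lt_or_ge (wt n) M with hn | hn
        · exact hhi' x h2 n hn
        · exact hlo' x h1 n hn
      have := Submodule.finrank_sup_add_finrank_inf_eq (sp t (lo.map (·.2))) (sp t (hi.map (·.2)))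
      rw [hd, finrank_bot, add_zero] at this
      rw [← this]
      refine finrank_mono' (sup_le (sp_mono ?_) (sp_mono ?_))
      · intro r hr
        obtain ⟨e, he, rfl⟩ := List.mem_map.1 hr
        exact List.mem_map_of_mem (List.mem_of_mem_filter he)
      · intro r hr
        obtain ⟨e, he, rfl⟩ := List.mem_map.1 hr
        exact List.mem_map_of_mem (List.mem_of_mem_filter he)
end BR

set_option linter.unusedSimpArgs false
namespace BR
open Module

def prw (w : ℕ) (x : W) : W := fun n => if wcode n = w then x n else 0
def nv (n : ℕ) : W := ((nL n).map fun c => Pi.single (M := fun _ => ℂ) c 1).sum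
def NN (x : W) : W := ∑ n ∈ Finset.Ico 18 81, x n • nv n

def R210 (a : ℕ) : W →ₗ[ℂ] W where
  toFun y m := if m/81 < m/9%9 then (if m/81 = a then y (9*(m/9%9)+m%9) else 0)
    - (if m/9%9 = a then y (9*(m/81)+m%9) else 0) else 0
  map_add' x y := by ext m; simp only [Pi.add_apply]; split_ifs <;> ring
  map_smul' c x := by ext m; simp only [Pi.smul_apply, smul_eq_mul, RingHom.id_apply]; split_ifs <;> ring
def R120 (b : ℕ) : W →ₗ[ℂ] W where
  toFun y m := if m/9%9 < m%9 then (if m/9%9 = b then y (9*(m/81)+m%9) else 0)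
    - (if m%9 = b then y (9*(m/81)+m/9%9) else 0) else 0
  map_add' x y := by ext m; simp only [Pi.add_apply]; split_ifs <;> ring
  map_smul' c x := by ext m; simp only [Pi.smul_apply, smul_eq_mul, RingHom.id_apply]; split_ifs <;> ring
theorem R210_apply (a y m) : R210 a y m = if m/81 < m/9%9 then (if m/81 = a then y (9*(m/9%9)+m%9) else 0)
    - (if m/9%9 = a then y (9*(m/81)+m%9) else 0) else 0 := rfl
theorem R120_apply (b y m) : R120 b y m = if m/9%9 < m%9 then (if m/9%9 = b then y (9*(m/81)+m%9) else 0)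
    - (if m%9 = b then y (9*(m/81)+m/9%9) else 0) else 0 := rfl

theorem R210_single (a c : ℕ) (q : ℂ) (ha : a < 9) (hc : c < 81) : R210 a (Pi.single c q) =
    if c / 9 < a then Pi.single (9 * (9 * (c / 9) + a) + c % 9) (-q)
    else if a < c / 9 then Pi.single (9 * (9 * a + c / 9) + c % 9) q else 0 := by
  ext m
  rw [R210_apply]
  simp only [Pi.single_apply]
  split_ifs <;> simp only [Pi.single_apply, Pi.zero_apply] <;> (try split_ifs) <;> first | omega | simp
theorem R120_single (b c : ℕ) (q : ℂ) (hb : b < 9) (hc : c < 81) : R120 b (Pi.single c q) =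
    if c % 9 < b then Pi.single (9 * (9 * (c / 9) + c % 9) + b) (-q)
    else if b < c % 9 then Pi.single (9 * (9 * (c / 9) + b) + c % 9) q else 0 := by
  ext m
  rw [R120_apply]
  simp only [Pi.single_apply]
  split_ifs <;> simp only [Pi.single_apply, Pi.zero_apply] <;> (try split_ifs) <;> first | omega | simp

theorem row210_sound (t : ℂ) (a : ℕ) (ha : a < 9) (r : Row) (hr : ∀ e ∈ r, e.1 < 81) :
    rowv t (row210 a r) = R210 a (rowv t r) := by
  induction r with
  | nil => simp [row210, rowv]
  | cons e r ih =>
    obtain ⟨c, p⟩ := e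
    have ih := ih fun e he => hr e (by simp [he])
    have hc : c < 81 := hr (c, p) (by simp)
    rw [row210, rowv, map_add, R210_single _ _ _ ha hc, ← ih]
    simp only [Nat.blt_eq]
    split_ifs <;> simp [rowv, pev_pscale]
theorem row120_sound (t : ℂ) (a : ℕ) (ha : a < 9) (r : Row) (hr : ∀ e ∈ r, e.1 < 81) :
    rowv t (row120 a r) = R120 a (rowv t r) := by
  induction r with
  | nil => simp [row120, rowv]
  | cons e r ih =>
    obtain ⟨c, p⟩ := e
    have ih := ih fun e he => hr e (by simp [he])
    have hc : c < 81 := hr (c, p) (by simp)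
    rw [row120, rowv, map_add, R120_single _ _ _ ha hc, ← ih]
    simp only [Nat.blt_eq]
    split_ifs <;> simp [rowv, pev_pscale]

def wt3 (m : ℕ) : ℕ := wn (m/81) + wn (m/9%9) + wn (m%9)
theorem wcode_mk (a b : ℕ) (hb : b < 9) : wcode (9*a+b) = wn a + wn b := by
  have h1 : (9*a+b)/9 = a := by omega
  have h2 : (9*a+b)%9 = b := by omega
  rw [wcode, h1, h2]
theorem R210_wt {a w y} (h : SW wcode w y) : SW wt3 (w + wn a) (R210 a y) := by
  intro m hm
  rw [R210_apply] at hm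
  have hb : m % 9 < 9 := Nat.mod_lt _ (by norm_num)
  have key : (m/81 = a ∧ y (9*(m/9%9)+m%9) ≠ 0) ∨ (m/9%9 = a ∧ y (9*(m/81)+m%9) ≠ 0) := by
    by_contra! hk
    apply hm
    split_ifs <;> simp_all
  rcases key with ⟨h1, h2⟩ | ⟨h1, h2⟩ <;> have := h _ h2 <;> rw [wcode_mk _ _ hb] at this <;> rw [wt3] <;> rw [h1] at * <;> omega
theorem R120_wt {a w y} (h : SW wcode w y) : SW wt3 (w + wn a) (R120 a y) := by
  intro m hm
  rw [R120_apply] at hm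
  have hb : m % 9 < 9 := Nat.mod_lt _ (by norm_num)
  have hb' : m / 9 % 9 < 9 := Nat.mod_lt _ (by norm_num)
  have key : (m/9%9 = a ∧ y (9*(m/81)+m%9) ≠ 0) ∨ (m%9 = a ∧ y (9*(m/81)+m/9%9) ≠ 0) := by
    by_contra! hk
    apply hm
    split_ifs <;> simp_all
  rcases key with ⟨h1, h2⟩ | ⟨h1, h2⟩ <;> have := h _ h2
  · rw [wcode_mk _ _ hb] at this; rw [wt3, h1]; omega
  · rw [wcode_mk _ _ hb'] at this; rw [wt3, h1]; omega

structure Cond (E : Submodule ℂ W) : Prop where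
  dim : finrank ℂ E = 14
  supp : ∀ x ∈ E, ∀ n, x n ≠ 0 → 18 ≤ n ∧ n < 81
  gr : ∀ x ∈ E, ∀ w, prw w x ∈ E
  nn : ∀ x ∈ E, NN x ∈ E
  T : ∀ e ∈ L0, ∀ t, rowv t e.2 ∈ E
  z210 : ∃ Z : Submodule ℂ (Fin 7 → W), 14 ≤ finrank ℂ Z ∧
    ∀ z ∈ Z, (∀ a, z a ∈ E) ∧ ∑ a : Fin 7, R210 (a.val + 2) (z a) = 0
  z120 : ∃ Z : Submodule ℂ (Fin 9 → W), 14 ≤ finrank ℂ Z ∧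
    ∀ z ∈ Z, (∀ a, z a ∈ E) ∧ ∑ a : Fin 9, R120 a.val (z a) = 0

theorem rank_test {E : Submodule ℂ W} (hd : finrank ℂ E = 14) {k : ℕ} (R : Fin k → W →ₗ[ℂ] W)
    (Z : Submodule ℂ (Fin k → W)) (hZ : 14 ≤ finrank ℂ Z)
    (h : ∀ z ∈ Z, (∀ a, z a ∈ E) ∧ ∑ a, R a (z a) = 0)
    (X : Submodule ℂ W) (hX : ∀ x ∈ X, ∃ y : Fin k → E, ∑ a, R a (y a) = x) :
    finrank ℂ X + 14 ≤ 14 * k := by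
  have : FiniteDimensional ℂ E := Module.finite_of_finrank_pos (by omega)
  let Θ : (Fin k → E) →ₗ[ℂ] W := ∑ a, (R a).comp (E.subtype.comp (LinearMap.proj a))
  have hΘ : ∀ y, Θ y = ∑ a, R a (y a) := by intro y; simp [Θ]
  have h1 := Θ.finrank_range_add_finrank_ker
  rw [Module.finrank_pi_fintype] at h1
  simp only [hd, Finset.sum_const, Finset.card_univ, Fintype.card_fin, smul_eq_mul] at h1
  have h2 : finrank ℂ X ≤ finrank ℂ (LinearMap.range Θ) := by
    apply Submodule.finrank_mono
    intro x hx
    obtain ⟨y, rfl⟩ := hX x hx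
    exact ⟨y, hΘ y⟩
  let inc : (Fin k → E) →ₗ[ℂ] (Fin k → W) := LinearMap.pi fun a => E.subtype.comp (LinearMap.proj a)
  have h3 : Z ≤ (LinearMap.ker Θ).map inc := by
    intro z hz
    obtain ⟨h3, h4⟩ := h z hz
    refine ⟨fun a => ⟨z a, h3 a⟩, ?_, ?_⟩
    · simp only [SetLike.mem_coe, LinearMap.mem_ker, hΘ, h4]
    · ext a n; simp [inc]
  have h4 := Submodule.finrank_mono h3
  have h5 := Submodule.finrank_map_le inc (LinearMap.ker Θ)
  linarith

theorem homS_sound {t : ℂ} {S : St} (h : homS S = true) :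
    ∀ e ∈ S, SW wcode e.1 (rowv t e.2) ∧ ∀ f ∈ e.2, f.1 < 81 := by
  intro e he
  have h := List.all_eq_true.1 h e he
  have h : ∀ f ∈ e.2, f.1 < 81 ∧ wcode f.1 = e.1 := by
    intro f hf
    have := List.all_eq_true.1 h f hf
    simp only [Bool.and_eq_true, Nat.blt_eq, Nat.beq_eq] at this
    exact ⟨this.1.2, this.2⟩
  refine ⟨?_, fun f hf => (h f hf).1⟩
  generalize e.1 = w at h
  generalize e.2 = r at h
  induction r with
  | nil => intro n hn; simp [rowv] at hn
  | cons f r ih =>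
    intro n hn
    obtain ⟨d, q⟩ := f
    by_cases hd : n = d
    · subst hd; exact (h (n, q) (by simp)).2
    · rw [rowv, Pi.add_apply, Pi.single_eq_of_ne hd, zero_add] at hn
      exact ih (fun f hf => h f (by simp [hf])) n hn

theorem sum_single_fin {k : ℕ} {E : Submodule ℂ W} (R : Fin k → W →ₗ[ℂ] W) (rs : List Row) (t : ℂ)
    (h : ∀ r ∈ rs, ∃ a, ∃ x ∈ E, rowv t r = R a x) :
    ∀ x ∈ sp t rs, ∃ y : Fin k → E, ∑ a, R a (y a) = x := by
  let Θ : (Fin k → E) →ₗ[ℂ] W := ∑ a, (R a).comp (E.subtype.comp (LinearMap.proj a))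
  have hΘ : ∀ y, Θ y = ∑ a, R a (y a) := by intro y; simp [Θ]
  have : sp t rs ≤ LinearMap.range Θ := by
    rw [sp_le]
    intro r hr
    obtain ⟨a, x, hx, h⟩ := h r hr
    refine ⟨Pi.single a ⟨x, hx⟩, ?_⟩
    rw [hΘ, Finset.sum_eq_single a, h]
    · simp
    · intro b _ hb; simp [Pi.single_eq_of_ne hb]
    · simp
  intro x hx
  obtain ⟨y, hy⟩ := this hx
  exact ⟨y, by rw [← hΘ, hy]⟩

theorem finrank_sp_le (t : ℂ) (rs) : finrank ℂ (sp t rs) ≤ rs.length := by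
  induction rs with
  | nil => simp [sp_nil]
  | cons r rs ih =>
    rw [sp_cons]
    have h1 := Submodule.finrank_add_le_finrank_add_finrank (Submodule.span ℂ {rowv t r}) (sp t rs)
    have h2 : finrank ℂ (Submodule.span ℂ {rowv t r}) ≤ 1 := by
      have := finrank_span_le_card (R := ℂ) ({rowv t r} : Set W)
      simpa using this
    simp only [List.length_cons]
    omega

theorem leaf_sound {E : Submodule ℂ W} (hE : Cond E) {t : ℂ} (ht : gd t) {S : St}
    (hS : ∀ e ∈ S, rowv t e.2 ∈ E) (h : leaf S = true) : E ≤ sp t (candS.map (·.2)) := by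
  simp only [leaf, Bool.and_eq_true, Bool.or_eq_true] at h
  obtain ⟨hh, (h | h) | h⟩ := h
  · exfalso
    have h := Nat.le_of_ble_eq_true h
    have hs := homS_sound (t := t) hh
    have h1 := rkb_sound ht wt3 7 0 (rows210 S) (by
      intro e he
      simp only [rows210, List.mem_flatMap, List.mem_map, List.mem_range] at he
      obtain ⟨e0, he0, a, ⟨a', ha', rfl⟩, rfl⟩ := he
      simp only
      rw [row210_sound _ _ (by omega) _ (hs _ he0).2]
      exact R210_wt (hs _ he0).1)
    obtain ⟨Z, hZ, hz⟩ := hE.z210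
    have h2 := rank_test hE.dim (fun a : Fin 7 => R210 (a.val + 2)) Z hZ hz _ (sum_single_fin (fun a : Fin 7 => R210 (a.val + 2))
      ((rows210 S).map (·.2)) t (by
        intro r hr
        simp only [rows210, List.mem_flatMap, List.mem_map, List.mem_range] at hr
        obtain ⟨e, ⟨e0, he0, a, ⟨a', ha', rfl⟩, rfl⟩, rfl⟩ := hr
        exact ⟨⟨a', ha'⟩, rowv t e0.2, hS _ he0, row210_sound _ _ (by omega) _ (hs _ he0).2⟩))
    rw [blockRk] at h
    omega
  · exfalso
    have h := Nat.le_of_ble_eq_true h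
    have hs := homS_sound (t := t) hh
    have h1 := rkb_sound ht wt3 7 0 (rows120 S) (by
      intro e he
      simp only [rows120, List.mem_flatMap, List.mem_map, List.mem_range] at he
      obtain ⟨e0, he0, a, ha', rfl⟩ := he
      simp only
      rw [row120_sound _ _ (by omega) _ (hs _ he0).2]
      exact R120_wt (hs _ he0).1)
    obtain ⟨Z, hZ, hz⟩ := hE.z120
    have h2 := rank_test hE.dim (fun a : Fin 9 => R120 a.val) Z hZ hz _ (sum_single_fin (fun a : Fin 9 => R120 a.val)
      ((rows120 S).map (·.2)) t (by
        intro r hr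
        simp only [rows120, List.mem_flatMap, List.mem_map, List.mem_range] at hr
        obtain ⟨e, ⟨e0, he0, a, ha', rfl⟩, rfl⟩ := hr
        exact ⟨⟨a, ha'⟩, rowv t e0.2, hS _ he0, row120_sound _ _ (by omega) _ (hs _ he0).2⟩))
    rw [blockRk] at h
    omega
  · simp only [isCand, Bool.and_eq_true, Nat.beq_eq] at h
    obtain ⟨h1, h2⟩ := h
    have : FiniteDimensional ℂ E := Module.finite_of_finrank_pos (by rw [hE.dim]; omega)
    have h3 := rk_sound ht 20 (S.map (·.2))
    have h4 : sp t (S.map (·.2)) ≤ E := by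
      rw [sp_le]
      intro r hr
      obtain ⟨e, he, rfl⟩ := List.mem_map.1 hr
      exact hS e he
    have h5 : sp t (S.map (·.2)) = E := Submodule.eq_of_le_of_finrank_le h4 (by rw [hE.dim]; omega)
    rw [← h5]
    split at h2
    · simp at h2
    · next l hl =>
      refine (redBy_sound ht _ _ _ _ hl).trans (sup_le le_rfl ?_)
      rw [sp_le]
      intro r hr
      have := List.all_eq_true.1 h2 r hr
      rw [List.isEmpty_iff] at this
      subst this
      exact zero_mem _

def spw (t : ℂ) (S : St) (v : ℕ) : Submodule ℂ W := sp t ((S.filter fun e => Nat.beq e.1 v).map (·.2))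

theorem foldr_nv (t : ℂ) (l : List ℕ) : rowv t (l.foldr (fun c r => radd [(c, [1])] r) []) =
    (l.map fun c => Pi.single (M := fun _ => ℂ) c 1).sum := by
  induction l with
  | nil => simp [rowv]
  | cons c l ih => simp [List.foldr_cons, radd_sound, ih, rowv, pev]

theorem nE_sound (t : ℂ) (n : ℕ) : rowv t (nE n) = nv n + Pi.single (n + 1000) 1 := by
  rw [nE, radd_sound, foldr_nv]
  simp [rowv, pev, nv]

theorem nL_wt : ∀ n ∈ Finset.Ico 18 81, ∀ c ∈ nL n, (wcode c + 1 = wcode n ∨ wcode c + 2 = wcode n ∨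
    wcode c + 7 = wcode n ∨ wcode c + 14 = wcode n) := by decide +kernel

theorem nv_supp (n c : ℕ) (h : nv n c ≠ 0) : c ∈ nL n := by
  rw [nv] at h
  generalize nL n = l at h
  induction l with
  | nil => simp at h
  | cons d l ih =>
    by_cases hd : c = d
    · simp [hd]
    · rw [List.map_cons, List.sum_cons, Pi.add_apply, Pi.single_eq_of_ne hd, zero_add] at h
      simp [ih h]

theorem wcode_lt (n : ℕ) (h : n ∈ Finset.Ico 18 81) : wcode n < 49 := by
  revert n; decide +kernel

theorem x_eq_sum {E : Submodule ℂ W} (hE : Cond E) {x : W} (hx : x ∈ E) :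
    x = ∑ n ∈ Finset.Ico 18 81, x n • Pi.single (M := fun _ => ℂ) n 1 := by
  ext m
  rw [Finset.sum_apply]
  by_cases hm : x m = 0
  · rw [hm, Finset.sum_eq_zero]
    intro n _
    by_cases h : m = n
    · subst h; simp [hm]
    · simp [Pi.single_eq_of_ne h]
  · rw [Finset.sum_eq_single m]
    · simp
    · intro b _ hb; simp [Pi.single_eq_of_ne hb.symm]
    · intro h; exact absurd (Finset.mem_Ico.2 (hE.supp x hx m hm)) h

theorem sum_prw {E : Submodule ℂ W} (hE : Cond E) {x : W} (hx : x ∈ E) :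
    x = ∑ w ∈ Finset.range 49, prw w x := by
  ext m
  rw [Finset.sum_apply]
  simp only [prw]
  by_cases hm : x m = 0
  · simp [hm]
  · have := wcode_lt m (Finset.mem_Ico.2 (hE.supp x hx m hm))
    simp [this]

theorem SW_prw (w x) : SW wcode w (prw w x) := by
  intro n hn
  by_contra h
  simp [prw, h] at hn

theorem newH_sound {E : Submodule ℂ W} (hE : Cond E) {t : ℂ} (ht : gd t) {S : St} {w : ℕ}
    (hl : ∀ v < w, ∀ y ∈ E, SW wcode v y → y ∈ spw t S v) {H} (h : newH S w = some H)
    {x : W} (hx : x ∈ E) (hw : SW wcode w x) : x ∈ spw t S w ⊔ sp t H := by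
  rw [newH] at h
  simp only at h
  split at h
  · simp at h
  next ks hks =>
  split at h
  · simp at h
  next ks' hks' =>
  set B := (S.filter fun e => Nat.beq (e.1+1) w || Nat.beq (e.1+2) w || Nat.beq (e.1+7) w || Nat.beq (e.1+14) w).map (·.2) with hB
  have hyB : NN x ∈ sp t B := by
    have hy := hE.nn x hx
    rw [sum_prw hE hy]
    refine Submodule.sum_mem _ fun v hv => ?_
    by_cases hvw : v + 1 = w ∨ v + 2 = w ∨ v + 7 = w ∨ v + 14 = w
    · have := hl v (by omega) _ (hE.gr _ hy v) (SW_prw _ _)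
      refine sp_mono ?_ this
      intro r hr
      obtain ⟨e, he, rfl⟩ := List.mem_map.1 hr
      obtain ⟨he1, he2⟩ := List.mem_filter.1 he
      refine List.mem_map_of_mem (List.mem_filter.2 ⟨he1, ?_⟩)
      have : e.1 = v := by simpa using he2
      simp only [this, Bool.or_eq_true, Nat.beq_eq]
      omega
    · have : prw v (NN x) = 0 := by
        ext c
        by_contra h0
        have h1 : wcode c = v := SW_prw _ _ c h0
        have h2 : NN x c ≠ 0 := by
          intro h2; apply h0; simp [prw, h2]
        rw [NN, Finset.sum_apply] at h2
        obtain ⟨n, hn, hn'⟩ := Finset.exists_ne_zero_of_sum_ne_zero h2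
        rw [Pi.smul_apply, smul_eq_mul] at hn'
        have h3 := hw n (left_ne_zero_of_mul hn')
        have h4 := nL_wt n hn c (nv_supp n c (right_ne_zero_of_mul hn'))
        rw [h1, h3] at h4
        exact hvw h4
      rw [this]; exact zero_mem _
  set z := ∑ n ∈ Finset.Ico 18 81, x n • Pi.single (M := fun _ => ℂ) (n+1000) 1 with hz
  have hz' : z = (∑ n ∈ Finset.Ico 18 81, x n • rowv t (nE n)) - NN x := by
    rw [NN, ← Finset.sum_sub_distrib]
    refine Finset.sum_congr rfl fun n _ => ?_
    rw [nE_sound, smul_add, add_sub_cancel_left]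
  have hz0 : ∀ c < 1000, z c = 0 := by
    intro c hc
    rw [hz, Finset.sum_apply]
    refine Finset.sum_eq_zero fun n _ => ?_
    rw [Pi.smul_apply, Pi.single_eq_of_ne (by omega), smul_zero]
  have hzm : z ∈ sp t (B ++ (coords w).map nE) := by
    rw [hz']
    refine sub_mem (Submodule.sum_mem _ fun n hn => ?_) (sp_mono (by simp_all) hyB)
    by_cases h0 : x n = 0
    · rw [h0, zero_smul]; exact zero_mem _
    · refine Submodule.smul_mem _ _ (mem_sp ?_)
      rw [List.mem_append]
      right
      refine List.mem_map_of_mem ?_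
      rw [coords, List.mem_filter]
      refine ⟨?_, by simpa using hw n h0⟩
      rw [Finset.mem_Ico] at hn
      rw [codes, List.mem_map]
      exact ⟨n - 18, by rw [List.mem_range]; omega, by omega⟩
  have h1 := kerv_sound ht _ _ _ hks z hzm hz0
  have h2 : shift z = x := by
    conv_rhs => rw [x_eq_sum hE hx]
    rw [hz, map_sum]
    refine Finset.sum_congr rfl fun n _ => ?_
    rw [map_smul]
    refine congrArg (x n • ·) ?_
    ext m
    rw [shift_apply]
    by_cases hmn : m = n
    · rw [hmn, Pi.single_eq_same, Pi.single_eq_same]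
    · rw [Pi.single_eq_of_ne hmn, Pi.single_eq_of_ne (by omega)]
  have h3 : x ∈ sp t (ks.map unoff) := by
    rw [← h2]
    have : sp t ks ≤ (sp t (ks.map unoff)).comap shift := by
      rw [sp_le]
      intro r hr
      rw [Submodule.mem_comap, ← unoff_sound]
      exact mem_sp (List.mem_map_of_mem hr)
    exact this h1
  have h4 := redBy_sound ht _ _ _ _ hks' h3
  exact (sup_le_sup_left (ech_sound ht _ _ _ h) _) h4

theorem isConst_sound {S : St} (h : isConst S = true) (t t' : ℂ) : ∀ e ∈ S, rowv t e.2 = rowv t' e.2 := by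
  intro e he
  have h := List.all_eq_true.1 h e he
  have h : ∀ f ∈ e.2, f.2.length ≤ 1 := fun f hf => Nat.le_of_ble_eq_true (List.all_eq_true.1 h f hf)
  generalize e.2 = r at h
  induction r with
  | nil => rfl
  | cons f r ih =>
    obtain ⟨d, q⟩ := f
    rw [rowv, rowv, ih fun f hf => h f (by simp [hf])]
    have : pev t q = pev t' q := by
      have := h (d, q) (by simp)
      match q, this with
      | [], _ => rfl
      | [a], _ => simp [pev]
      | a :: b :: q, h => simp at h
    rw [this]

theorem weights_mem : ∀ n ∈ Finset.Ico 18 81, wcode n ∈ weights := by decide +kernel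

theorem explore_sound {E : Submodule ℂ W} (hE : Cond E) : ∀ n m S t, gd t → S.length + n = 14 →
    (∀ e ∈ S, rowv t e.2 ∈ E) → (∀ v < m, ∀ y ∈ E, SW wcode v y → y ∈ spw t S v) →
    explore n m S = true → ∃ t', E ≤ sp t' (candS.map (·.2)) := by
  intro n
  induction n with
  | zero =>
    intro m S t ht _ hS _ h
    rw [explore] at h
    exact ⟨t, leaf_sound hE ht hS h⟩
  | succ n ih =>
    intro m S t ht hlen hS hlow h
    by_cases hall : ∀ w, ∀ y ∈ E, SW wcode w y → y ∈ spw t S w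
    · exfalso
      have h1 : E ≤ sp t (S.map (·.2)) := by
        intro x hx
        rw [sum_prw hE hx]
        refine Submodule.sum_mem _ fun v _ => ?_
        refine sp_mono ?_ (hall v _ (hE.gr x hx v) (SW_prw _ _))
        intro r hr
        obtain ⟨e, he, rfl⟩ := List.mem_map.1 hr
        exact List.mem_map_of_mem (List.mem_of_mem_filter he)
      have h2 := finrank_mono' h1
      have h3 := finrank_sp_le t (S.map (·.2))
      rw [hE.dim] at h2
      rw [List.length_map] at h3
      omega
    · push Not at hall
      classical
      have hw := Nat.find_spec hall
      have hmin : ∀ v < Nat.find hall, ∀ y ∈ E, SW wcode v y → y ∈ spw t S v := by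
        intro v hv
        have := Nat.find_min hall hv
        push Not at this
        exact this
      generalize Nat.find hall = w at hw hmin
      obtain ⟨x, hx, hxw, hxn⟩ := hw
      have hmw : m ≤ w := by
        by_contra hc
        exact hxn (hlow w (by omega) x hx hxw)
      have hwm : w ∈ weights := by
        have : ∃ n, x n ≠ 0 := by
          by_contra! h0
          apply hxn
          have : x = 0 := by ext n; exact h0 n
          rw [this]; exact zero_mem _
        obtain ⟨n, hn⟩ := this
        rw [← hxw n hn]
        exact weights_mem n (Finset.mem_Ico.2 (hE.supp x hx n hn))
      rw [explore] at h
      have h := List.all_eq_true.1 h w hwm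
      have hb : Nat.blt w m = false := by
        rw [← Bool.not_eq_true, Nat.blt_eq]; omega
      rw [hb, Bool.false_or] at h
      have hSE : spw t S w ≤ E := by
        rw [spw, sp_le]
        intro r hr
        obtain ⟨e, he, rfl⟩ := List.mem_map.1 hr
        exact hS e (List.mem_of_mem_filter he)
      have step : ∀ g t', gd t' → (∀ e ∈ S, rowv t' e.2 = rowv t e.2) → rowv t' g ∈ E →
          explore n w (S ++ [(w, g)]) = true → ∃ t', E ≤ sp t' (candS.map (·.2)) := by
        intro g t' ht' hc hg he
        refine ih w _ t' ht' (by simp; omega) ?_ ?_ he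
        · intro e he
          rcases List.mem_append.1 he with he | he
          · rw [hc e he]; exact hS e he
          · simp only [List.mem_singleton] at he
            subst he; exact hg
        · intro v hv y hy hyv
          have h1 := hmin v hv y hy hyv
          have h2 : spw t S v ≤ spw t' (S ++ [(w, g)]) v := by
            rw [spw, sp_le]
            intro r hr
            obtain ⟨e, he, rfl⟩ := List.mem_map.1 hr
            rw [← hc e (List.mem_of_mem_filter he)]
            refine mem_sp (List.mem_map_of_mem ?_)
            rw [List.filter_append]
            exact List.mem_append_left _ he
          exact h2 h1
      split at h
      · next hH =>
        have := newH_sound hE ht hmin hH hx hxw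
        rw [sp_nil, sup_bot_eq] at this
        exact absurd this hxn
      · next g hH =>
        have := newH_sound hE ht hmin hH hx hxw
        rw [sp_cons, sp_nil, sup_bot_eq] at this
        obtain ⟨s, hs, u, hu, hsu⟩ := Submodule.mem_sup.1 this
        obtain ⟨α, rfl⟩ := Submodule.mem_span_singleton.1 hu
        have hα : α ≠ 0 := by
          rintro rfl
          rw [zero_smul, add_zero] at hsu
          exact hxn (hsu ▸ hs)
        refine step g t ht (fun _ _ => rfl) ?_ h
        have : rowv t g = α⁻¹ • (x - s) := by
          rw [← hsu, add_sub_cancel_left, smul_smul, inv_mul_cancel₀ hα, one_smul]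
        rw [this]
        exact Submodule.smul_mem _ _ (sub_mem hx (hSE hs))
      · next g1 g2 hH =>
        have := newH_sound hE ht hmin hH hx hxw
        rw [sp_cons, sp_cons, sp_nil, sup_bot_eq] at this
        obtain ⟨s, hs, u, hu, hsu⟩ := Submodule.mem_sup.1 this
        obtain ⟨u1, hu1, u2, hu2, rfl⟩ := Submodule.mem_sup.1 hu
        obtain ⟨α, rfl⟩ := Submodule.mem_span_singleton.1 hu1
        obtain ⟨β, rfl⟩ := Submodule.mem_span_singleton.1 hu2
        simp only [Bool.and_eq_true] at h
        obtain ⟨⟨hc1, hc2⟩, ⟨⟨⟨ha, hb⟩, hc⟩, hd⟩, he⟩ := h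
        have hmem : α • rowv t g1 + β • rowv t g2 ∈ E := by
          have : α • rowv t g1 + β • rowv t g2 = x - s := by rw [← hsu]; abel
          rw [this]; exact sub_mem hx (hSE hs)
        by_cases hα : α = 0
        · subst hα
          rw [zero_smul, zero_add] at hmem hsu
          have hβ : β ≠ 0 := by
            rintro rfl
            rw [zero_smul, add_zero] at hsu
            exact hxn (hsu ▸ hs)
          refine step g2 t ht (fun _ _ => rfl) ?_ ha
          have := Submodule.smul_mem _ β⁻¹ hmem
          rwa [smul_smul, inv_mul_cancel₀ hβ, one_smul] at this
        · have hmem : rowv t g1 + (α⁻¹ * β) • rowv t g2 ∈ E := by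
            have := Submodule.smul_mem _ α⁻¹ hmem
            rwa [smul_add, smul_smul, smul_smul, inv_mul_cancel₀ hα, one_smul] at this
          generalize α⁻¹ * β = τ at hmem
          by_cases h0 : τ = 0
          · refine step g1 t ht (fun _ _ => rfl) ?_ hb
            simpa [h0] using hmem
          by_cases h1 : τ = 1
          · refine step _ t ht (fun _ _ => rfl) ?_ hc
            rw [radd_sound]
            simpa [h1] using hmem
          by_cases h2 : τ = -1
          · refine step _ t ht (fun _ _ => rfl) ?_ hd
            rw [radd_sound, rscale_sound]
            simpa [h2, pev] using hmem
          · refine step _ τ ⟨h0, h1, h2⟩ (isConst_sound hc1 τ t) ?_ he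
            rw [radd_sound, rscale_sound]
            have e1 := isConst_sound hc2 τ t (0, g1) (by simp)
            have e2 := isConst_sound hc2 τ t (0, g2) (by simp)
            simp only at e1 e2
            rw [e1, e2]
            simpa [pev] using hmem
      · simp at h

set_option maxRecDepth 1000000 in
theorem explore_true : explore 5 0 L0 = true := by decide +kernel

theorem candS_const : isConst candS = true := by decide +kernel

theorem classify {E : Submodule ℂ W} (hE : Cond E) : E ≤ sp 0 (candS.map (·.2)) := by
  obtain ⟨t, h⟩ := explore_sound hE 5 0 L0 2 ⟨by norm_num, by norm_num, by norm_num⟩ (by decide +kernel)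
    (fun e he => hE.T e he 2) (by simp) explore_true
  refine h.trans ?_
  rw [sp_le]
  intro r hr
  obtain ⟨e, he, rfl⟩ := List.mem_map.1 hr
  rw [isConst_sound candS_const t 0 e he]
  exact mem_sp (List.mem_map_of_mem he)
end BR

set_option linter.unusedSectionVars false
set_option linter.unusedSimpArgs false
namespace BR
open Module Filter Topology

section dims
variable {V V' : Type} [AddCommGroup V] [Module ℂ V] [AddCommGroup V'] [Module ℂ V']

theorem dimA [FiniteDimensional ℂ V] {S : Type} [Fintype S] (P : Submodule ℂ V) (f : V →ₗ[ℂ] V') (g : V →ₗ[ℂ] (S → ℂ))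
    (h : ∀ x ∈ P, f x = 0 → g x = 0 → x = 0) :
    finrank ℂ P ≤ finrank ℂ (P.map f) + Fintype.card S := by
  have h1 := LinearMap.finrank_range_add_finrank_ker (f.domRestrict P)
  have h2 : LinearMap.range (f.domRestrict P) = P.map f := by
    rw [LinearMap.domRestrict, LinearMap.range_comp, Submodule.range_subtype]
  rw [h2] at h1
  have h3 : finrank ℂ (LinearMap.ker (f.domRestrict P)) ≤ finrank ℂ (S → ℂ) := by
    refine LinearMap.finrank_le_finrank_of_injective
      (f := (g.domRestrict P).domRestrict (LinearMap.ker (f.domRestrict P))) ?_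
    rw [← LinearMap.ker_eq_bot, LinearMap.ker_eq_bot']
    rintro ⟨⟨x, hx⟩, hk⟩ h0
    have := h x hx hk h0
    subst this; rfl
  rw [finrank_fintype_fun_eq_card] at h3
  omega

variable {ι : Type} [Fintype ι]
/-- vectors supported on `m` -/
def vs (m : ι → Prop) : Submodule ℂ (ι → ℂ) where
  carrier := {x | ∀ i, ¬ m i → x i = 0}
  add_mem' ha hb i hi := by simp [ha i hi, hb i hi]
  zero_mem' i _ := rfl
  smul_mem' c x hx i hi := by simp [hx i hi]

def mk (m : ι → Prop) [DecidablePred m] : (ι → ℂ) →ₗ[ℂ] (ι → ℂ) where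
  toFun x := fun i => if m i then x i else 0
  map_add' x y := by ext i; by_cases h : m i <;> simp [h]
  map_smul' c x := by ext i; by_cases h : m i <;> simp [h]
theorem mk_apply (m : ι → Prop) [DecidablePred m] (x i) : mk m x i = if m i then x i else 0 := rfl

def rs (S : ι → Prop) : (ι → ℂ) →ₗ[ℂ] ({i // S i} → ℂ) := LinearMap.funLeft ℂ ℂ Subtype.val
theorem rs_zero {S : ι → Prop} {x : ι → ℂ} (h : rs S x = 0) (i) (hi : S i) : x i = 0 := congrFun h ⟨i, hi⟩

theorem finrank_vs (m : ι → Prop) [DecidablePred m] : Fintype.card {i // m i} ≤ finrank ℂ (vs m) := by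
  have := dimA (S := {i // ¬ m i}) ⊤ (mk m) (rs fun i => ¬ m i) (fun x _ h1 h2 => by
    funext i
    by_cases h : m i
    · have := congrFun h1 i
      simpa [mk_apply, h] using this
    · exact rs_zero h2 i h)
  have h3 : (Submodule.map (mk m) ⊤) ≤ vs m := by
    rintro _ ⟨x, -, rfl⟩ i hi
    simp [mk_apply, hi]
  have := Submodule.finrank_mono h3
  rw [finrank_top, finrank_fintype_fun_eq_card] at *
  have := Fintype.card_subtype_compl m
  have := Fintype.card_subtype_le m
  omega

/-- truncation -/
theorem mk_mem {m : ι → Prop} [DecidablePred m] {F : Submodule ℂ (ι → ℂ)} (hF : vs (fun i => ¬ m i) ≤ F)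
    {x} (hx : x ∈ F) : mk m x ∈ F := by
  have : mk m x = x - (x - mk m x) := by abel
  rw [this]
  refine F.sub_mem hx (hF ?_)
  intro i hi
  have hi : m i := not_not.1 hi
  simp [mk_apply, hi]

theorem finrank_trunc {m : ι → Prop} [DecidablePred m] {F : Submodule ℂ (ι → ℂ)} (hF : vs (fun i => ¬ m i) ≤ F) :
    finrank ℂ (F.map (mk m)) + Fintype.card {i // ¬ m i} = finrank ℂ F := by
  apply le_antisymm
  · have h1 : F.map (mk m) ⊔ vs (fun i => ¬ m i) ≤ F := by
      refine sup_le ?_ hF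
      rintro _ ⟨x, hx, rfl⟩
      exact mk_mem hF hx
    have h2 : F.map (mk m) ⊓ vs (fun i => ¬ m i) = ⊥ := by
      rw [eq_bot_iff]
      rintro _ ⟨⟨x, hx, rfl⟩, h2⟩
      rw [Submodule.mem_bot]
      funext i
      by_cases h : m i
      · exact h2 i (not_not.2 h)
      · simp [mk_apply, h]
    have := Submodule.finrank_sup_add_finrank_inf_eq (F.map (mk m)) (vs (fun i => ¬ m i))
    rw [h2, finrank_bot] at this
    have := Submodule.finrank_mono h1
    have := finrank_vs (fun i => ¬ m i)
    omega
  · exact dimA F (mk m) (rs fun i => ¬ m i) (fun x _ h1 h2 => by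
      funext i
      by_cases h : m i
      · have := congrFun h1 i
        simpa [mk_apply, h] using this
      · exact rs_zero h2 i h)
end dims

/-! ### encoding -/
def enc : V2 →ₗ[ℂ] W where
  toFun x := fun n => if h : n < 81 then x (⟨n / 9, by omega⟩, ⟨n % 9, by omega⟩) else 0
  map_add' x y := by ext n; by_cases h : n < 81 <;> simp [h]
  map_smul' c x := by ext n; by_cases h : n < 81 <;> simp [h]
theorem enc_lt (x : V2) (n : ℕ) (h : n < 81) : enc x n = x (⟨n / 9, by omega⟩, ⟨n % 9, by omega⟩) := dif_pos h
theorem enc_ge (x : V2) (n : ℕ) (h : ¬ n < 81) : enc x n = 0 := dif_neg h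
theorem enc_mk (x : V2) (a b : I) : enc x (9 * a.val + b.val) = x (a, b) := by
  rw [enc_lt _ _ (by omega)]
  congr 2 <;> ext <;> simp <;> omega
theorem enc_mk' (x : V2) (a b : ℕ) (ha : a < 9) (hb : b < 9) : enc x (9 * a + b) = x (⟨a, ha⟩, ⟨b, hb⟩) :=
  enc_mk x ⟨a, ha⟩ ⟨b, hb⟩
theorem enc_inj : Function.Injective enc := by
  intro x y h
  funext ⟨a, b⟩
  rw [← enc_mk x, h, enc_mk]

abbrev m2 (p : I × I) : Prop := 2 ≤ p.1.val
abbrev m3 (p : I × I × I) : Prop := 2 ≤ p.1.val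
def EE (F : Submodule ℂ V2) : Submodule ℂ W := (F.map (mk m2)).map enc

theorem card_m2 : Fintype.card {p : I × I // ¬ m2 p} = 18 := by decide +kernel
theorem card_m3 : Fintype.card {p : I × I × I // ¬ m3 p} = 162 := by decide +kernel
abbrev mP (p : I × I × I) : Prop := p.1.val < 2 ∧ p.1 ≤ p.2.1
abbrev mQ (p : I × I × I) : Prop := p.1.val < 2 ∧ p.2.1 ≤ p.2.2
theorem card_mP : Fintype.card {p : I × I × I // mP p} = 153 := by decide +kernel
theorem card_mQ : Fintype.card {p : I × I × I // mQ p} = 90 := by decide +kernel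
def JJ (R : Submodule ℂ V2) : (Fin 7 → R) →ₗ[ℂ] V3 where
  toFun z := fun p => if h : 2 ≤ p.1.val then (z ⟨p.1.val - 2, by omega⟩ : V2) p.2 else 0
  map_add' x y := by ext p; by_cases h : 2 ≤ p.1.val <;> simp [h]
  map_smul' c x := by ext p; by_cases h : 2 ≤ p.1.val <;> simp [h]

theorem sl_JJ (R : Submodule ℂ V2) (z) (a : I) (h : 2 ≤ a.val) : sl a (JJ R z) = z ⟨a.val - 2, by omega⟩ := by
  funext p
  exact dif_pos h

theorem slice_R {R : Submodule ℂ V2} {G : Submodule ℂ V3} (d : ℕ) (hR : finrank ℂ R = d) (hG : finrank ℂ G = 162 + 7 * d)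
    (hK : vs (fun p => ¬ m3 p) ≤ G) (hRG : ∀ r ∈ R, ∀ y, ten3 y r ∈ G) {h : V3} (hh : h ∈ G)
    (a : I) (ha : 2 ≤ a.val) : sl a h ∈ R := by
  have h1 := finrank_trunc (m := m3) hK
  rw [card_m3, hG] at h1
  have hinj : Function.Injective (JJ R) := by
    intro z z' hz
    funext i
    have e := sl_JJ R z ⟨i.val + 2, by omega⟩ (by simp)
    rw [hz, sl_JJ R z' _ (by simp)] at e
    exact Subtype.ext e.symm
  have h2 := LinearMap.finrank_range_of_inj hinj
  rw [finrank_pi_fintype] at h2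
  simp only [hR, Finset.sum_const, Finset.card_univ, Fintype.card_fin, smul_eq_mul] at h2
  have hle : LinearMap.range (JJ R) ≤ G.map (mk m3) := by
    rintro _ ⟨z, rfl⟩
    refine ⟨JJ R z, ?_, ?_⟩
    · have : JJ R z = ∑ i : Fin 7, ten3 (Pi.single ⟨i.val + 2, by omega⟩ 1) (z i) := by
        funext p
        rw [Finset.sum_apply]
        simp only [ten3_apply, Pi.single_apply]
        by_cases hp : 2 ≤ p.1.val
        · rw [Finset.sum_eq_single (⟨p.1.val - 2, by omega⟩ : Fin 7)]
          · rw [if_pos, one_mul]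
            · exact dif_pos hp
            · ext; simp; omega
          · intro b _ hb
            rw [if_neg, zero_mul]
            intro h; apply hb; ext; simp [h]
          · simp
        · rw [Finset.sum_eq_zero]
          · exact dif_neg hp
          · intro i _
            rw [if_neg, zero_mul]
            intro h; apply hp; rw [h]; simp
      rw [this]
      exact G.sum_mem fun i _ => hRG _ (z i).2 _
    · funext p
      rw [mk_apply]
      by_cases hp : m3 p
      · rw [if_pos hp]
      · have e : JJ R z p = 0 := dif_neg hp
        rw [if_neg hp, e]
  have heq := Submodule.eq_of_le_of_finrank_eq hle (by rw [h2]; exact (show finrank ℂ (G.map (mk m3)) = 7 * d by omega).symm)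
  have hm : mk m3 h ∈ LinearMap.range (JJ R) := by rw [heq]; exact ⟨h, hh, rfl⟩
  obtain ⟨z, hz⟩ := hm
  have : sl a h = sl a (mk m3 h) := by
    funext p; rw [sl_apply, sl_apply, mk_apply, if_pos (show m3 (a, p) from ha)]
  rw [this, ← hz, sl_JJ R z a ha]
  exact (z _).2

theorem vs_le {K : Submodule ℂ V1} {H : Submodule ℂ V3} (h0 : Pi.single 0 1 ∈ K) (h1 : Pi.single 1 1 ∈ K)
    (hKH : ∀ x ∈ K, ∀ r, ten3 x r ∈ H) : vs (fun p => ¬ m3 p) ≤ H := by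
  intro x hx
  have : x = ten3 (Pi.single 0 1) (sl 0 x) + ten3 (Pi.single 1 1) (sl 1 x) := by
    funext ⟨a, p⟩
    simp only [Pi.add_apply, ten3_apply, sl_apply, Pi.single_apply]
    by_cases ha : m3 (a, p)
    · rw [hx _ (not_not.2 ha), if_neg, if_neg]
      · simp
      · rintro rfl; exact absurd ha (by simp [m3])
      · rintro rfl; exact absurd ha (by simp [m3])
    · have : a = 0 ∨ a = 1 := by
        have : ¬ 2 ≤ a.val := ha
        rcases a with ⟨a, h⟩
        simp only at this
        interval_cases a
        · left; rfl
        · right; rfl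
      rcases this with rfl | rfl <;> simp
  rw [this]
  exact H.add_mem (hKH _ h0 _) (hKH _ h1 _)

end BR

set_option linter.unusedSectionVars false
set_option linter.unusedSimpArgs false
namespace BR
open Module Filter Topology

theorem nL_lt : ∀ n ∈ Finset.Ico 18 81, ∀ c ∈ nL n, c < 81 := by decide +kernel

theorem nv_count (n m : ℕ) : nv n m = (List.count m (nL n) : ℂ) := by
  unfold nv
  induction nL n with
  | nil => simp
  | cons c l ih =>
    rw [List.map_cons, List.sum_cons, Pi.add_apply, ih, List.count_cons, Pi.single_apply]
    by_cases h : m = c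
    · subst h; simp; ring
    · have : ¬ c = m := fun h' => h h'.symm
      simp [h, this]

def NZ (q p : I × I) : ℤ := ∑ s : Fin 4, (cz s p.1 * (if (tau s p.1, p.2) = q then 1 else 0)
  + cz s p.2 * (if (p.1, tau s p.2) = q then 1 else 0))

theorem NZ_eq : ∀ q p : I × I, 2 ≤ q.1.val → (List.count (9 * p.1.val + p.2.val) (nL (9 * q.1.val + q.2.val)) : ℤ) =
    if 2 ≤ p.1.val then NZ q p else 0 := by decide +kernel

theorem N2_sum (y : V2) (p : I × I) : (∑ s, N2 s y) p = ∑ q, y q * (NZ q p : ℂ) := by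
  obtain ⟨a, b⟩ := p
  simp only [NZ, Finset.sum_apply, N2_apply, Int.cast_sum, Finset.mul_sum]
  rw [Finset.sum_comm]
  refine Finset.sum_congr rfl fun s _ => ?_
  push_cast
  simp only [mul_add, Finset.sum_add_distrib, mul_ite, mul_one, mul_zero, Finset.sum_ite_eq,
    Finset.mem_univ, if_true, cc]
  ring

theorem sum_enc (y : V2) (hy : ∀ p, ¬ m2 p → y p = 0) (f : ℕ → ℂ) :
    ∑ n ∈ Finset.Ico 18 81, enc y n * f n = ∑ q : I × I, y q * f (9 * q.1.val + q.2.val) := by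
  have h1 : ∑ n ∈ Finset.Ico 18 81, enc y n * f n = ∑ n ∈ Finset.range 81, enc y n * f n := by
    refine Finset.sum_subset (fun n hn => by simp at hn ⊢; omega) (fun n hn hn' => ?_)
    simp at hn hn'
    rw [enc_lt y n hn, hy _ (by show ¬ 2 ≤ n / 9; omega), zero_mul]
  rw [h1, Finset.sum_range, ← (finProdFinEquiv (m := 9) (n := 9)).sum_comp]
  refine Finset.sum_congr rfl fun q _ => ?_
  have : (finProdFinEquiv q : Fin (9*9)).val = 9 * q.1.val + q.2.val := by
    simp [finProdFinEquiv]; ring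
  rw [this, enc_mk]

theorem NN_enc (y : V2) (hy : ∀ p, ¬ m2 p → y p = 0) : NN (enc y) = enc (mk m2 (∑ s, N2 s y)) := by
  funext m
  unfold NN
  rw [Finset.sum_apply]
  by_cases hm : m < 81
  · have := sum_enc y hy (fun n => nv n m)
    simp only [Pi.smul_apply, smul_eq_mul]
    rw [this, enc_lt _ _ hm, mk_apply, N2_sum]
    have e : m = 9 * (m / 9) + m % 9 := by omega
    have key : ∀ q : I × I, y q * nv (9 * q.1.val + q.2.val) m =
        if 2 ≤ m / 9 then y q * (NZ q (⟨m/9, by omega⟩, ⟨m % 9, by omega⟩) : ℂ) else 0 := by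
      intro q
      by_cases hq : m2 q
      · have h2 := NZ_eq q (⟨m/9, by omega⟩, ⟨m % 9, by omega⟩) hq
        simp only at h2
        rw [← e] at h2
        rw [nv_count]
        have h3 := congrArg (fun z : ℤ => (z : ℂ)) h2
        simp only [Int.cast_natCast] at h3
        rw [h3]
        split <;> simp
      · simp [hy q hq]
    rw [Finset.sum_congr rfl fun q _ => key q]
    by_cases h2 : 2 ≤ m / 9
    · simp [h2]
    · simp [h2]
  · rw [enc_ge _ _ hm]
    refine Finset.sum_eq_zero fun n hn => ?_
    rw [Pi.smul_apply, nv_count, List.count_eq_zero_of_not_mem]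
    · simp
    · intro h; exact hm (nL_lt n hn m h)

theorem rowv_filterMap (t : ℂ) (c : ℕ) (l : List ℕ) (hl : l.Nodup) (m : ℕ) :
    rowv t (l.filterMap fun n => if isz (TN (n/9) (n%9) c) then none else some (n, [TN (n/9) (n%9) c])) m
      = if m ∈ l then (TN (m/9) (m%9) c : ℂ) else 0 := by
  induction l with
  | nil => simp [rowv]
  | cons d l ih =>
    rw [List.nodup_cons] at hl
    rw [List.filterMap_cons]
    have ih := ih hl.2
    by_cases hz : isz (TN (d/9) (d%9) c) = true
    · simp only [hz, if_true] at ih ⊢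
      rw [ih]
      by_cases hm : m = d
      · subst hm
        rw [(isz_iff _).1 hz]
        simp
      · simp [hm]
    · simp only [hz] at ih ⊢
      simp only [Bool.false_eq_true, if_false, rowv, Pi.add_apply]
      rw [ih]
      by_cases hm : m = d
      · subst hm
        simp [hl.1, pev]
      · simp [hm, Pi.single_apply]

theorem codes_nd : codes.Nodup := by decide +kernel
theorem mem_codes (m : ℕ) : m ∈ codes ↔ 18 ≤ m ∧ m < 81 := by
  simp only [codes, List.mem_map, List.mem_range]
  constructor
  · rintro ⟨a, h, rfl⟩; omega
  · rintro h; exact ⟨m - 18, by omega, by omega⟩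

/-- the `c`-slice of `T0` -/
def Ts (c : I) : V2 := fun p => (TZ p.1 p.2 c : ℂ)

theorem L0_enc (t : ℂ) (e) (he : e ∈ L0) : ∃ c, rowv t e.2 = enc (mk m2 (Ts c)) := by
  unfold L0 at he
  obtain ⟨c, hc, rfl⟩ := List.mem_map.1 he
  rw [List.mem_range] at hc
  refine ⟨⟨c, hc⟩, ?_⟩
  funext m
  simp only
  rw [rowv_filterMap t c codes codes_nd]
  simp only [mem_codes]
  by_cases hm : m < 81
  · rw [enc_lt _ _ hm, mk_apply]
    have : (18 ≤ m ∧ m < 81) ↔ 2 ≤ m / 9 := by omega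
    simp only [this, Ts, m2]
    rfl
  · rw [enc_ge _ _ hm, if_neg (by omega)]

theorem w1_wn : ∀ a : I, w1 a = (wn a.val : ℤ) := by decide

theorem prw_enc (w : ℕ) (y : V2) : prw w (enc y) = enc (prj w2 w y) := by
  funext n
  by_cases hn : n < 81
  · rw [prw, enc_lt _ _ hn, enc_lt _ _ hn, prj_apply]
    have : wcode n = w ↔ w2 (⟨n/9, by omega⟩, ⟨n % 9, by omega⟩) = w := by
      simp only [w2, w1_wn, wcode]; norm_cast
    simp only [this]
  · rw [prw, enc_ge _ _ hn, enc_ge _ _ hn]; simp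

theorem prj_mk (w) (y : V2) : prj w2 w (mk m2 y) = mk m2 (prj w2 w y) := by
  funext p; simp only [prj_apply, mk_apply]; split <;> split <;> rfl

theorem mem_EE {F : Submodule ℂ V2} {y} (h : y ∈ F) : enc (mk m2 y) ∈ EE F := ⟨_, ⟨y, h, rfl⟩, rfl⟩

def zP (a : Fin 7) : V3 →ₗ[ℂ] W := enc.comp ((mk m2).comp (sl ⟨a.val + 2, by omega⟩))
def zQ (b : Fin 9) : V3 →ₗ[ℂ] W := enc.comp ((mk m2).comp ((sl b).comp s12))

theorem cond_EE {K F} (h : Half K F) (h0 : Pi.single 0 1 ∈ K) (h1 : Pi.single 1 1 ∈ K)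
    (hK : vs (fun p => ¬ m2 p) ≤ F) (hg : Graded w2 F)
    (hn : ∀ s, ∀ x ∈ F, N2 s x ∈ F) (hT : ∀ c, Ts c ∈ F) : Cond (EE F) where
  dim := by
    have h1 := finrank_trunc (m := m2) hK
    rw [card_m2, h.dimF] at h1
    have h2 := (Submodule.equivMapOfInjective enc enc_inj (F.map (mk m2))).finrank_eq
    have h3 : finrank ℂ (F.map (mk m2)) = 14 := by omega
    exact h2.symm.trans h3
  supp := by
    rintro _ ⟨_, ⟨y, hy, rfl⟩, rfl⟩ n hn
    have h81 : n < 81 := by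
      by_contra h; exact hn (enc_ge _ _ h)
    rw [enc_lt _ _ h81, mk_apply] at hn
    have : 2 ≤ n / 9 := by
      by_contra h; exact hn (if_neg h)
    omega
  gr := by
    rintro _ ⟨_, ⟨y, hy, rfl⟩, rfl⟩ w
    rw [prw_enc, prj_mk]
    exact mem_EE (hg y hy w)
  nn := by
    rintro _ ⟨_, ⟨y, hy, rfl⟩, rfl⟩
    rw [NN_enc _ (fun p hp => by simp only [mk_apply, if_neg hp])]
    exact mem_EE (F.sum_mem fun s _ => hn s _ (mk_mem hK hy))
  T := by
    intro e he t
    obtain ⟨c, hc⟩ := L0_enc t e he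
    rw [hc]
    exact mem_EE (hT c)
  z210 := by
    obtain ⟨P, M, hd, hM, hs, hPM, hKM, hFM⟩ := h.hP
    have hF : ∀ x ∈ P, ∀ a : I, 2 ≤ a.val → sl a x ∈ F := fun x hx a ha =>
      slice_R 32 h.dimF hM (vs_le h0 h1 hKM) hFM (hPM x hx) a ha
    refine ⟨P.map (LinearMap.pi zP), ?_, ?_⟩
    · have := dimA P (LinearMap.pi zP) (rs mP) (fun x hx h1 h2 => by
        have hsym : ∀ a b c, x (b, a, c) = x (a, b, c) := fun a b c => congrFun (hs x hx) (a, b, c)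
        have key : ∀ a b c : I, a ≤ b → x (a, b, c) = 0 := by
          intro a b c hab
          by_cases ha : a.val < 2
          · exact rs_zero h2 (a, b, c) ⟨ha, hab⟩
          · have h3 := congrFun (congrFun h1 ⟨a.val - 2, by omega⟩) (9 * b.val + c.val)
            simp only [LinearMap.pi_apply, zP, LinearMap.comp_apply, enc_mk, mk_apply, Pi.zero_apply, sl_apply] at h3
            have e : a.val - 2 + 2 = a.val := by omega
            simp only [e, Fin.eta] at h3
            rwa [if_pos] at h3
            show 2 ≤ b.val
            have : a.val ≤ b.val := hab
            omega
        funext ⟨a, b, c⟩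
        rcases le_total a b with h | h
        · exact key a b c h
        · rw [← hsym]; exact key b a c h)
      rw [hd, card_mP] at this
      omega
    · rintro _ ⟨x, hx, rfl⟩
      refine ⟨fun a => mem_EE (hF x hx _ (by simp)), ?_⟩
      have hsym : ∀ a b c, x (b, a, c) = x (a, b, c) := fun a b c => congrFun (hs x hx) (a, b, c)
      funext m
      rw [Finset.sum_apply]
      simp only [R210_apply, Pi.zero_apply]
      by_cases hij : m / 81 < m / 9 % 9
      · simp only [hij, if_true, Finset.sum_sub_distrib]
        have e1 : ∀ (i j k : ℕ) (hi : i < 9) (hj : j < 9) (hk : k < 9),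
            (∑ a : Fin 7, if i = a.val + 2 then (LinearMap.pi zP x) a (9 * j + k) else 0) =
            if 2 ≤ i ∧ 2 ≤ j then x (⟨i, hi⟩, ⟨j, hj⟩, ⟨k, hk⟩) else 0 := by
          intro i j k hi hj hk
          by_cases h2 : 2 ≤ i
          · rw [Finset.sum_eq_single (⟨i - 2, by omega⟩ : Fin 7)]
            · have e : i - 2 + 2 = i := by omega
              simp only [LinearMap.pi_apply, zP, LinearMap.comp_apply, enc_mk' _ _ _ hj hk, mk_apply, sl_apply, e, h2]
              simp [m2]
            · intro b _ hb
              rw [if_neg]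
              intro h; apply hb; ext; simp; omega
            · simp
          · rw [Finset.sum_eq_zero]
            · simp [h2]
            · intro a _; rw [if_neg]; omega
        rw [e1 _ _ _ (by omega) (by omega) (by omega), e1 _ _ _ (by omega) (by omega) (by omega), hsym]
        simp [and_comm]
      · simp [hij]
  z120 := by
    obtain ⟨P, hd, hs, hF⟩ := h.hQ
    refine ⟨P.map (LinearMap.pi zQ), ?_, ?_⟩
    · have := dimA P (LinearMap.pi zQ) (rs mQ) (fun x hx h1 h2 => by
        have hsym : ∀ a b c, x (a, c, b) = x (a, b, c) := fun a b c => congrFun (hs x hx) (a, b, c)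
        have key : ∀ a b c : I, b ≤ c → x (a, b, c) = 0 := by
          intro a b c hab
          by_cases ha : a.val < 2
          · exact rs_zero h2 (a, b, c) ⟨ha, hab⟩
          · have h3 := congrFun (congrFun h1 b) (9 * a.val + c.val)
            simp only [LinearMap.pi_apply, zQ, LinearMap.comp_apply, enc_mk, mk_apply, Pi.zero_apply, sl_apply] at h3
            rwa [if_pos] at h3
            show 2 ≤ a.val
            omega
        funext ⟨a, b, c⟩
        rcases le_total b c with h | h
        · exact key a b c h
        · rw [← hsym]; exact key a c b h)
      rw [hd, card_mQ] at this
      omega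
    · rintro _ ⟨x, hx, rfl⟩
      refine ⟨fun a => mem_EE (hF x hx _), ?_⟩
      have hsym : ∀ a b c, x (a, c, b) = x (a, b, c) := fun a b c => congrFun (hs x hx) (a, b, c)
      funext m
      rw [Finset.sum_apply]
      simp only [R120_apply, Pi.zero_apply]
      by_cases hij : m / 9 % 9 < m % 9
      · simp only [hij, if_true, Finset.sum_sub_distrib]
        by_cases hi : m / 81 < 9
        · have e1 : ∀ (i j k : ℕ) (hi : i < 9) (hj : j < 9) (hk : k < 9),
              (∑ a : Fin 9, if j = a.val then (LinearMap.pi zQ x) a (9 * i + k) else 0) =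
              if 2 ≤ i then x (⟨i, hi⟩, ⟨j, hj⟩, ⟨k, hk⟩) else 0 := by
            intro i j k hi hj hk
            rw [Finset.sum_eq_single (⟨j, by omega⟩ : Fin 9)]
            · simp only [LinearMap.pi_apply, zQ, LinearMap.comp_apply, enc_mk' _ _ _ hi hk, mk_apply, sl_apply, m2, if_true]
              rfl
            · intro b _ hb
              rw [if_neg]
              intro h; apply hb; ext; simp; omega
            · simp
          rw [e1 _ _ _ (by omega) (by omega) (by omega), e1 _ _ _ (by omega) (by omega) (by omega), hsym]
          simp
        · have e2 : ∀ (a : Fin 9) (k : ℕ), (LinearMap.pi zQ x) a (9 * (m / 81) + k) = 0 := by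
            intro a k
            simp only [LinearMap.pi_apply, zQ, LinearMap.comp_apply]
            exact enc_ge _ _ (by omega)
          simp [e2]
      · simp [hij]
end BR

set_option linter.unusedSectionVars false
set_option linter.unusedSimpArgs false
namespace BR
open Module Filter Topology

/-- for a code `n` in `[18, 81)`, the representative of its class and the sign (0 for vanishing) -/
def bsL : List (ℕ × ℤ) := 
  [(18, 1), (19, 1), (20, 1), (21, 1), (22, 1), (23, 0), (24, 1), (25, 1), (26, 0), (27, 1), (28, 1),
  (29, 1),  (30, 0), (31, 0), (32, 0), (33, 0), (34, 1), (35, 1), (28, -1), (37, 0), (22, 1), (39,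
  0), (40, 0), (41, 0), (34, -1), (43, 0), (44, 1), (29, -1), (22, -1), (47, 0), (48, 0), (49, 0),
  (50, 0), (35, -1), (44, -1), (53, 0), (54, 0), (55, 1), (24, 1), (57, 0), (34, -1), (35, -1), (60,
  0), (61, 0), (62, 0), (55, -1), (64, 0), (25, 1), (34, 1), (67, 0), (44, -1), (69, 0), (70, 0),
  (71, 0), (24, -1), (25, -1), (74, 0), (35, 1), (44, 1), (77, 0), (78, 0), (79, 0), (80, 0)]
def bs (n : ℕ) : ℕ := (bsL.getD (n - 18) (0, 0)).1
def sn (n : ℕ) : ℤ := (bsL.getD (n - 18) (0, 0)).2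

theorem pev_zero (p : Poly) : pev 0 p = (p.headD 0 : ℂ) := by
  cases p <;> simp [pev]

theorem cand_chk : ∀ r ∈ candS.map (·.2), ∀ n ∈ codes,
    (coef n r).headD 0 = sn n * (coef (bs n) r).headD 0 := by decide +kernel

theorem cand_eq {y : W} (hy : y ∈ sp 0 (candS.map (·.2))) (n : ℕ) (hn : n ∈ codes) :
    y n = sn n * y (bs n) := by
  have hle : sp 0 (candS.map (·.2)) ≤ LinearMap.ker
      ((LinearMap.proj n : W →ₗ[ℂ] ℂ) - (sn n : ℂ) • (LinearMap.proj (bs n) : W →ₗ[ℂ] ℂ)) := by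
    rw [sp_le]
    intro r hr
    have := cand_chk r hr n hn
    simp only [LinearMap.mem_ker, LinearMap.sub_apply, LinearMap.smul_apply, LinearMap.proj_apply, smul_eq_mul]
    rw [← coef_sound, ← coef_sound, pev_zero, pev_zero, this]
    push_cast; ring
  have := hle hy
  simp only [LinearMap.mem_ker, LinearMap.sub_apply, LinearMap.smul_apply, LinearMap.proj_apply, smul_eq_mul] at this
  linear_combination this

def z0 (a b c : ℕ) : Bool := Nat.beq a 2 || (Nat.beq a 3 && Nat.beq b 0 && Nat.ble c 2) ||
  isz (sn (9*a+b)) || isz (sn (9*a+c))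
def mates (n : ℕ) : List ℕ := codes.filter fun n' => Nat.beq (bs n') (bs n) && !(isz (sn n'))
def zstep (z : ℕ → ℕ → ℕ → Bool) (a b c : ℕ) : Bool := z a b c ||
  (mates (9*a+b)).any (fun n' => z (n'/9) (n'%9) c) || (mates (9*a+c)).any (fun n' => z (n'/9) b (n'%9))
theorem z_all : ((List.range 7).all fun a => (List.range 9).all fun b => (List.range 9).all fun c =>
  zstep (zstep z0) (a+2) b c) = true := by decide +kernel

structure Geq (G : ℕ → ℕ → ℕ → ℂ) : Prop where
  e1 : ∀ n ∈ codes, ∀ c < 9, G (n/9) (n%9) c = sn n * G (bs n / 9) (bs n % 9) c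
  e2 : ∀ n ∈ codes, ∀ b < 9, G (n/9) b (n%9) = sn n * G (bs n / 9) b (bs n % 9)

theorem code_mem (a b : ℕ) (ha : 2 ≤ a) (ha' : a < 9) (hb : b < 9) : 9*a+b ∈ codes := by
  rw [mem_codes]; omega
theorem code_div (a b : ℕ) (hb : b < 9) : (9*a+b)/9 = a := by omega
theorem code_mod (a b : ℕ) (hb : b < 9) : (9*a+b)%9 = b := by omega

theorem Geq.step {G} (hG : Geq G) (z : ℕ → ℕ → ℕ → Bool)
    (hz : ∀ a b c, 2 ≤ a → a < 9 → b < 9 → c < 9 → z a b c = true → G a b c = 0) :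
    ∀ a b c, 2 ≤ a → a < 9 → b < 9 → c < 9 → zstep z a b c = true → G a b c = 0 := by
  intro a b c ha ha' hb hc h
  simp only [zstep, Bool.or_eq_true, List.any_eq_true, mates, List.mem_filter, Bool.and_eq_true,
    Nat.beq_eq, Bool.not_eq_true', ← Bool.not_eq_true, isz_iff] at h
  rcases h with (h | ⟨n, ⟨hn, hb', hs⟩, h⟩) | ⟨n, ⟨hn, hb', hs⟩, h⟩
  · exact hz a b c ha ha' hb hc h
  · have hn2 := (mem_codes n).1 hn
    have h0 := hz _ _ _ (by omega) (by omega) (by omega) hc h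
    have h1 := hG.e1 n hn c hc
    have h2 := hG.e1 _ (code_mem a b ha ha' hb) c hc
    rw [code_div _ _ hb, code_mod _ _ hb, ← hb'] at h2
    rw [h0] at h1
    have h3 : (sn n : ℂ) ≠ 0 := by exact_mod_cast hs
    rw [h2, (mul_eq_zero.1 h1.symm).resolve_left h3, mul_zero]
  · have hn2 := (mem_codes n).1 hn
    have h0 := hz _ _ _ (by omega) (by omega) hb (by omega) h
    have h1 := hG.e2 n hn b hb
    have h2 := hG.e2 _ (code_mem a c ha ha' hc) b hb
    rw [code_div _ _ hc, code_mod _ _ hc, ← hb'] at h2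
    rw [h0] at h1
    have h3 : (sn n : ℂ) ≠ 0 := by exact_mod_cast hs
    rw [h2, (mul_eq_zero.1 h1.symm).resolve_left h3, mul_zero]

theorem Geq.zero {G} (hG : Geq G) (h2 : ∀ b < 9, ∀ c < 9, G 2 b c = 0) (h3 : ∀ c ≤ 2, G 3 0 c = 0) :
    ∀ a b c, 2 ≤ a → a < 9 → b < 9 → c < 9 → G a b c = 0 := by
  intro a b c ha ha' hb hc
  refine hG.step (zstep z0) (hG.step z0 ?_) a b c ha ha' hb hc ?_
  · intro a b c ha ha' hb hc h
    simp only [z0, Bool.or_eq_true, Bool.and_eq_true, Nat.beq_eq, Nat.ble_eq, isz_iff] at h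
    rcases h with ((rfl | ⟨⟨rfl, rfl⟩, h⟩) | h) | h
    · exact h2 b hb c hc
    · exact h3 c h
    · have := hG.e1 _ (code_mem a b ha ha' hb) c hc
      rwa [code_div _ _ hb, code_mod _ _ hb, h, Int.cast_zero, zero_mul] at this
    · have := hG.e2 _ (code_mem a c ha ha' hc) b hb
      rwa [code_div _ _ hc, code_mod _ _ hc, h, Int.cast_zero, zero_mul] at this
  · have := z_all
    simp only [List.all_eq_true, List.mem_range] at this
    have := this (a - 2) (by omega) b hb c hc
    rwa [show a - 2 + 2 = a by omega] at this

def gN (h : V3) (a b c : ℕ) : ℂ := if H : a < 9 ∧ b < 9 ∧ c < 9 then h (⟨a, H.1⟩, ⟨b, H.2.1⟩, ⟨c, H.2.2⟩) else 0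
theorem gN_lt (h : V3) (a b c : ℕ) (ha : a < 9) (hb : b < 9) (hc : c < 9) :
    gN h a b c = h (⟨a, ha⟩, ⟨b, hb⟩, ⟨c, hc⟩) := dif_pos ⟨ha, hb, hc⟩

theorem dimB {V V' : Type} [AddCommGroup V] [Module ℂ V] [AddCommGroup V'] [Module ℂ V'] [FiniteDimensional ℂ V]
    (R D : Submodule ℂ V) (f : V →ₗ[ℂ] V') (hD : D ≤ R) (hf : ∀ x ∈ D, f x = 0) (hs : R.map f = ⊤) :
    finrank ℂ D + finrank ℂ V' ≤ finrank ℂ R := by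
  have h1 := LinearMap.finrank_range_add_finrank_ker (f.domRestrict R)
  have h2 : LinearMap.range (f.domRestrict R) = R.map f := by
    rw [LinearMap.domRestrict, LinearMap.range_comp, Submodule.range_subtype]
  rw [h2, hs, finrank_top] at h1
  have h3 : finrank ℂ D ≤ finrank ℂ (LinearMap.ker (f.domRestrict R)) := by
    refine LinearMap.finrank_le_finrank_of_injective (f := (Submodule.inclusion hD).codRestrict _ ?_) ?_
    · intro x; exact hf x x.2
    · intro x y h
      have := congrArg Subtype.val h
      exact Submodule.inclusion_injective hD this
  omega

def psi : V2 →ₗ[ℂ] (Fin 4 → ℂ) := LinearMap.funLeft ℂ ℂ (![(1,8),(0,8),(1,5),(0,5)] : Fin 4 → I × I)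
theorem psi_apply (x : V2) (i) : psi x i = x ((![(1,8),(0,8),(1,5),(0,5)] : Fin 4 → I × I) i) := rfl

theorem TZ_psi : ∀ i j : Fin 4, TZ ((![3,4,6,7] : Fin 4 → I) i) ((![(1,8),(0,8),(1,5),(0,5)] : Fin 4 → I × I) j).1
    ((![(1,8),(0,8),(1,5),(0,5)] : Fin 4 → I × I) j).2 = if i = j then (![-1,1,1,-1] : Fin 4 → ℤ) i else 0 := by decide
theorem TZ_sym23 : ∀ a b c, TZ a b c = TZ a c b := by decide +kernel

theorem main0 {K F F'} (hf : Full K F F') (h0 : Pi.single 0 1 ∈ K) (h1 : Pi.single 1 1 ∈ K)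
    (gF : Graded w2 F) (gF' : Graded w2 F') (nF : ∀ s, ∀ x ∈ F, N2 s x ∈ F)
    (nF' : ∀ s, ∀ x ∈ F', N2 s x ∈ F') : False := by
  obtain ⟨-, hh1, hh2, R, H, G, dR, dH, dG, hT, hKH, hHF', hHF, hHG, hRG⟩ := hf
  have hKH3 : vs (fun p => ¬ m3 p) ≤ H := vs_le h0 h1 hKH
  have hKF : vs (fun p => ¬ m2 p) ≤ F := by
    intro x hx
    have := hHF (fun p => x (p.1, p.2.1)) (hKH3 fun p hp => hx _ hp) 0
    exact this
  have hKF' : vs (fun p => ¬ m2 p) ≤ F' := by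
    intro x hx
    have := hHF' (fun p => x (p.1, p.2.2)) (hKH3 fun p hp => hx _ hp) 0
    exact this
  have hTF : ∀ c, Ts c ∈ F := fun c => hHF T0 hT c
  have hTF' : ∀ c, Ts c ∈ F' := by
    intro c
    have e : sl c (s12 T0) = Ts c := by
      funext ⟨a, b⟩
      show (TZ a c b : ℂ) = TZ a b c
      rw [TZ_sym23]
    rw [← e]; exact hHF' T0 hT c
  have cF := classify (cond_EE hh1 h0 h1 hKF gF nF hTF)
  have cF' := classify (cond_EE hh2 h0 h1 hKF' gF' nF' hTF')
  have hGeq : ∀ h ∈ H, Geq (gN (mk m3 h)) := by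
    intro h hh
    have bsz : ∀ n ∈ codes, bs n / 9 < 9 ∧ 2 ≤ bs n / 9 := by decide +kernel
    constructor
    · intro n hn c hc
      have hn' := (mem_codes n).1 hn
      have := cand_eq (cF (mem_EE (hHF h hh ⟨c, hc⟩))) n hn
      have hb := bsz n hn
      rw [enc_lt _ _ (by omega), enc_lt _ _ (by omega)] at this
      rw [gN_lt _ _ _ _ (by omega) (by omega) hc, gN_lt _ _ _ _ (by omega) (by omega) hc]
      exact this
    · intro n hn c hc
      have hn' := (mem_codes n).1 hn
      have := cand_eq (cF' (mem_EE (hHF' h hh ⟨c, hc⟩))) n hn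
      have hb := bsz n hn
      rw [enc_lt _ _ (by omega), enc_lt _ _ (by omega)] at this
      rw [gN_lt _ _ _ _ (by omega) hc (by omega), gN_lt _ _ _ _ (by omega) hc (by omega)]
      exact this
  have d14 := finrank_trunc (m := m3) hKH3
  rw [card_m3, dH] at d14
  have hKG : vs (fun p => ¬ m3 p) ≤ G := hKH3.trans hHG
  have hD : finrank ℂ (H.map (mk m3)) ≤ finrank ℂ ((H.map (mk m3)).map (sl 2)) + 3 := by
    have := dimA (S := Fin 3) (H.map (mk m3)) (sl 2)
      (LinearMap.funLeft ℂ ℂ (![(3,0,0),(3,0,1),(3,0,2)] : Fin 3 → I × I × I)) (by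
      rintro _ ⟨h, hh, rfl⟩ z1 z2
      have hz := (hGeq h hh).zero (fun b hb c hc => by
        rw [gN_lt _ _ _ _ (by omega) hb hc]
        exact congrFun z1 (⟨b, hb⟩, ⟨c, hc⟩)) (fun c hc => by
        rw [gN_lt _ _ _ _ (by omega) (by omega) (by omega)]
        interval_cases c
        · exact congrFun z2 0
        · exact congrFun z2 1
        · exact congrFun z2 2)
      funext ⟨a, b, c⟩
      by_cases ha : m3 (a, b, c)
      · have := hz a.val b.val c.val ha a.2 b.2 c.2
        rwa [gN_lt _ _ _ _ a.2 b.2 c.2] at this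
      · rw [mk_apply, if_neg ha]; rfl)
    simpa using this
  have hB := dimB R ((H.map (mk m3)).map (sl 2)) psi (by
      rintro _ ⟨_, ⟨h, hh, rfl⟩, rfl⟩
      exact slice_R 14 dR dG hKG hRG (hHG _ (mk_mem hKH3 hh)) 2 (by decide)) (by
      rintro _ ⟨_, ⟨h, hh, rfl⟩, rfl⟩
      have e := (hGeq h hh).e2
      funext i
      rw [psi_apply, sl_apply]
      have e8 : ∀ b : I, mk m3 h (2, b, 8) = 0 := by
        intro b
        have := e 26 (by decide) b.val b.2
        rw [show sn 26 = 0 by decide, Int.cast_zero, zero_mul, gN_lt _ _ _ _ (by omega) b.2 (by omega)] at this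
        exact this
      have e5 : ∀ b : I, mk m3 h (2, b, 5) = 0 := by
        intro b
        have := e 23 (by decide) b.val b.2
        rw [show sn 23 = 0 by decide, Int.cast_zero, zero_mul, gN_lt _ _ _ _ (by omega) b.2 (by omega)] at this
        exact this
      fin_cases i
      · exact e8 1
      · exact e8 0
      · exact e5 1
      · exact e5 0) (by
      rw [eq_top_iff]
      intro v _
      refine ⟨∑ i, (v i * (![-1,1,1,-1] : Fin 4 → ℂ) i) • sl ((![3,4,6,7] : Fin 4 → I) i) T0, R.sum_mem fun i _ => R.smul_mem _ ?_, ?_⟩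
      · exact slice_R 14 dR dG hKG hRG (hHG _ hT) _ (by revert i; decide)
      · funext j
        rw [psi_apply, Finset.sum_apply]
        have : ∀ i, ((v i * (![-1,1,1,-1] : Fin 4 → ℂ) i) • sl ((![3,4,6,7] : Fin 4 → I) i) T0)
            ((![(1,8),(0,8),(1,5),(0,5)] : Fin 4 → I × I) j) = if i = j then v i else 0 := by
          intro i
          rw [Pi.smul_apply, smul_eq_mul, sl_apply, T0]
          simp only [TZ_psi]
          by_cases hij : i = j
          · simp only [hij, if_true]
            fin_cases j <;> simp
          · simp [hij]
        simp only [this]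
        simp)
  rw [dR] at hB
  simp at hB
  omega
end BR

set_option linter.unusedSectionVars false
set_option linter.unusedSimpArgs false
namespace BR
open Module Filter Topology

theorem w1_inj : ∀ a b, w1 a = w1 b → a = b := by decide

theorem single_mem {K : Submodule ℂ V1} (gK : Graded w1 K) {x} (hx : x ∈ K) (a : I) (ha : x a ≠ 0) :
    Pi.single a 1 ∈ K := by
  have h := gK x hx (w1 a)
  have e : prj w1 (w1 a) x = x a • Pi.single a 1 := by
    funext b
    rw [prj_apply]
    by_cases hb : b = a
    · subst hb; simp
    · have : w1 b ≠ w1 a := fun h => hb (w1_inj _ _ h)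
      simp [hb, this]
  rw [e] at h
  have := K.smul_mem (x a)⁻¹ h
  rwa [smul_smul, inv_mul_cancel₀ ha, one_smul] at this

theorem down {K : Submodule ℂ V1} (gK : Graded w1 K) (nK : ∀ s, ∀ x ∈ K, N1 s x ∈ K) (s : Fin 4) (b : I)
    (hs : cz s b = 1) (h : Pi.single (tau s b) 1 ∈ K) : Pi.single b 1 ∈ K := by
  refine single_mem gK (nK s _ h) b ?_
  rw [N1_apply, cc, hs]; simp

theorem K_cases {K : Submodule ℂ V1} (hd : finrank ℂ K = 2) (gK : Graded w1 K)
    (nK : ∀ s, ∀ x ∈ K, N1 s x ∈ K) :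
    Pi.single 0 1 ∈ K ∧ (Pi.single 1 1 ∈ K ∨ Pi.single 3 1 ∈ K) := by
  have hex : ∃ a : I, a ≠ 0 ∧ Pi.single a 1 ∈ K := by
    by_contra hno
    have hle := dimA (S := Fin 1) K (0 : V1 →ₗ[ℂ] V1) (LinearMap.funLeft ℂ ℂ (fun _ => 0)) (fun x hx _ h => by
      funext a
      by_cases ha : a = 0
      · subst ha; exact congrFun h 0
      · by_contra hxa
        exact hno ⟨a, ha, single_mem gK hx a hxa⟩)
    have : Submodule.map (0 : V1 →ₗ[ℂ] V1) K = ⊥ := Submodule.map_zero K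
    rw [this, hd, finrank_bot] at hle
    simp at hle
  have d0 : ∀ b : I, cz 0 b = 1 → Pi.single (tau 0 b) 1 ∈ K → Pi.single b 1 ∈ K := down gK nK 0
  have d1 : ∀ b : I, cz 1 b = 1 → Pi.single (tau 1 b) 1 ∈ K → Pi.single b 1 ∈ K := down gK nK 1
  have d2 : ∀ b : I, cz 2 b = 1 → Pi.single (tau 2 b) 1 ∈ K → Pi.single b 1 ∈ K := down gK nK 2
  have d3 : ∀ b : I, cz 3 b = 1 → Pi.single (tau 3 b) 1 ∈ K → Pi.single b 1 ∈ K := down gK nK 3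
  have s6 : Pi.single 6 1 ∈ K → Pi.single 3 1 ∈ K := d1 3 (by decide)
  have s7 : Pi.single 7 1 ∈ K → Pi.single 4 1 ∈ K := d1 4 (by decide)
  have s8 : Pi.single 8 1 ∈ K → Pi.single 5 1 ∈ K := d1 5 (by decide)
  have s5 : Pi.single 5 1 ∈ K → Pi.single 2 1 ∈ K := d0 2 (by decide)
  have s4 : Pi.single 4 1 ∈ K → Pi.single 1 1 ∈ K := d0 1 (by decide)
  have s3 : Pi.single 3 1 ∈ K → Pi.single 0 1 ∈ K := d0 0 (by decide)
  have s2 : Pi.single 2 1 ∈ K → Pi.single 1 1 ∈ K := d3 1 (by decide)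
  have s1 : Pi.single 1 1 ∈ K → Pi.single 0 1 ∈ K := d2 0 (by decide)
  obtain ⟨a, ha, h⟩ := hex
  fin_cases a
  · exact absurd rfl ha
  · exact ⟨s1 h, Or.inl h⟩
  · exact ⟨s1 (s2 h), Or.inl (s2 h)⟩
  · exact ⟨s3 h, Or.inr h⟩
  · exact ⟨s1 (s4 h), Or.inl (s4 h)⟩
  · exact ⟨s1 (s2 (s5 h)), Or.inl (s2 (s5 h))⟩
  · exact ⟨s3 (s6 h), Or.inr (s6 h)⟩
  · exact ⟨s1 (s4 (s7 h)), Or.inl (s4 (s7 h))⟩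
  · exact ⟨s1 (s2 (s5 (s8 h))), Or.inl (s2 (s5 (s8 h)))⟩

theorem w2_sg : ∀ p q : I × I, w2 (sg p.1, sg p.2) = w2 (sg q.1, sg q.2) ↔ w2 p = w2 q := by decide +kernel

theorem graded_q {F : Submodule ℂ V2} (h : Graded w2 F) : Graded w2 (mp F q2) := by
  rintro _ ⟨x, hx, rfl⟩ w
  by_cases hw : ∃ q : I × I, w2 q = w
  · obtain ⟨q, rfl⟩ := hw
    refine ⟨prj w2 (w2 (sg q.1, sg q.2)) x, h x hx _, ?_⟩
    funext p
    change q2 _ p = prj w2 (w2 q) (q2 x) p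
    rw [prj_apply]
    have e1 : q2 x p = x (sg p.1, sg p.2) := rfl
    have e2 : ∀ y, q2 y p = y (sg p.1, sg p.2) := fun y => rfl
    rw [e2, e2, prj_apply]
    simp only [w2_sg]
  · have : prj w2 w (q2 x) = 0 := by
      funext p
      rw [prj_apply, if_neg (fun h => hw ⟨p, h⟩)]; rfl
    change prj w2 w (q2 x) ∈ _
    rw [this]
    exact Submodule.zero_mem _

theorem cz_sg : ∀ (s : Fin 4) (a : I), cz (s + 2) (sg a) = cz s a := by decide
theorem tau_sg : ∀ (s : Fin 4) (a : I), cz s a ≠ 0 → tau (s + 2) (sg a) = sg (tau s a) := by decide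

theorem N2_q {F : Submodule ℂ V2} (h : ∀ s, ∀ x ∈ F, N2 s x ∈ F) : ∀ s, ∀ x ∈ mp F q2, N2 s x ∈ mp F q2 := by
  rintro s _ ⟨x, hx, rfl⟩
  refine ⟨N2 (s + 2) x, h _ x hx, ?_⟩
  funext ⟨a, b⟩
  change q2 _ (a, b) = N2 s (q2 x) (a, b)
  rw [q2_apply, N2_apply, N2_apply, q2_apply, q2_apply]
  have key : ∀ (a : I) (f : I → ℂ), cc (s + 2) (sg a) * f (tau (s + 2) (sg a)) = cc s a * f (sg (tau s a)) := by
    intro a f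
    by_cases hc : cz s a = 0
    · simp [cc, cz_sg, hc]
    · rw [tau_sg s a hc, cc, cc, cz_sg]
  rw [key a (fun t => x (t, sg b)), key b (fun t => x (sg a, t))]

theorem bor_false {K F F'} (h : Bor K F F') : False := by
  obtain ⟨k0, k1 | k3⟩ := K_cases h.full.dimK h.gK h.nK
  · exact main0 h.full k0 k1 h.gF h.gF' h.nF h.nF'
  · refine main0 (h.full.mp compat_q) ⟨_, k0, ?_⟩ ⟨_, k3, ?_⟩ (graded_q h.gF) (graded_q h.gF') (N2_q h.nF) (N2_q h.nF')
    · funext a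
      change (Pi.single 0 1 : V1) (sg a) = _
      simp only [Pi.single_apply]
      congr 1
      revert a; decide
    · funext a
      change (Pi.single 3 1 : V1) (sg a) = _
      simp only [Pi.single_apply]
      congr 1
      revert a; decide

theorem no_full : ¬ ∃ K F F', Full K F F' := by
  intro h
  obtain ⟨K, F, F', h1, h2, h3, h4, h5, h6, h7⟩ := borel h
  exact bor_false ⟨h1, h2, h3, h4, h5, h6, h7⟩
end BR

set_option linter.unusedSectionVars false
set_option linter.unusedSimpArgs false
namespace BR
open Module Filter Topology

abbrev Pts := Fin 16 → V1
def lo (i : Fin 2) : Fin 16 := ⟨i.val, by omega⟩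
def hi (t : Fin 14) : Fin 16 := ⟨t.val + 2, by omega⟩
def ab (j : Fin 7) : I := ⟨j.val + 2, by omega⟩
def ev {ι : Type} [DecidableEq ι] (j : ι) : ι → ℂ := Pi.single j 1
def uu (a : Pts) (j : I) : V1 := if h : j.val < 2 then a ⟨j.val, by omega⟩ else ev j

def fK (a : Pts) (i : Fin 2) : V1 := a (lo i)
def fF (a b : Pts) : (Fin 2 × I) ⊕ Fin 14 → V2 :=
  Sum.elim (fun q => ten2 (a (lo q.1)) (ev q.2)) (fun t => ten2 (a (hi t)) (b (hi t)))
def fR (b c : Pts) (t : Fin 14) : V2 := ten2 (b (hi t)) (c (hi t))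
def gM {κ : Type} (a : Pts) (r : κ → V2) : (Fin 2 × (I × I)) ⊕ (Fin 7 × κ) → V3 :=
  Sum.elim (fun q => ten3 (a (lo q.1)) (ev q.2)) (fun q => ten3 (ev (ab q.1)) (r q.2))
def fH (a b c : Pts) : (Fin 2 × (I × I)) ⊕ Fin 14 → V3 :=
  Sum.elim (fun q => ten3 (a (lo q.1)) (ev q.2)) (fun t => ten3 (a (hi t)) (ten2 (b (hi t)) (c (hi t))))
abbrev tQ := {q : I × I // q.1 ≤ q.2}
abbrev tP := {q : Fin 2 × I // q.1.val ≤ q.2.val}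
def fQ (a b : Pts) : (Fin 2 × tQ) ⊕ Fin 14 → V3 :=
  Sum.elim (fun q => ten3 (a (lo q.1)) (ev q.2.1) + s23 (ten3 (a (lo q.1)) (ev q.2.1)))
    (fun t => ten3 (a (hi t)) (ten2 (b (hi t)) (b (hi t))))
def fP (a b : Pts) : (tP × I) ⊕ Fin 14 → V3 :=
  Sum.elim (fun q => ten3 (a (lo q.1.1.1)) (ten2 (uu a q.1.1.2) (ev q.2))
      + s12 (ten3 (a (lo q.1.1.1)) (ten2 (uu a q.1.1.2) (ev q.2))))
    (fun t => ten3 (a (hi t)) (ten2 (a (hi t)) (b (hi t))))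

theorem ten2_ev (i j : I) : ten2 (ev i) (ev j) = ev (i, j) := by
  funext ⟨x, y⟩
  simp only [ten2, ev, Pi.single_apply, Prod.mk.injEq]
  by_cases h1 : x = i <;> by_cases h2 : y = j <;> simp [h1, h2]
theorem ten3_ev (i : I) (j : I × I) : ten3 (ev i) (ev j) = ev (i, j) := by
  funext ⟨x, y⟩
  simp only [ten3_apply, ev, Pi.single_apply, Prod.mk.injEq]
  by_cases h1 : x = i <;> by_cases h2 : y = j <;> simp [h1, h2]
theorem s12_ev (p : I × I × I) : s12 (ev p) = ev (sw12 p) := by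
  funext q
  simp only [s12_apply, ev, Pi.single_apply]
  have : sw12 q = p ↔ q = sw12 p := by
    constructor <;> rintro rfl <;> rfl
  simp [this]
theorem s23_ev (p : I × I × I) : s23 (ev p) = ev (sw23 p) := by
  funext q
  simp only [s23_apply, ev, Pi.single_apply]
  have : sw23 q = p ↔ q = sw23 p := by
    constructor <;> rintro rfl <;> rfl
  simp [this]

theorem li_key {κ ι : Type} [Fintype κ] [DecidableEq κ] (v : κ → ι → ℂ) (f : κ → ι)
    (h : ∀ k k', k ≠ k' → v k (f k') = 0) (h' : ∀ k, v k (f k) ≠ 0) : LinearIndependent ℂ v := by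
  rw [Fintype.linearIndependent_iff]
  intro g hg i
  have := congrFun hg (f i)
  simp only [Finset.sum_apply, Pi.smul_apply, smul_eq_mul, Pi.zero_apply] at this
  rw [Finset.sum_eq_single i (fun b _ hb => by rw [h b i hb, mul_zero]) (by simp)] at this
  exact (mul_eq_zero.1 this).resolve_right (h' i)

theorem li_ev {κ ι : Type} [DecidableEq ι] (f : κ → ι) (h : Function.Injective f) :
    LinearIndependent ℂ (fun k => ev (f k)) := by
  classical
  rw [linearIndependent_iff']
  intro s g hg i hi
  have := congrFun hg (f i)
  simp only [Finset.sum_apply, Pi.smul_apply, smul_eq_mul, Pi.zero_apply] at this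
  rw [Finset.sum_eq_single i (fun b _ hb => ?_) (by simp [hi])] at this
  · simpa [ev] using this
  · rw [ev, Pi.single_eq_of_ne (fun hh => hb (h hh.symm)), mul_zero]

theorem li_ev2 {κ ι : Type} [Fintype κ] [DecidableEq κ] [DecidableEq ι] (v : κ → ι → ℂ) (f f' : κ → ι) (c : κ → ℕ)
    (hv : ∀ k, v k = ev (f k) + (c k : ℂ) • ev (f' k)) (h : Function.Injective f)
    (h' : ∀ k k', f' k = f k' → k = k') :
    LinearIndependent ℂ v := by
  refine li_key v f (fun k k' hk => ?_) (fun k => ?_)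
  · rw [hv]
    simp only [Pi.add_apply, Pi.smul_apply, ev]
    rw [Pi.single_eq_of_ne (fun hh => hk (h hh.symm)), Pi.single_eq_of_ne (fun hh => hk (h' _ _ hh.symm))]
    simp
  · rw [hv]
    simp only [Pi.add_apply, Pi.smul_apply, ev, Pi.single_eq_same, Pi.single_apply]
    split
    · simp only [smul_eq_mul, mul_one]
      norm_cast
      omega
    · simp

/-! ### base point -/
def ka (i : Fin 16) : I := if i.val < 2 then ⟨i.val % 9, by omega⟩ else ⟨2 + (i.val - 2) % 7, by omega⟩
def kb (i : Fin 16) : I := ⟨((i.val - 2) / 7) % 9, by omega⟩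
def kc (i : Fin 16) : I := ⟨((i.val - 2) / 7 + (i.val - 2) % 7) % 9, by omega⟩
def a0 : Pts := fun i => ev (ka i)
def b0 : Pts := fun i => ev (kb i)
def c0 : Pts := fun i => ev (kc i)

theorem uu_a0 : ∀ j, uu a0 j = ev j := by
  intro j
  unfold uu
  split_ifs with h
  · unfold a0 ka
    congr 1
    ext
    simp [h]
  · rfl

theorem li_K : LinearIndependent ℂ (fK a0) := li_ev (fun i => ka (lo i)) (by decide)
theorem li_U : LinearIndependent ℂ (uu a0) := by
  have := li_ev (fun i : I => i) (fun _ _ h => h)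
  convert this using 2
  exact uu_a0 _

section
variable (kb : Fin 16 → I)
def qF : (Fin 2 × I) ⊕ Fin 14 → I × I :=
  Sum.elim (fun q => (ka (lo q.1), q.2)) (fun t => (ka (hi t), kb (hi t)))
def qQ : (Fin 2 × tQ) ⊕ Fin 14 → I × I × I :=
  Sum.elim (fun q => (ka (lo q.1), q.2.1)) (fun t => (ka (hi t), kb (hi t), kb (hi t)))
def qP : (tP × I) ⊕ Fin 14 → I × I × I :=
  Sum.elim (fun q => (ka (lo q.1.1.1), q.1.1.2, q.2)) (fun t => (ka (hi t), ka (hi t), kb (hi t)))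

theorem fF_base (k) : fF a0 (fun i => ev (kb i)) k = ev (qF kb k) := by
  rcases k with q | t
  · exact ten2_ev _ _
  · exact ten2_ev _ _
theorem fQ_base (k) : fQ a0 (fun i => ev (kb i)) k = ev (qQ kb k) +
    (((Sum.elim (fun _ => 1) (fun _ => 0) k : ℕ)) : ℂ) • ev (sw23 (qQ kb k)) := by
  rcases k with q | t
  · simp [fQ, qQ, a0, ten3_ev, s23_ev]
  · simp [fQ, qQ, a0, ten3_ev, ten2_ev]
theorem fP_base (k) : fP a0 (fun i => ev (kb i)) k = ev (qP kb k) +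
    (((Sum.elim (fun _ => 1) (fun _ => 0) k : ℕ)) : ℂ) • ev (sw12 (qP kb k)) := by
  rcases k with q | t
  · simp only [fP, qP, Sum.elim_inl, uu_a0, a0, ten2_ev, ten3_ev, s12_ev]
    simp
  · simp [fP, qP, a0, ten3_ev, ten2_ev]
end

theorem inj_F : Function.Injective (qF kb) := by decide +kernel
theorem inj_F' : Function.Injective (qF kc) := by decide +kernel
theorem inj_Q : Function.Injective (qQ kb) := by decide +kernel
theorem inj_Q' : Function.Injective (qQ kc) := by decide +kernel
theorem inj_P : Function.Injective (qP kb) := by decide +kernel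
theorem inj_P' : Function.Injective (qP kc) := by decide +kernel
theorem jQ : ∀ k k', sw23 (qQ kb k) = qQ kb k' → k = k' := by decide +kernel
theorem jQ' : ∀ k k', sw23 (qQ kc k) = qQ kc k' → k = k' := by decide +kernel
theorem jP : ∀ k k', sw12 (qP kb k) = qP kb k' → k = k' := by decide +kernel
theorem jP' : ∀ k k', sw12 (qP kc k) = qP kc k' → k = k' := by decide +kernel
theorem inj_R : Function.Injective (fun t => (kb (hi t), kc (hi t))) := by decide +kernel

theorem li_gM {κ : Type} (r : κ → V2) (q : κ → I × I) (hr : ∀ k, r k = ev (q k)) (hq : Function.Injective q) :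
    LinearIndependent ℂ (gM a0 r) := by
  have : gM a0 r = fun k => ev (Sum.elim (fun q => (ka (lo q.1), q.2)) (fun x => (ab x.1, q x.2)) k) := by
    funext k
    rcases k with k | k
    · exact ten3_ev _ _
    · simp only [gM, Sum.elim_inr, hr, ten3_ev]
  rw [this]
  refine li_ev _ ?_
  have h1 : ∀ i j, ka (lo i) = ka (lo j) → i = j := by decide
  have h2 : ∀ i j, ka (lo i) ≠ ab j := by decide
  have h3 : ∀ i j, ab i = ab j → i = j := by decide
  rintro (⟨i, p⟩ | ⟨i, p⟩) (⟨j, p'⟩ | ⟨j, p'⟩) h <;> simp only [Sum.elim_inl, Sum.elim_inr, Prod.mk.injEq] at h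
  · rw [h1 _ _ h.1, h.2]
  · exact absurd h.1 (h2 _ _)
  · exact absurd h.1.symm (h2 _ _)
  · rw [h3 _ _ h.1, hq h.2]

theorem li_H : LinearIndependent ℂ (fH a0 b0 c0) := by
  have h := li_gM (fR b0 c0) (fun t => (kb (hi t), kc (hi t))) (fun k => ten2_ev _ _) inj_R
  have h' := h.comp (Sum.map id (fun t : Fin 14 => ((⟨t.val % 7, by omega⟩, t) : Fin 7 × Fin 14)))
    (Function.Injective.sumMap Function.injective_id (fun t t' h => (Prod.mk.inj h).2))
  convert h' using 1
  funext k
  rcases k with k | k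
  · rfl
  · simp only [fH, gM, Function.comp, Sum.map_inr, Sum.elim_inr, fR, a0]
    congr 3
    revert k; decide

structure LI (a b c : Pts) : Prop where
  K : LinearIndependent ℂ (fK a)
  U : LinearIndependent ℂ (uu a)
  F : LinearIndependent ℂ (fF a b)
  F' : LinearIndependent ℂ (fF a c)
  P : LinearIndependent ℂ (fP a b)
  P' : LinearIndependent ℂ (fP a c)
  Q : LinearIndependent ℂ (fQ a b)
  Q' : LinearIndependent ℂ (fQ a c)
  M : LinearIndependent ℂ (gM a (fF a b))
  M' : LinearIndependent ℂ (gM a (fF a c))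
  R : LinearIndependent ℂ (fR b c)
  H : LinearIndependent ℂ (fH a b c)
  G : LinearIndependent ℂ (gM a (fR b c))

theorem LI_base : LI a0 b0 c0 where
  K := li_K
  U := li_U
  F := by rw [show fF a0 b0 = fun k => ev (qF kb k) from funext (fF_base kb)]; exact li_ev _ inj_F
  F' := by rw [show fF a0 c0 = fun k => ev (qF kc k) from funext (fF_base kc)]; exact li_ev _ inj_F'
  P := li_ev2 _ _ _ _ (fP_base kb) inj_P jP
  P' := li_ev2 _ _ _ _ (fP_base kc) inj_P' jP'
  Q := li_ev2 _ _ _ _ (fQ_base kb) inj_Q jQ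
  Q' := li_ev2 _ _ _ _ (fQ_base kc) inj_Q' jQ'
  M := li_gM _ _ (fF_base kb) inj_F
  M' := li_gM _ _ (fF_base kc) inj_F'
  R := li_ev (fun t => (kb (hi t), kc (hi t))) inj_R |> fun h => by
    convert h using 2
    exact ten2_ev _ _
  H := li_H
  G := li_gM _ (fun t => (kb (hi t), kc (hi t))) (fun k => ten2_ev _ _) inj_R

/-! ### curve -/
def cv (a a' : Pts) (s : ℂ) : Pts := fun i x => (1 - s) * a i x + s * a' i x
theorem cv_d (a a' : Pts) (i x) : Differentiable ℂ fun s => cv a a' s i x := by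
  unfold cv; fun_prop
theorem cv_one (a a' : Pts) : cv a a' 1 = a' := by funext i x; simp [cv]
theorem cv_zero (a a' : Pts) : cv a a' 0 = a := by funext i x; simp [cv]
theorem uu_d (a a' : Pts) (i x) : Differentiable ℂ fun s => uu (cv a a' s) i x := by
  unfold uu
  split_ifs
  · exact cv_d _ _ _ _
  · fun_prop

theorem ev_LI (a b c : Pts) : ∀ᶠ s in 𝓝[≠] (0:ℂ), LI (cv a a0 s) (cv b b0 s) (cv c c0 s) := by
  have B := LI_base
  have da := cv_d a a0
  have db := cv_d b b0
  have dc := cv_d c c0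
  have du := uu_d a a0
  have dF : ∀ (b b' : Pts) k p, Differentiable ℂ fun s => fF (cv a a0 s) (cv b b' s) k p := by
    intro b b' k p
    have := cv_d b b'
    rcases k with k | k
    · exact (da _ _).mul (differentiable_const _)
    · exact (da _ _).mul (this _ _)
  have dR : ∀ k p, Differentiable ℂ fun s => fR (cv b b0 s) (cv c c0 s) k p := fun k p => (db _ _).mul (dc _ _)
  have dM : ∀ {κ : Type} (r : ℂ → κ → V2) (hr : ∀ k p, Differentiable ℂ fun s => r s k p) (k p),
      Differentiable ℂ fun s => gM (cv a a0 s) (r s) k p := by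
    intro κ r hr k p
    rcases k with k | k
    · exact (da _ _).mul (differentiable_const _)
    · exact (differentiable_const _).mul (hr _ _)
  have dQ : ∀ (b b' : Pts) k p, Differentiable ℂ fun s => fQ (cv a a0 s) (cv b b' s) k p := by
    intro b b' k p
    have := cv_d b b'
    rcases k with k | k
    · exact ((da _ _).mul (differentiable_const _)).add ((da _ _).mul (differentiable_const _))
    · exact (da _ _).mul ((this _ _).mul (this _ _))
  have dP : ∀ (b b' : Pts) k p, Differentiable ℂ fun s => fP (cv a a0 s) (cv b b' s) k p := by
    intro b b' k p
    have := cv_d b b'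
    rcases k with k | k
    · exact ((da _ _).mul ((du _ _).mul (differentiable_const _))).add ((da _ _).mul ((du _ _).mul (differentiable_const _)))
    · exact (da _ _).mul ((da _ _).mul (this _ _))
  have dH : ∀ k p, Differentiable ℂ fun s => fH (cv a a0 s) (cv b b0 s) (cv c c0 s) k p := by
    intro k p
    rcases k with k | k
    · exact (da _ _).mul (differentiable_const _)
    · exact (da _ _).mul ((db _ _).mul (dc _ _))
  filter_upwards [
    eventually_li (fun k s => fK (cv a a0 s) k) (fun k i => da _ _) (by simpa only [cv_one] using B.K),
    eventually_li (fun k s => uu (cv a a0 s) k) (fun k i => du _ _) (by simpa only [cv_one] using B.U),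
    eventually_li (fun k s => fF (cv a a0 s) (cv b b0 s) k) (dF b b0) (by simpa only [cv_one] using B.F),
    eventually_li (fun k s => fF (cv a a0 s) (cv c c0 s) k) (dF c c0) (by simpa only [cv_one] using B.F'),
    eventually_li (fun k s => fP (cv a a0 s) (cv b b0 s) k) (dP b b0) (by simpa only [cv_one] using B.P),
    eventually_li (fun k s => fP (cv a a0 s) (cv c c0 s) k) (dP c c0) (by simpa only [cv_one] using B.P'),
    eventually_li (fun k s => fQ (cv a a0 s) (cv b b0 s) k) (dQ b b0) (by simpa only [cv_one] using B.Q),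
    eventually_li (fun k s => fQ (cv a a0 s) (cv c c0 s) k) (dQ c c0) (by simpa only [cv_one] using B.Q'),
    eventually_li (fun k s => gM (cv a a0 s) (fF (cv a a0 s) (cv b b0 s)) k)
      (dM (fun s => fF (cv a a0 s) (cv b b0 s)) (dF b b0)) (by simpa only [cv_one] using B.M),
    eventually_li (fun k s => gM (cv a a0 s) (fF (cv a a0 s) (cv c c0 s)) k)
      (dM (fun s => fF (cv a a0 s) (cv c c0 s)) (dF c c0)) (by simpa only [cv_one] using B.M'),
    eventually_li (fun k s => fR (cv b b0 s) (cv c c0 s) k) dR (by simpa only [cv_one] using B.R),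
    eventually_li (fun k s => fH (cv a a0 s) (cv b b0 s) (cv c c0 s) k) dH (by simpa only [cv_one] using B.H),
    eventually_li (fun k s => gM (cv a a0 s) (fR (cv b b0 s) (cv c c0 s)) k)
      (dM (fun s => fR (cv b b0 s) (cv c c0 s)) dR) (by simpa only [cv_one] using B.G)]
    with s h1 h2 h3 h4 h5 h6 h7 h8 h9 h10 h11 h12 h13
  exact ⟨h1, h2, h3, h4, h5, h6, h7, h8, h9, h10, h11, h12, h13⟩
end BR

set_option linter.unusedSectionVars false
set_option linter.unusedSimpArgs false
namespace BR
open Module Filter Topology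

abbrev spn {κ V : Type} [AddCommGroup V] [Module ℂ V] (f : κ → V) : Submodule ℂ V := Submodule.span ℂ (Set.range f)
theorem spn_mem {κ V : Type} [AddCommGroup V] [Module ℂ V] (f : κ → V) (k) : f k ∈ spn f :=
  Submodule.subset_span ⟨k, rfl⟩
theorem fr_spn {κ V : Type} [AddCommGroup V] [Module ℂ V] [Fintype κ] {f : κ → V} (h : LinearIndependent ℂ f) (n : ℕ)
    (hn : Fintype.card κ = n) : finrank ℂ (spn f) = n := by
  rw [finrank_span_eq_card h, hn]
/-- a linear map sends the span of generators into `Y` -/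
theorem spn_map {κ V W : Type} [AddCommGroup V] [Module ℂ V] [AddCommGroup W] [Module ℂ W] (f : κ → V)
    (g : V →ₗ[ℂ] W) (Y : Submodule ℂ W) (h : ∀ k, g (f k) ∈ Y) : ∀ x ∈ spn f, g x ∈ Y := by
  intro x hx
  have : spn f ≤ Y.comap g := by
    rw [Submodule.span_le]
    rintro _ ⟨k, rfl⟩
    exact h k
  exact this hx

def t2 : V1 →ₗ[ℂ] V1 →ₗ[ℂ] V2 :=
  LinearMap.mk₂ ℂ ten2
    (fun x y r => by ext p; simp [ten2, add_mul]) (fun c x r => by ext p; simp [ten2, mul_assoc])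
    (fun x y r => by ext p; simp [ten2, mul_add]) (fun c x r => by ext p; simp [ten2]; ring)
theorem t2_apply (x y) : t2 x y = ten2 x y := rfl

theorem spn_ev {ι : Type} [Fintype ι] [DecidableEq ι] (x : ι → ℂ) : x ∈ spn (fun j : ι => ev j) := by
  have : x = ∑ q, x q • ev q := by
    ext p
    simp [ev, Finset.sum_apply, Pi.single_apply]
  rw [this]
  exact Submodule.sum_mem _ fun q _ => Submodule.smul_mem _ _ (spn_mem _ q)

theorem ten2_lo (a b : Pts) (i : Fin 2) (y : V1) : ten2 (a (lo i)) y ∈ spn (fF a b) :=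
  spn_map (fun j : I => ev j) (t2 (a (lo i))) _ (fun k => spn_mem (fF a b) (Sum.inl (i, k))) y (spn_ev y)

theorem gM_lo {κ : Type} (a : Pts) (r : κ → V2) (i : Fin 2) (y : V2) : ten3 (a (lo i)) y ∈ spn (gM a r) :=
  spn_map (fun j : I × I => ev j) (ten3 (a (lo i))) _ (fun k => spn_mem (gM a r) (Sum.inl (i, k))) y (spn_ev y)
theorem fH_lo (a b c : Pts) (i : Fin 2) (y : V2) : ten3 (a (lo i)) y ∈ spn (fH a b c) :=
  spn_map (fun j : I × I => ev j) (ten3 (a (lo i))) _ (fun k => spn_mem (fH a b c) (Sum.inl (i, k))) y (spn_ev y)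

theorem gM_K {κ : Type} (a : Pts) (r : κ → V2) : ∀ x ∈ spn (fK a), ∀ y, ten3 x y ∈ spn (gM a r) :=
  fun x hx y => spn_map (fK a) (ten3.flip y) _ (fun i => gM_lo a r i y) x hx

theorem gM_R {κ : Type} (a : Pts) (hU : LinearIndependent ℂ (uu a)) (r : κ → V2) :
    ∀ x ∈ spn r, ∀ y, ten3 y x ∈ spn (gM a r) := by
  have ht : spn (uu a) = ⊤ := hU.span_eq_top_of_card_eq_finrank (by simp)
  intro x hx y
  refine spn_map (uu a) (ten3.flip x) _ (fun j => ?_) y (by rw [ht]; trivial)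
  by_cases hj : j.val < 2
  · have : uu a j = a (lo ⟨j.val, hj⟩) := dif_pos hj
    rw [this]
    exact gM_lo a r _ x
  · have : uu a j = ev (ab ⟨j.val - 2, by omega⟩) := by
      rw [uu, dif_neg hj]
      congr 1
      ext; simp [ab]; omega
    rw [this]
    exact spn_map r (ten3 _) _ (fun k => spn_mem (gM a r) (Sum.inr (_, k))) x hx

theorem slb (x : V1) (r : V2) (b : I) : sl b (s12 (ten3 x r)) = ten2 x (fun c => r (b, c)) := rfl
theorem slc (x : V1) (r : V2) (c : I) : sl c (s12 (s23 (ten3 x r))) = ten2 x (fun b => r (b, c)) := rfl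

theorem ten2_hi (a b : Pts) (t : Fin 14) (m : ℂ) (y : V1) (hy : y = m • b (hi t)) :
    ten2 (a (hi t)) y ∈ spn (fF a b) := by
  rw [hy, ← t2_apply, map_smul]
  exact Submodule.smul_mem _ _ (spn_mem (fF a b) (Sum.inr t))

theorem s12_s12 (h : V3) : s12 (s12 h) = h := rfl
theorem s23_s23 (h : V3) : s23 (s23 h) = h := rfl

theorem half_of (a b : Pts) (U : LinearIndependent ℂ (uu a)) (F : LinearIndependent ℂ (fF a b))
    (P : LinearIndependent ℂ (fP a b)) (Q : LinearIndependent ℂ (fQ a b))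
    (M : LinearIndependent ℂ (gM a (fF a b))) : Half (spn (fK a)) (spn (fF a b)) where
  dimF := fr_spn F _ (by decide)
  hP := by
    refine ⟨spn (fP a b), spn (gM a (fF a b)), fr_spn P _ (by decide +kernel), fr_spn M _ (by simp), ?_, ?_,
      gM_K a _, gM_R a U _⟩
    · intro h hh
      have := spn_map (fP a b) (s12 - LinearMap.id) ⊥ (fun k => by
        rw [Submodule.mem_bot]
        rcases k with k | k
        · simp only [fP, Sum.elim_inl, LinearMap.sub_apply, map_add, s12_s12, LinearMap.id_apply]
          abel
        · simp only [fP, Sum.elim_inr, LinearMap.sub_apply, LinearMap.id_apply]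
          funext p
          simp only [Pi.sub_apply, s12_apply, ten3_apply, ten2, sw12, Pi.zero_apply]
          ring) h hh
      rw [Submodule.mem_bot] at this
      exact sub_eq_zero.1 this
    · refine spn_map (fP a b) LinearMap.id _ fun k => ?_
      rcases k with k | k
      · refine Submodule.add_mem _ (gM_lo _ _ _ _) ?_
        have : s12 (ten3 (a (lo k.1.1.1)) (ten2 (uu a k.1.1.2) (ev k.2))) =
            ten3 (uu a k.1.1.2) (ten2 (a (lo k.1.1.1)) (ev k.2)) := by
          funext p
          simp only [s12_apply, ten3_apply, ten2, sw12]
          ring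
        rw [this]
        exact gM_R a U _ _ (ten2_lo _ _ _ _) _
      · exact gM_R a U _ _ (spn_mem (fF a b) (Sum.inr k)) _
  hQ := by
    refine ⟨spn (fQ a b), fr_spn Q _ (by decide +kernel), ?_, ?_⟩
    · intro h hh
      have := spn_map (fQ a b) (s23 - LinearMap.id) ⊥ (fun k => by
        rw [Submodule.mem_bot]
        rcases k with k | k
        · simp only [fQ, Sum.elim_inl, LinearMap.sub_apply, map_add, s23_s23, LinearMap.id_apply]
          abel
        · simp only [fQ, Sum.elim_inr, LinearMap.sub_apply, LinearMap.id_apply]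
          funext p
          simp only [Pi.sub_apply, s23_apply, ten3_apply, ten2, sw23, Pi.zero_apply]
          ring) h hh
      rw [Submodule.mem_bot] at this
      exact sub_eq_zero.1 this
    · intro h hh β
      refine spn_map (fQ a b) ((sl β).comp s12) _ (fun k => ?_) h hh
      rcases k with k | k
      · simp only [fQ, Sum.elim_inl, LinearMap.comp_apply, map_add]
        exact Submodule.add_mem _ (ten2_lo a b k.1 (fun c => ev k.2.1 (β, c))) (ten2_lo a b k.1 (fun c => ev k.2.1 (c, β)))
      · exact ten2_hi a b k (b (hi k) β) _ rfl

/-- the tensor of a point configuration -/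
def TT (a b c : Pts) : V3 := ∑ i, ten3 (a i) (ten2 (b i) (c i))

theorem pre_of (a b c : Pts) (h : LI a b c) : ∃ K F F', Pre (TT a b c) K F F' := by
  refine ⟨spn (fK a), spn (fF a b), spn (fF a c), fr_spn h.K _ (by simp), half_of a b h.U h.F h.P h.Q h.M,
    half_of a c h.U h.F' h.P' h.Q' h.M', spn (fR b c), spn (fH a b c), spn (gM a (fR b c)),
    fr_spn h.R _ (by simp), fr_spn h.H _ (by simp), fr_spn h.G _ (by simp), ?_, ?_, ?_, ?_, ?_, gM_R a h.U _⟩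
  · refine Submodule.sum_mem _ fun i _ => ?_
    by_cases hi2 : i.val < 2
    · exact fH_lo a b c ⟨i.val, hi2⟩ _
    · have := spn_mem (fH a b c) (Sum.inr ⟨i.val - 2, by omega⟩)
      have e : hi ⟨i.val - 2, by omega⟩ = i := by ext; simp [hi]; omega
      simpa only [fH, Sum.elim_inr, e] using this
  · exact fun x hx y => spn_map (fK a) (ten3.flip y) _ (fun i => fH_lo a b c i y) x hx
  · intro x hx β
    refine spn_map (fH a b c) ((sl β).comp s12) _ (fun k => ?_) x hx
    rcases k with k | k
    · exact ten2_lo a c k.1 (fun c => ev k.2 (β, c))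
    · exact ten2_hi a c k (b (hi k) β) _ rfl
  · intro x hx β
    refine spn_map (fH a b c) ((sl β).comp (s12.comp s23)) _ (fun k => ?_) x hx
    rcases k with k | k
    · exact ten2_lo a b k.1 (fun c => ev k.2 (c, β))
    · refine ten2_hi a b k (c (hi k) β) (fun x => ten2 (b (hi k)) (c (hi k)) (x, β)) ?_
      funext x
      exact mul_comm _ _
  · refine spn_map (fH a b c) LinearMap.id _ (fun k => ?_)
    rcases k with k | k
    · exact gM_lo _ _ _ _
    · exact gM_R a h.U _ _ (spn_mem (fR b c) k) _

theorem T0_not : T0 ∉ closure {t : V3 | ∃ a b c, t = TT a b c} := by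
  intro h
  have hsub : {t : V3 | ∃ a b c, t = TT a b c} ⊆ closure {t : V3 | ∃ K F F', Pre t K F F'} := by
    rintro _ ⟨a, b, c, rfl⟩
    have hc : Continuous fun s : ℂ => TT (cv a a0 s) (cv b b0 s) (cv c c0 s) := by
      refine continuous_pi fun p => ?_
      simp only [TT, Finset.sum_apply, ten3_apply, ten2]
      refine continuous_finsetSum _ fun i _ => ?_
      exact (cv_d a a0 _ _).continuous.mul ((cv_d b b0 _ _).continuous.mul (cv_d c c0 _ _).continuous)
    have h1 : Tendsto (fun s : ℂ => TT (cv a a0 s) (cv b b0 s) (cv c c0 s)) (𝓝[≠] 0) (𝓝 (TT a b c)) := by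
      have := hc.tendsto 0
      simp only [cv_zero] at this
      exact this.mono_left nhdsWithin_le_nhds
    refine mem_closure_of_tendsto h1 ?_
    filter_upwards [ev_LI a b c] with s hs
    exact pre_of _ _ _ hs
  have h' := closure_minimal hsub isClosed_closure h
  obtain ⟨x, hx, hl⟩ := mem_closure_iff_seq_limit.1 h'
  exact no_full (Full.lim (hl.mono_left Nat.hyperfilter_le_atTop) hx)
end BR

set_option linter.unusedSectionVars false
set_option linter.unusedSimpArgs false
namespace BR
open Module Filter Topology

/-! ### upper bound -/
def r2 : ℂ := ((Real.sqrt 2 : ℝ) : ℂ)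
def r3 : ℂ := ((Real.sqrt 3 : ℝ) : ℂ)
theorem r2_sq : r2 ^ 2 = 2 := by
  unfold r2; norm_cast; simp
theorem r3_sq : r3 ^ 2 = 3 := by
  unfold r3; norm_cast; simp

/-- orbit weights -/
def oc : Fin 6 → ℂ := ![5 / 4 * r2, 5 / 2 * Complex.I, 1, 5 / 6, 5 / 24, -5 / 48]
/-- coordinates of orbit representatives -/
def ov : Fin 6 → I → ℂ := ![
  ![r2, Complex.I * r2 * r3 / 3, 1, 0, Complex.I * r3 / 3, 0, Complex.I * r2 * r3 / 5, -r2 / 5, -Complex.I * r3 / 5],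
  ![Complex.I, -r3 / 3, 1, 0, Complex.I * r3 / 3, 0, r3 / 5, Complex.I / 5, Complex.I * r3 / 5],
  ![0, 2 * r3 / 3, 1, 1, 0, 0, 0, 1, -r3 / 2],
  ![1, 1, 0, 0, 0, 1, 1, -3 / 5, 0],
  ![-2, 2 * Complex.I, 0, 0, 0, 1, -2 * Complex.I / 5, 6 / 5, 0],
  ![4, 0, 0, 0, 0, 1, 0, 0, 0]]
def orb : Fin 17 → Fin 6 := ![0, 0, 0, 0, 1, 1, 1, 1, 2, 2, 2, 2, 3, 3, 4, 4, 5]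
def osz : Fin 6 → ℕ := ![4, 4, 4, 2, 2, 1]
/-- sign class of a coordinate -/
def cls : I → Fin 4 := ![0, 1, 2, 2, 3, 0, 1, 0, 3]
/-- whether a class may be nonzero on an orbit -/
def spp (o : Fin 6) (i : I) : ℤ := if o.val < 3 then 1 else if o.val < 5 then (if (cls i).val < 2 then 1 else 0)
  else if (cls i).val = 0 then 1 else 0
def sgc : Fin 4 → Fin 4 → ℤ := ![![1, 1, 1, 1], ![1, -1, 1, -1], ![1, 1, -1, -1], ![1, -1, -1, 1]]
def sgs (s : Fin 17) (i : I) : ℤ := sgc (cls i) ⟨s.val % 4, by omega⟩ * spp (orb s) i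
def triv (i j k : I) : Bool := Nat.xor (Nat.xor (cls i).val (cls j).val) (cls k).val == 0

theorem sgs_sum : ∀ i j k : I, ∀ o : Fin 6, (∑ s, if orb s = o then sgs s i * sgs s j * sgs s k else 0) =
    if triv i j k then osz o * (spp o i * spp o j * spp o k) else 0 := by decide +kernel

def MM (i j k : I) : ℂ := ∑ o, oc o * (ov o i * ov o j * ov o k)
def SS (i j k : I) : ℂ := ∑ s, oc (orb s) / osz (orb s) * (sgs s i * ov (orb s) i) * (sgs s j * ov (orb s) j) *
  (sgs s k * ov (orb s) k)

theorem spp_ov (o i) : (spp o i : ℂ) * ov o i = ov o i := by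
  fin_cases o <;> fin_cases i <;> simp [spp, cls, ov]

theorem osz_ne (o) : (osz o : ℂ) ≠ 0 := by
  fin_cases o <;> simp [osz]

theorem SS_eq (i j k : I) : SS i j k = if triv i j k then MM i j k else 0 := by
  have h1 : SS i j k = ∑ o, (oc o / osz o * (ov o i * ov o j * ov o k)) *
      ((∑ s, if orb s = o then sgs s i * sgs s j * sgs s k else 0 : ℤ) : ℂ) := by
    simp only [Int.cast_sum, Finset.mul_sum]
    rw [Finset.sum_comm]
    refine Finset.sum_congr rfl fun s _ => ?_
    rw [Finset.sum_eq_single (orb s)]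
    · simp only [if_true]
      push_cast
      ring
    · intro b _ hb
      rw [if_neg (fun h => hb h.symm)]
      simp
    · simp
  rw [h1]
  simp only [sgs_sum]
  by_cases ht : triv i j k = true
  · simp only [ht, if_true, MM]
    refine Finset.sum_congr rfl fun o _ => ?_
    have := osz_ne o
    push_cast
    rw [← spp_ov o i, ← spp_ov o j, ← spp_ov o k]
    have e : ∀ i, (spp o i : ℂ) * spp o i = spp o i := by
      intro i
      unfold spp
      split_ifs <;> simp
    have e1 := e i
    have e2 := e j
    have e3 := e k
    field_simp
    linear_combination (norm := ring_nf) (oc o * ov o i * ov o j * ov o k * spp o j * spp o j * spp o k * spp o k) * e1 +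
      (oc o * ov o i * ov o j * ov o k * spp o i * spp o k * spp o k) * e2 +
      (oc o * ov o i * ov o j * ov o k * spp o i * spp o j) * e3
  · simp [ht]

section
theorem MM_ex (i j k : I) : MM i j k = 5 / 4 * r2 * (ov 0 i * ov 0 j * ov 0 k) +
    5 / 2 * Complex.I * (ov 1 i * ov 1 j * ov 1 k) + (ov 2 i * ov 2 j * ov 2 k) + 5 / 6 * (ov 3 i * ov 3 j * ov 3 k)
    + 5 / 24 * (ov 4 i * ov 4 j * ov 4 k) + (-5 / 48) * (ov 5 i * ov 5 j * ov 5 k) := by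
  unfold MM
  simp only [Fin.sum_univ_six, oc]
  simp
theorem ov00 : ov 0 0 = r2 := rfl
theorem ov01 : ov 0 1 = Complex.I * r2 * r3 / 3 := rfl
theorem ov02 : ov 0 2 = 1 := rfl
theorem ov03 : ov 0 3 = 0 := rfl
theorem ov04 : ov 0 4 = Complex.I * r3 / 3 := rfl
theorem ov05 : ov 0 5 = 0 := rfl
theorem ov06 : ov 0 6 = Complex.I * r2 * r3 / 5 := rfl
theorem ov07 : ov 0 7 = -r2 / 5 := rfl
theorem ov08 : ov 0 8 = -Complex.I * r3 / 5 := rfl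
theorem ov10 : ov 1 0 = Complex.I := rfl
theorem ov11 : ov 1 1 = -r3 / 3 := rfl
theorem ov12 : ov 1 2 = 1 := rfl
theorem ov13 : ov 1 3 = 0 := rfl
theorem ov14 : ov 1 4 = Complex.I * r3 / 3 := rfl
theorem ov15 : ov 1 5 = 0 := rfl
theorem ov16 : ov 1 6 = r3 / 5 := rfl
theorem ov17 : ov 1 7 = Complex.I / 5 := rfl
theorem ov18 : ov 1 8 = Complex.I * r3 / 5 := rfl
theorem ov20 : ov 2 0 = 0 := rfl
theorem ov21 : ov 2 1 = 2 * r3 / 3 := rfl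
theorem ov22 : ov 2 2 = 1 := rfl
theorem ov23 : ov 2 3 = 1 := rfl
theorem ov24 : ov 2 4 = 0 := rfl
theorem ov25 : ov 2 5 = 0 := rfl
theorem ov26 : ov 2 6 = 0 := rfl
theorem ov27 : ov 2 7 = 1 := rfl
theorem ov28 : ov 2 8 = -r3 / 2 := rfl
theorem ov30 : ov 3 0 = 1 := rfl
theorem ov31 : ov 3 1 = 1 := rfl
theorem ov32 : ov 3 2 = 0 := rfl
theorem ov33 : ov 3 3 = 0 := rfl
theorem ov34 : ov 3 4 = 0 := rfl
theorem ov35 : ov 3 5 = 1 := rfl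
theorem ov36 : ov 3 6 = 1 := rfl
theorem ov37 : ov 3 7 = -3 / 5 := rfl
theorem ov38 : ov 3 8 = 0 := rfl
theorem ov40 : ov 4 0 = -2 := rfl
theorem ov41 : ov 4 1 = 2 * Complex.I := rfl
theorem ov42 : ov 4 2 = 0 := rfl
theorem ov43 : ov 4 3 = 0 := rfl
theorem ov44 : ov 4 4 = 0 := rfl
theorem ov45 : ov 4 5 = 1 := rfl
theorem ov46 : ov 4 6 = -2 * Complex.I / 5 := rfl
theorem ov47 : ov 4 7 = 6 / 5 := rfl
theorem ov48 : ov 4 8 = 0 := rfl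
theorem ov50 : ov 5 0 = 4 := rfl
theorem ov51 : ov 5 1 = 0 := rfl
theorem ov52 : ov 5 2 = 0 := rfl
theorem ov53 : ov 5 3 = 0 := rfl
theorem ov54 : ov 5 4 = 0 := rfl
theorem ov55 : ov 5 5 = 1 := rfl
theorem ov56 : ov 5 6 = 0 := rfl
theorem ov57 : ov 5 7 = 0 := rfl
theorem ov58 : ov 5 8 = 0 := rfl
theorem M000 : MM 0 0 0 = 0 := by
  have h2 := r2_sq
  have h3 := r3_sq
  have hI := Complex.I_sq
  rw [MM_ex]
  simp only [ov00, ov10, ov20, ov30, ov40, ov50]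
  generalize r2 = x at *
  generalize r3 = y at *
  generalize Complex.I = z at *
  grind
theorem M005 : MM 0 0 5 = 0 := by
  have h2 := r2_sq
  have h3 := r3_sq
  have hI := Complex.I_sq
  rw [MM_ex]
  simp only [ov00, ov10, ov20, ov30, ov40, ov50, ov05, ov15, ov25, ov35, ov45, ov55]
  generalize r2 = x at *
  generalize r3 = y at *
  generalize Complex.I = z at *
  grind
theorem M007 : MM 0 0 7 = 0 := by
  have h2 := r2_sq
  have h3 := r3_sq
  have hI := Complex.I_sq
  rw [MM_ex]
  simp only [ov00, ov10, ov20, ov30, ov40, ov50, ov07, ov17, ov27, ov37, ov47, ov57]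
  generalize r2 = x at *
  generalize r3 = y at *
  generalize Complex.I = z at *
  grind
theorem M011 : MM 0 1 1 = 0 := by
  have h2 := r2_sq
  have h3 := r3_sq
  have hI := Complex.I_sq
  rw [MM_ex]
  simp only [ov00, ov10, ov20, ov30, ov40, ov50, ov01, ov11, ov21, ov31, ov41, ov51]
  generalize r2 = x at *
  generalize r3 = y at *
  generalize Complex.I = z at *
  grind
theorem M016 : MM 0 1 6 = 0 := by
  have h2 := r2_sq
  have h3 := r3_sq
  have hI := Complex.I_sq
  rw [MM_ex]
  simp only [ov00, ov10, ov20, ov30, ov40, ov50, ov01, ov11, ov21, ov31, ov41, ov51, ov06, ov16, ov26, ov36, ov46, ov56]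
  generalize r2 = x at *
  generalize r3 = y at *
  generalize Complex.I = z at *
  grind
theorem M022 : MM 0 2 2 = 0 := by
  have h2 := r2_sq
  have h3 := r3_sq
  have hI := Complex.I_sq
  rw [MM_ex]
  simp only [ov00, ov10, ov20, ov30, ov40, ov50, ov02, ov12, ov22, ov32, ov42, ov52]
  generalize r2 = x at *
  generalize r3 = y at *
  generalize Complex.I = z at *
  grind
theorem M023 : MM 0 2 3 = 0 := by
  have h2 := r2_sq
  have h3 := r3_sq
  have hI := Complex.I_sq
  rw [MM_ex]
  simp only [ov00, ov10, ov20, ov30, ov40, ov50, ov02, ov12, ov22, ov32, ov42, ov52, ov03, ov13, ov23, ov33, ov43, ov53]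
  generalize r2 = x at *
  generalize r3 = y at *
  generalize Complex.I = z at *
  grind
theorem M033 : MM 0 3 3 = 0 := by
  have h2 := r2_sq
  have h3 := r3_sq
  have hI := Complex.I_sq
  rw [MM_ex]
  simp only [ov00, ov10, ov20, ov30, ov40, ov50, ov03, ov13, ov23, ov33, ov43, ov53]
  generalize r2 = x at *
  generalize r3 = y at *
  generalize Complex.I = z at *
  grind
theorem M044 : MM 0 4 4 = 0 := by
  have h2 := r2_sq
  have h3 := r3_sq
  have hI := Complex.I_sq
  rw [MM_ex]
  simp only [ov00, ov10, ov20, ov30, ov40, ov50, ov04, ov14, ov24, ov34, ov44, ov54]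
  generalize r2 = x at *
  generalize r3 = y at *
  generalize Complex.I = z at *
  grind
theorem M048 : MM 0 4 8 = 1 := by
  have h2 := r2_sq
  have h3 := r3_sq
  have hI := Complex.I_sq
  rw [MM_ex]
  simp only [ov00, ov10, ov20, ov30, ov40, ov50, ov04, ov14, ov24, ov34, ov44, ov54, ov08, ov18, ov28, ov38, ov48, ov58]
  generalize r2 = x at *
  generalize r3 = y at *
  generalize Complex.I = z at *
  grind
theorem M055 : MM 0 5 5 = 0 := by
  have h2 := r2_sq
  have h3 := r3_sq
  have hI := Complex.I_sq
  rw [MM_ex]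
  simp only [ov00, ov10, ov20, ov30, ov40, ov50, ov05, ov15, ov25, ov35, ov45, ov55]
  generalize r2 = x at *
  generalize r3 = y at *
  generalize Complex.I = z at *
  grind
theorem M057 : MM 0 5 7 = -1 := by
  have h2 := r2_sq
  have h3 := r3_sq
  have hI := Complex.I_sq
  rw [MM_ex]
  simp only [ov00, ov10, ov20, ov30, ov40, ov50, ov05, ov15, ov25, ov35, ov45, ov55, ov07, ov17, ov27, ov37, ov47, ov57]
  generalize r2 = x at *
  generalize r3 = y at *
  generalize Complex.I = z at *
  grind
theorem M066 : MM 0 6 6 = 0 := by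
  have h2 := r2_sq
  have h3 := r3_sq
  have hI := Complex.I_sq
  rw [MM_ex]
  simp only [ov00, ov10, ov20, ov30, ov40, ov50, ov06, ov16, ov26, ov36, ov46, ov56]
  generalize r2 = x at *
  generalize r3 = y at *
  generalize Complex.I = z at *
  grind
theorem M077 : MM 0 7 7 = 0 := by
  have h2 := r2_sq
  have h3 := r3_sq
  have hI := Complex.I_sq
  rw [MM_ex]
  simp only [ov00, ov10, ov20, ov30, ov40, ov50, ov07, ov17, ov27, ov37, ov47, ov57]
  generalize r2 = x at *
  generalize r3 = y at *
  generalize Complex.I = z at *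
  grind
theorem M088 : MM 0 8 8 = 0 := by
  have h2 := r2_sq
  have h3 := r3_sq
  have hI := Complex.I_sq
  rw [MM_ex]
  simp only [ov00, ov10, ov20, ov30, ov40, ov50, ov08, ov18, ov28, ov38, ov48, ov58]
  generalize r2 = x at *
  generalize r3 = y at *
  generalize Complex.I = z at *
  grind
theorem M115 : MM 1 1 5 = 0 := by
  have h2 := r2_sq
  have h3 := r3_sq
  have hI := Complex.I_sq
  rw [MM_ex]
  simp only [ov01, ov11, ov21, ov31, ov41, ov51, ov05, ov15, ov25, ov35, ov45, ov55]
  generalize r2 = x at *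
  generalize r3 = y at *
  generalize Complex.I = z at *
  grind
theorem M117 : MM 1 1 7 = 0 := by
  have h2 := r2_sq
  have h3 := r3_sq
  have hI := Complex.I_sq
  rw [MM_ex]
  simp only [ov01, ov11, ov21, ov31, ov41, ov51, ov07, ov17, ov27, ov37, ov47, ov57]
  generalize r2 = x at *
  generalize r3 = y at *
  generalize Complex.I = z at *
  grind
theorem M124 : MM 1 2 4 = 0 := by
  have h2 := r2_sq
  have h3 := r3_sq
  have hI := Complex.I_sq
  rw [MM_ex]
  simp only [ov01, ov11, ov21, ov31, ov41, ov51, ov02, ov12, ov22, ov32, ov42, ov52, ov04, ov14, ov24, ov34, ov44, ov54]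
  generalize r2 = x at *
  generalize r3 = y at *
  generalize Complex.I = z at *
  grind
theorem M128 : MM 1 2 8 = 0 := by
  have h2 := r2_sq
  have h3 := r3_sq
  have hI := Complex.I_sq
  rw [MM_ex]
  simp only [ov01, ov11, ov21, ov31, ov41, ov51, ov02, ov12, ov22, ov32, ov42, ov52, ov08, ov18, ov28, ov38, ov48, ov58]
  generalize r2 = x at *
  generalize r3 = y at *
  generalize Complex.I = z at *
  grind
theorem M134 : MM 1 3 4 = 0 := by
  have h2 := r2_sq
  have h3 := r3_sq
  have hI := Complex.I_sq
  rw [MM_ex]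
  simp only [ov01, ov11, ov21, ov31, ov41, ov51, ov03, ov13, ov23, ov33, ov43, ov53, ov04, ov14, ov24, ov34, ov44, ov54]
  generalize r2 = x at *
  generalize r3 = y at *
  generalize Complex.I = z at *
  grind
theorem M138 : MM 1 3 8 = -1 := by
  have h2 := r2_sq
  have h3 := r3_sq
  have hI := Complex.I_sq
  rw [MM_ex]
  simp only [ov01, ov11, ov21, ov31, ov41, ov51, ov03, ov13, ov23, ov33, ov43, ov53, ov08, ov18, ov28, ov38, ov48, ov58]
  generalize r2 = x at *
  generalize r3 = y at *
  generalize Complex.I = z at *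
  grind
theorem M156 : MM 1 5 6 = 1 := by
  have h2 := r2_sq
  have h3 := r3_sq
  have hI := Complex.I_sq
  rw [MM_ex]
  simp only [ov01, ov11, ov21, ov31, ov41, ov51, ov05, ov15, ov25, ov35, ov45, ov55, ov06, ov16, ov26, ov36, ov46, ov56]
  generalize r2 = x at *
  generalize r3 = y at *
  generalize Complex.I = z at *
  grind
theorem M167 : MM 1 6 7 = 0 := by
  have h2 := r2_sq
  have h3 := r3_sq
  have hI := Complex.I_sq
  rw [MM_ex]
  simp only [ov01, ov11, ov21, ov31, ov41, ov51, ov06, ov16, ov26, ov36, ov46, ov56, ov07, ov17, ov27, ov37, ov47, ov57]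
  generalize r2 = x at *
  generalize r3 = y at *
  generalize Complex.I = z at *
  grind
theorem M225 : MM 2 2 5 = 0 := by
  have h2 := r2_sq
  have h3 := r3_sq
  have hI := Complex.I_sq
  rw [MM_ex]
  simp only [ov02, ov12, ov22, ov32, ov42, ov52, ov05, ov15, ov25, ov35, ov45, ov55]
  generalize r2 = x at *
  generalize r3 = y at *
  generalize Complex.I = z at *
  grind
theorem M227 : MM 2 2 7 = 0 := by
  have h2 := r2_sq
  have h3 := r3_sq
  have hI := Complex.I_sq
  rw [MM_ex]
  simp only [ov02, ov12, ov22, ov32, ov42, ov52, ov07, ov17, ov27, ov37, ov47, ov57]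
  generalize r2 = x at *
  generalize r3 = y at *
  generalize Complex.I = z at *
  grind
theorem M235 : MM 2 3 5 = 0 := by
  have h2 := r2_sq
  have h3 := r3_sq
  have hI := Complex.I_sq
  rw [MM_ex]
  simp only [ov02, ov12, ov22, ov32, ov42, ov52, ov03, ov13, ov23, ov33, ov43, ov53, ov05, ov15, ov25, ov35, ov45, ov55]
  generalize r2 = x at *
  generalize r3 = y at *
  generalize Complex.I = z at *
  grind
theorem M237 : MM 2 3 7 = 1 := by
  have h2 := r2_sq
  have h3 := r3_sq
  have hI := Complex.I_sq
  rw [MM_ex]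
  simp only [ov02, ov12, ov22, ov32, ov42, ov52, ov03, ov13, ov23, ov33, ov43, ov53, ov07, ov17, ov27, ov37, ov47, ov57]
  generalize r2 = x at *
  generalize r3 = y at *
  generalize Complex.I = z at *
  grind
theorem M246 : MM 2 4 6 = -1 := by
  have h2 := r2_sq
  have h3 := r3_sq
  have hI := Complex.I_sq
  rw [MM_ex]
  simp only [ov02, ov12, ov22, ov32, ov42, ov52, ov04, ov14, ov24, ov34, ov44, ov54, ov06, ov16, ov26, ov36, ov46, ov56]
  generalize r2 = x at *
  generalize r3 = y at *
  generalize Complex.I = z at *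
  grind
theorem M268 : MM 2 6 8 = 0 := by
  have h2 := r2_sq
  have h3 := r3_sq
  have hI := Complex.I_sq
  rw [MM_ex]
  simp only [ov02, ov12, ov22, ov32, ov42, ov52, ov06, ov16, ov26, ov36, ov46, ov56, ov08, ov18, ov28, ov38, ov48, ov58]
  generalize r2 = x at *
  generalize r3 = y at *
  generalize Complex.I = z at *
  grind
end
end BR

set_option linter.unusedSectionVars false
set_option linter.unusedSimpArgs false
namespace BR
open Module Filter Topology

/-! ### generalities on border rank -/
theorem rankLE_mono {ι₁ ι₂ ι₃ : Type} {T : ι₁ → ι₂ → ι₃ → ℂ} {r r' : ℕ} (h : r ≤ r') (hT : rankLE T r) :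
    rankLE T r' := by
  obtain ⟨u, v, w, rfl⟩ := hT
  obtain ⟨d, rfl⟩ := Nat.exists_eq_add_of_le h
  refine ⟨Fin.append u 0, Fin.append v 0, Fin.append w 0, ?_⟩
  funext i j k
  rw [Fin.sum_univ_add]
  simp

theorem brank_eq {ι₁ ι₂ ι₃ : Type} [Fintype ι₁] [Fintype ι₂] [Fintype ι₃] {T : ι₁ → ι₂ → ι₃ → ℂ} {r : ℕ}
    (h1 : T ∈ closure {S : ι₁ → ι₂ → ι₃ → ℂ | rankLE S (r + 1)})
    (h2 : T ∉ closure {S : ι₁ → ι₂ → ι₃ → ℂ | rankLE S r}) : brank T = r + 1 := by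
  unfold brank
  apply le_antisymm
  · exact Nat.sInf_le h1
  · refine le_csInf ⟨_, h1⟩ fun r' hr' => ?_
    by_contra hlt
    refine h2 (closure_mono ?_ hr')
    intro S hS
    exact rankLE_mono (by omega) hS

def reidx {ι₁ ι₂ ι₃ κ₁ κ₂ κ₃ : Type} (f : κ₁ → ι₁) (g : κ₂ → ι₂) (h : κ₃ → ι₃) (σ : κ₂ → ℂ) (τ : κ₃ → ℂ)
    (T : ι₁ → ι₂ → ι₃ → ℂ) : κ₁ → κ₂ → κ₃ → ℂ := fun i j k => σ j * τ k * T (f i) (g j) (h k)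

theorem closure_reidx {ι₁ ι₂ ι₃ κ₁ κ₂ κ₃ : Type} (f : κ₁ → ι₁) (g : κ₂ → ι₂) (h : κ₃ → ι₃) (σ : κ₂ → ℂ) (τ : κ₃ → ℂ)
    {T : ι₁ → ι₂ → ι₃ → ℂ} {r : ℕ} (hT : T ∈ closure {S : ι₁ → ι₂ → ι₃ → ℂ | rankLE S r}) :
    reidx f g h σ τ T ∈ closure {S : κ₁ → κ₂ → κ₃ → ℂ | rankLE S r} := by
  refine map_mem_closure (f := reidx f g h σ τ) ?_ hT ?_
  · unfold reidx
    fun_prop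
  · rintro S ⟨u, v, w, rfl⟩
    refine ⟨fun l i => u l (f i), fun l j => σ j * v l (g j), fun l k => τ k * w l (h k), ?_⟩
    funext i j k
    simp only [reidx, Finset.mul_sum]
    exact Finset.sum_congr rfl fun l _ => by ring

/-! ### the two tensors -/
def E3 (a b c : Fin 3) : ℂ := (epsZ a.val b.val c.val : ℂ)
def T9 (a b c : I) : ℂ := (TZ a b c : ℂ)

def sgA : Fin 3 → ℤ := ![-1, 1, 1]
def sgB : Fin 3 → ℤ := ![1, 1, -1]
def pm : Fin 3 → Fin 3 := ![0, 2, 1]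
def skZ (i j k : Fin 3) : ℤ := if (i = 0 ∧ j = 1 ∧ k = 1) ∨ (i = 0 ∧ j = 2 ∧ k = 2) ∨ (i = 1 ∧ j = 0 ∧ k = 1) ∨
       (i = 2 ∧ j = 0 ∧ k = 2) ∨ (i = 1 ∧ j = 2 ∧ k = 0)
    then 1
    else if i = 2 ∧ j = 1 ∧ k = 0 then -1 else 0
theorem skZ_eq (i j k) : skewCW2 i j k = (skZ i j k : ℂ) := by
  unfold skewCW2 skZ
  split_ifs <;> simp
theorem sk1 : ∀ i j k, skZ i j k = sgA j * sgB k * epsZ i.val j.val (pm k).val := by decide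
theorem sk2 : ∀ i j k : Fin 3, epsZ i.val j.val k.val = sgA j * sgB (pm k) * skZ i j (pm k) := by decide

theorem skew_E3 : skewCW2 = reidx id id pm (fun j => (sgA j : ℂ)) (fun k => (sgB k : ℂ)) E3 := by
  funext i j k
  rw [skZ_eq, sk1]
  simp [reidx, E3]
theorem E3_skew : E3 = reidx id id pm (fun j => (sgA j : ℂ)) (fun k => (sgB (pm k) : ℂ)) skewCW2 := by
  funext i j k
  simp only [reidx, skZ_eq, E3, id]
  rw [sk2]
  push_cast
  rfl

def cd (p : Fin 3 × Fin 3) : I := ⟨3 * p.1.val + p.2.val, by omega⟩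
def dv (a : I) : Fin 3 := ⟨a.val / 3, by omega⟩
def md (a : I) : Fin 3 := ⟨a.val % 3, by omega⟩
theorem TZ_cd (p q r) : TZ (cd p) (cd q) (cd r) = epsZ p.1.val q.1.val r.1.val * epsZ p.2.val q.2.val r.2.val := by
  have h1 : ∀ p, (cd p).val / 3 = p.1.val := fun p => by show (3 * p.1.val + p.2.val) / 3 = p.1.val; omega
  have h2 : ∀ p, (cd p).val % 3 = p.2.val := fun p => by show (3 * p.1.val + p.2.val) % 3 = p.2.val; omega
  unfold TZ
  rw [h1, h1, h1, h2, h2, h2]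

theorem kron_T9 : kron skewCW2 skewCW2 = reidx cd cd (fun p => cd (pm p.1, pm p.2))
    (fun j => (sgA j.1 * sgA j.2 : ℂ)) (fun k => (sgB k.1 * sgB k.2 : ℂ)) T9 := by
  funext i j k
  simp only [kron, reidx, T9, TZ_cd, skZ_eq, sk1]
  push_cast
  ring
theorem T9_kron : T9 = reidx (fun a => (dv a, md a)) (fun a => (dv a, md a)) (fun a => (pm (dv a), pm (md a)))
    (fun j => (sgA (dv j) * sgA (md j) : ℂ)) (fun k => (sgB (pm (dv k)) * sgB (pm (md k)) : ℂ))
    (kron skewCW2 skewCW2) := by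
  funext i j k
  have h := sk2 (dv i) (dv j) (dv k)
  have h' := sk2 (md i) (md j) (md k)
  have e : TZ i j k = epsZ (dv i).val (dv j).val (dv k).val * epsZ (md i).val (md j).val (md k).val := rfl
  simp only [kron, reidx, T9, skZ_eq, e, h, h']
  push_cast
  ring

/-! ### lower bound 17 -/
theorem T9_not : T9 ∉ closure {S : I → I → I → ℂ | rankLE S 16} := by
  intro h
  refine T0_not ?_
  refine map_mem_closure (f := fun (S : I → I → I → ℂ) (p : I × I × I) => S p.1 p.2.1 p.2.2) ?_ h ?_
  · fun_prop
  · rintro S ⟨u, v, w, rfl⟩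
    refine ⟨u, v, w, ?_⟩
    funext p
    simp only [TT, Finset.sum_apply, ten3_apply, ten2]
    exact Finset.sum_congr rfl fun l _ => by ring

/-! ### upper bound 17 -/
def L29 : List (I × I × I) := [(0, 0, 0), (0, 0, 5), (0, 0, 7), (0, 1, 1), (0, 1, 6), (0, 2, 2), (0, 2, 3), (0, 3, 3),
  (0, 4, 4), (0, 4, 8), (0, 5, 5), (0, 5, 7), (0, 6, 6), (0, 7, 7), (0, 8, 8), (1, 1, 5), (1, 1, 7), (1, 2, 4),
  (1, 2, 8), (1, 3, 4), (1, 3, 8), (1, 5, 6), (1, 6, 7), (2, 2, 5), (2, 2, 7), (2, 3, 5), (2, 3, 7), (2, 4, 6),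
  (2, 6, 8)]
theorem L29_MM : ∀ p ∈ L29, MM p.1 p.2.1 p.2.2 = T9 p.1 p.2.1 p.2.2 := by
  have e : ∀ (i j k : I) (n : ℤ), MM i j k = n → TZ i j k = n → MM i j k = T9 i j k := by
    intro i j k n h1 h2
    rw [h1, T9, h2]
  simp only [L29, List.forall_mem_cons, List.not_mem_nil, false_imp_iff, implies_true, and_true]
  refine ⟨?_, ?_, ?_, ?_, ?_, ?_, ?_, ?_, ?_, ?_, ?_, ?_, ?_, ?_, ?_, ?_, ?_, ?_, ?_, ?_, ?_, ?_, ?_, ?_, ?_, ?_, ?_,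
    ?_, ?_⟩
  · exact e _ _ _ 0 (by rw [M000]; norm_num) (by decide)
  · exact e _ _ _ 0 (by rw [M005]; norm_num) (by decide)
  · exact e _ _ _ 0 (by rw [M007]; norm_num) (by decide)
  · exact e _ _ _ 0 (by rw [M011]; norm_num) (by decide)
  · exact e _ _ _ 0 (by rw [M016]; norm_num) (by decide)
  · exact e _ _ _ 0 (by rw [M022]; norm_num) (by decide)
  · exact e _ _ _ 0 (by rw [M023]; norm_num) (by decide)
  · exact e _ _ _ 0 (by rw [M033]; norm_num) (by decide)
  · exact e _ _ _ 0 (by rw [M044]; norm_num) (by decide)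
  · exact e _ _ _ 1 (by rw [M048]; norm_num) (by decide)
  · exact e _ _ _ 0 (by rw [M055]; norm_num) (by decide)
  · exact e _ _ _ (-1) (by rw [M057]; norm_num) (by decide)
  · exact e _ _ _ 0 (by rw [M066]; norm_num) (by decide)
  · exact e _ _ _ 0 (by rw [M077]; norm_num) (by decide)
  · exact e _ _ _ 0 (by rw [M088]; norm_num) (by decide)
  · exact e _ _ _ 0 (by rw [M115]; norm_num) (by decide)
  · exact e _ _ _ 0 (by rw [M117]; norm_num) (by decide)
  · exact e _ _ _ 0 (by rw [M124]; norm_num) (by decide)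
  · exact e _ _ _ 0 (by rw [M128]; norm_num) (by decide)
  · exact e _ _ _ 0 (by rw [M134]; norm_num) (by decide)
  · exact e _ _ _ (-1) (by rw [M138]; norm_num) (by decide)
  · exact e _ _ _ 1 (by rw [M156]; norm_num) (by decide)
  · exact e _ _ _ 0 (by rw [M167]; norm_num) (by decide)
  · exact e _ _ _ 0 (by rw [M225]; norm_num) (by decide)
  · exact e _ _ _ 0 (by rw [M227]; norm_num) (by decide)
  · exact e _ _ _ 0 (by rw [M235]; norm_num) (by decide)
  · exact e _ _ _ 1 (by rw [M237]; norm_num) (by decide)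
  · exact e _ _ _ (-1) (by rw [M246]; norm_num) (by decide)
  · exact e _ _ _ 0 (by rw [M268]; norm_num) (by decide)

def inL (i j k : I) : Bool := L29.contains (i, j, k)
theorem inL_MM (i j k : I) (h : inL i j k = true) : MM i j k = T9 i j k :=
  L29_MM (i, j, k) (List.contains_iff_mem.1 h)
/-- some permutation of the triple is listed -/
def anyL (i j k : I) : Bool := inL i j k || inL i k j || inL j i k || inL j k i || inL k i j || inL k j i
theorem anyL_all : ∀ i j k : I, (i.val < 3 ∨ j.val < 3 ∨ k.val < 3) → triv i j k = true → anyL i j k = true := by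
  decide +kernel
theorem L29_triv : ∀ i j k : I, (i.val < 3 ∨ j.val < 3 ∨ k.val < 3) → triv i j k = false → TZ i j k = 0 := by
  decide +kernel
theorem TZ_12 : ∀ i j k : I, TZ i j k = TZ j i k := by decide +kernel
theorem MM_12 (i j k : I) : MM i j k = MM j i k := by
  unfold MM; exact Finset.sum_congr rfl fun o _ => by ring
theorem MM_23 (i j k : I) : MM i j k = MM i k j := by
  unfold MM; exact Finset.sum_congr rfl fun o _ => by ring

theorem SS_T9 (i j k : I) (h : i.val < 3 ∨ j.val < 3 ∨ k.val < 3) : SS i j k = T9 i j k := by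
  rw [SS_eq]
  have t12 : ∀ i j k, T9 i j k = T9 j i k := fun i j k => by unfold T9; rw [TZ_12]
  have t23 : ∀ i j k, T9 i j k = T9 i k j := fun i j k => by unfold T9; rw [TZ_sym23]
  by_cases ht : triv i j k = true
  · rw [if_pos ht]
    have h' := anyL_all i j k h ht
    simp only [anyL, Bool.or_eq_true] at h'
    rcases h' with ((((h | h) | h) | h) | h) | h
    · exact inL_MM i j k h
    · exact (MM_23 i j k).trans ((inL_MM i k j h).trans (t23 i k j))
    · exact (MM_12 i j k).trans ((inL_MM j i k h).trans (t12 j i k))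
    · exact (MM_12 i j k).trans ((MM_23 j i k).trans ((inL_MM j k i h).trans ((t23 j k i).trans (t12 j i k))))
    · exact (MM_23 i j k).trans ((MM_12 i k j).trans ((inL_MM k i j h).trans ((t12 k i j).trans (t23 i k j))))
    · exact (MM_12 i j k).trans ((MM_23 j i k).trans ((MM_12 j k i).trans ((inL_MM k j i h).trans
        ((t12 k j i).trans ((t23 j k i).trans (t12 j i k))))))
  · rw [if_neg ht, T9, L29_triv i j k h (by simpa using ht), Int.cast_zero]

def ltc (t : ℂ) (i : I) : ℂ := if i.val < 3 then (t ^ 2)⁻¹ else t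
def lt (t : ℂ) (s : Fin 17) (i : I) : ℂ := ltc t i * (sgs s i * ov (orb s) i)

def low (i : I) : ℕ := if i.val < 3 then 1 else 0
theorem TZ_lo : ∀ i j k : I, low i + low j + low k ≠ 1 → TZ i j k = 0 := by decide +kernel
theorem lt_sum (t : ℂ) (i j k : I) : (∑ s, (oc (orb s) / osz (orb s) * lt t s i) * lt t s j * lt t s k) =
    ltc t i * ltc t j * ltc t k * SS i j k := by
  unfold SS lt
  rw [Finset.mul_sum]
  exact Finset.sum_congr rfl fun s _ => by ring

theorem T9_mem : T9 ∈ closure {S : I → I → I → ℂ | rankLE S 17} := by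
  have hl : Tendsto (fun (t : ℂ) (i j k : I) => T9 i j k + t ^ 3 * (if i.val < 3 ∨ j.val < 3 ∨ k.val < 3 then 0 else
      SS i j k - T9 i j k)) (𝓝[≠] 0) (𝓝 T9) := by
    have hc : Continuous (fun (t : ℂ) (i j k : I) => T9 i j k + t ^ 3 * (if i.val < 3 ∨ j.val < 3 ∨ k.val < 3 then 0 else
      SS i j k - T9 i j k)) := by fun_prop
    have := hc.tendsto 0
    simp only [ne_eq, OfNat.ofNat_ne_zero, not_false_eq_true, zero_pow, zero_mul, add_zero] at this
    exact this.mono_left nhdsWithin_le_nhds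
  refine mem_closure_of_tendsto hl ?_
  filter_upwards [self_mem_nhdsWithin] with t ht
  have ht : t ≠ 0 := ht
  refine ⟨fun s i => oc (orb s) / osz (orb s) * lt t s i, lt t, lt t, ?_⟩
  funext i j k
  rw [lt_sum]
  have hz : low i + low j + low k ≠ 1 → T9 i j k = 0 := fun h => by rw [T9, TZ_lo i j k h, Int.cast_zero]
  by_cases hc : i.val < 3 ∨ j.val < 3 ∨ k.val < 3
  · rw [if_pos hc, SS_T9 i j k hc]
    by_cases h1 : low i + low j + low k = 1
    · have : ltc t i * ltc t j * ltc t k = 1 := by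
        unfold ltc
        unfold low at h1
        split_ifs at h1 ⊢ <;> first | omega | (field_simp)
      rw [this]; ring
    · rw [hz h1]; ring
  · rw [if_neg hc]
    push Not at hc
    rw [hz (by unfold low; split_ifs <;> omega)]
    unfold ltc
    rw [if_neg (by omega), if_neg (by omega), if_neg (by omega)]
    ring
end BR

namespace BR
open Module Filter Topology

/-! ### border rank of the small tensor is five -/
def q5u : Fin 5 → Fin 3 → ℤ := ![![0,1,1], ![1,1,0], ![0,2,0], ![0,-1,1], ![1,-1,0]]
def q5v : Fin 5 → Fin 3 → ℤ := ![![1,-1,0], ![0,1,-1], ![-1,0,1], ![1,1,0], ![0,1,1]]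
def q5w : Fin 5 → Fin 3 → ℤ := ![![1,1,0], ![0,1,1], ![1,0,1], ![-1,1,0], ![0,-1,1]]
theorem q5 : ∀ i j k : Fin 3, 2 * epsZ i.val j.val k.val = ∑ l, q5u l i * q5v l j * q5w l k := by decide +kernel

theorem E3_mem : E3 ∈ closure {S : Fin 3 → Fin 3 → Fin 3 → ℂ | rankLE S 5} := by
  refine subset_closure ⟨fun l i => (q5u l i : ℂ) / 2, fun l j => (q5v l j : ℂ), fun l k => (q5w l k : ℂ), ?_⟩
  funext i j k
  have h : (2 * epsZ i.val j.val k.val : ℂ) = ∑ l, (q5u l i * q5v l j * q5w l k : ℂ) := by exact_mod_cast q5 i j k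
  have h2 : ∑ l, (q5u l i : ℂ) / 2 * q5v l j * q5w l k = (∑ l, (q5u l i * q5v l j * q5w l k : ℂ)) / 2 := by
    rw [Finset.sum_div]
    exact Finset.sum_congr rfl fun l _ => by ring
  rw [h2, ← h, E3]
  ring

/-- the Koszul flattening -/
def KN (T : Fin 3 → Fin 3 → Fin 3 → ℂ) : Matrix (Fin 3 × Fin 3) (Fin 3 × Fin 3) ℂ :=
  fun p q => ∑ a, (epsZ a.val p.1.val q.1.val : ℂ) * T a p.2 q.2

theorem koz (u : Fin 3 → ℂ) : ∃ g : (Fin 3 → ℂ) →ₗ[ℂ] (Fin 2 → ℂ), ∀ y, g y = 0 → ∀ p q, u p * y q = u q * y p := by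
  by_cases h : u = 0
  · exact ⟨0, fun y _ p q => by simp [h]⟩
  obtain ⟨m, hm⟩ := Function.ne_iff.1 h
  simp only [Pi.zero_apply] at hm
  refine ⟨LinearMap.pi fun e => u m • LinearMap.proj (m + 1 + (if e = 0 then 0 else 1)) -
    u (m + 1 + (if e = 0 then 0 else 1)) • LinearMap.proj m, fun y hy => ?_⟩
  have h0 := congrFun hy 0
  have h1 := congrFun hy 1
  simp at h0 h1
  have key : ∀ r, u m * y r = u r * y m := by
    intro r
    have : ∀ m r : Fin 3, r = m ∨ r = m + 1 ∨ r = m + 1 + 1 := by decide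
    rcases this m r with rfl | rfl | rfl
    · rfl
    · linear_combination h0
    · linear_combination h1
  intro p q
  apply mul_left_cancel₀ hm
  linear_combination u p * key q - u q * key p

theorem epsZ_anti : ∀ a p q : Fin 3, epsZ a.val p.val q.val = - epsZ q.val p.val a.val := by decide

theorem KN_det {S : Fin 3 → Fin 3 → Fin 3 → ℂ} (hS : rankLE S 4) : (KN S).det = 0 := by
  obtain ⟨u, v, w, rfl⟩ := hS
  choose g hg using fun l => koz (u l)
  let Y : Fin 4 → ((Fin 3 × Fin 3 → ℂ) →ₗ[ℂ] (Fin 3 → ℂ)) := fun l =>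
    LinearMap.pi fun q => ∑ k, w l k • LinearMap.proj (q, k)
  let F : (Fin 3 × Fin 3 → ℂ) →ₗ[ℂ] (Fin 4 → Fin 2 → ℂ) := LinearMap.pi fun l => (g l).comp (Y l)
  have hk : LinearMap.ker F ≠ ⊥ := LinearMap.ker_ne_bot_of_finrank_lt (by simp [Module.finrank_pi_fintype])
  obtain ⟨x, hx, hx0⟩ := (Submodule.ne_bot_iff _).1 hk
  refine Matrix.exists_mulVec_eq_zero_iff.1 ⟨x, hx0, ?_⟩
  have hF : ∀ l, g l (Y l x) = 0 := fun l => congrFun (LinearMap.mem_ker.1 hx) l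
  have hY : ∀ l q, Y l x q = ∑ k, w l k * x (q, k) := fun l q => by simp [Y]
  have hz : ∀ l, ∀ p : Fin 3, ∑ a : Fin 3, ∑ q : Fin 3, (epsZ a.val p.val q.val : ℂ) * (u l a * Y l x q) = 0 := by
    intro l p
    have hs : ∑ a, ∑ q : Fin 3, (epsZ a.val p.val q.val : ℂ) * (u l a * Y l x q) =
        - ∑ a, ∑ q : Fin 3, (epsZ a.val p.val q.val : ℂ) * (u l a * Y l x q) := by
      conv_lhs => rw [Finset.sum_comm]
      rw [← Finset.sum_neg_distrib]
      refine Finset.sum_congr rfl fun a _ => ?_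
      rw [← Finset.sum_neg_distrib]
      refine Finset.sum_congr rfl fun q _ => ?_
      rw [epsZ_anti q p a, hg l _ (hF l) q a]
      push_cast
      ring
    exact self_eq_neg.1 hs
  funext p
  obtain ⟨p, j⟩ := p
  have : (KN (fun i j k => ∑ l, u l i * v l j * w l k)).mulVec x (p, j) =
      ∑ l, v l j * ∑ a, ∑ q : Fin 3, (epsZ a.val p.val q.val : ℂ) * (u l a * Y l x q) := by
    simp only [hY, Matrix.mulVec, dotProduct, KN, Fintype.sum_prod_type, Fin.sum_univ_three, Fin.sum_univ_four]
    ring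
  rw [this]
  simp only [hz, mul_zero, Finset.sum_const_zero, Pi.zero_apply]

theorem KN_E3 : (KN E3).det ≠ 0 := by
  intro h
  obtain ⟨x, hx0, hx⟩ := Matrix.exists_mulVec_eq_zero_iff.2 h
  apply hx0
  have e : ∀ p j, (if p = j then x (0, 0) + x (1, 1) + x (2, 2) else 0) - x (j, p) = 0 := by
    intro p j
    have := congrFun hx (p, j)
    rw [Pi.zero_apply] at this
    refine Eq.trans ?_ this
    simp only [Matrix.mulVec, dotProduct, KN, Fintype.sum_prod_type, Fin.sum_univ_three, E3]
    fin_cases p <;> fin_cases j <;> simp [epsZ] <;> try ring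
  have hd := e 0 0
  have hd1 := e 1 1
  have hd2 := e 2 2
  simp only [if_true] at hd hd1 hd2
  have ht : x (0, 0) + x (1, 1) + x (2, 2) = 0 := by linear_combination (hd + hd1 + hd2) / 2
  funext p
  obtain ⟨p, j⟩ := p
  have := e j p
  rw [ht, ite_self] at this
  simpa using this

theorem E3_not : E3 ∉ closure {S : Fin 3 → Fin 3 → Fin 3 → ℂ | rankLE S 4} := by
  intro h
  have hc : IsClosed {S : Fin 3 → Fin 3 → Fin 3 → ℂ | (KN S).det = 0} := by
    refine isClosed_eq (Continuous.matrix_det ?_) continuous_const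
    unfold KN
    refine continuous_matrix fun p q => ?_
    fun_prop
  exact KN_E3 (closure_minimal (fun S hS => KN_det hS) hc h)

theorem br_skew : brank skewCW2 = 5 := by
  refine brank_eq (r := 4) ?_ fun h => E3_not ?_
  · rw [skew_E3]; exact closure_reidx _ _ _ _ _ E3_mem
  · rw [E3_skew]; exact closure_reidx _ _ _ _ _ h

theorem br_kron : brank (kron skewCW2 skewCW2) = 17 := by
  refine brank_eq (r := 16) ?_ fun h => T9_not ?_
  · rw [kron_T9]; exact closure_reidx _ _ _ _ _ T9_mem
  · rw [T9_kron]; exact closure_reidx _ _ _ _ _ h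
end BR

/-- `BR(T_{skewcw,2}) = 5`, `BR(T_{skewcw,2} ⊠ T_{skewcw,2}) = 17`, and in
particular the border rank of the Kronecker square is strictly less than
`BR(T_{skewcw,2})² = 25`. -/
theorem borderRank_skewCW2_kron_square :
    brank skewCW2 = 5 ∧ brank (kron skewCW2 skewCW2) = 17 ∧
      brank (kron skewCW2 skewCW2) < (brank skewCW2) ^ 2 ∧ (brank skewCW2) ^ 2 = 25 := by
  rw [BR.br_skew, BR.br_kron]
  norm_num

end
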